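/- arXiv:1708.05381 — 6 statements merged into one kernel-verified Lean document; each statement's English description precedes it below -/
import Mathlib

section
/- There exists exactly one slit-plane Green's function; that is, there is one and only one function g : ℤ² → ℝ satisfying conditions (i)–(vi). -/
/-- `g` is a slit-plane Green's function: the voltage `G_H` on the half-plane square
lattice `{(x,y) : y ≥ 0, x+y even}` with Dirichlet boundary on the negative `x`-axis,
reflecting boundary on the positive `x`-axis, and one unit of current inserted at the
origin. -/
def IsSlitGreen (g : ℤ × ℤ → ℝ) : Prop :=
  -- g vanishes off the half-plane lattice
  (∀ x y : ℤ, (y < 0 ∨ Odd (x + y)) → g (x, y) = 0) ∧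
  -- (i) Dirichlet boundary on the negative x-axis
  (∀ x : ℤ, x < 0 → g (x, 0) = 0) ∧
  -- (ii) harmonicity off the x-axis
  (∀ x y : ℤ, 1 ≤ y → Even (x + y) →
    4 * g (x, y) =
      g (x - 1, y - 1) + g (x + 1, y - 1) + g (x - 1, y + 1) + g (x + 1, y + 1)) ∧
  -- (iii) reflecting boundary on the positive x-axis
  (∀ x : ℤ, 0 < x → Even x → 2 * g (x, 0) = g (x - 1, 1) + g (x + 1, 1)) ∧
  -- (iv) one unit of current inserted at the origin
  (2 * g (0, 0) - g (1, 1) - g (-1, 1) = 1) ∧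
  -- (v) values between 0 and 1
  (∀ x y : ℤ, 0 ≤ g (x, y) ∧ g (x, y) ≤ 1) ∧
  -- (vi) decay at infinity
  (∀ ε : ℝ, 0 < ε → ∃ N : ℕ, ∀ x y : ℤ, (N : ℤ) ≤ |x| + |y| → |g (x, y)| < ε)

lemma le_of_forall_isMax_shift {f : ℤ × ℤ → ℝ} {C : ℝ} (hC : 0 ≤ C)
    (hf : ∀ ε : ℝ, 0 < ε → ∃ N : ℕ, ∀ x y : ℤ, (N : ℤ) ≤ |x| + |y| → |f (x, y)| < ε)
    (hshift : ∀ x y : ℤ, C < f (x, y) → (∀ q, f q ≤ f (x, y)) → f (x + 1, y + 1) = f (x, y))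
    (p : ℤ × ℤ) : f p ≤ C := by
  by_contra! hp
  obtain ⟨N, hN⟩ := hf (f p) (hC.trans_lt hp)
  have key : ∀ q : ℤ × ℤ, f p ≤ f q → q ∈ Finset.Icc (-(N : ℤ)) N ×ˢ Finset.Icc (-(N : ℤ)) N := by
    rintro ⟨x, y⟩ hq
    by_contra hmem
    have : (N : ℤ) ≤ |x| + |y| := by
      by_contra! h
      apply hmem
      simp only [Finset.mem_product, Finset.mem_Icc]
      have := abs_nonneg x
      have := abs_nonneg y
      exact ⟨abs_le.1 (by omega), abs_le.1 (by omega)⟩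
    exact absurd (hN x y this) (not_lt.2 (hq.trans (le_abs_self _)))
  obtain ⟨m, -, hm⟩ := Finset.exists_max_image _ f ⟨p, key p le_rfl⟩
  have hpm : f p ≤ f m := hm p (key p le_rfl)
  have hmax : ∀ q, f q ≤ f m := fun q => by
    rcases le_total (f p) (f q) with h | h
    · exact hm q (key q h)
    · exact h.trans hpm
  have hdiag : ∀ n : ℕ, f (m.1 + n, m.2 + n) = f m := by
    intro n
    induction n with
    | zero => simp
    | succ n ih =>
      have := hshift (m.1 + n) (m.2 + n) (by rw [ih]; exact hp.trans_le hpm)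
        (fun q => by rw [ih]; exact hmax q)
      rw [ih] at this
      rw [← this]
      push_cast
      simp only [add_assoc]
  have h1 := key (m.1 + ((2 * N + 1 : ℕ) : ℤ), m.2 + ((2 * N + 1 : ℕ) : ℤ))
    (by rw [hdiag]; exact hpm)
  have h2 := key m hpm
  simp only [Finset.mem_product, Finset.mem_Icc] at h1 h2
  push_cast at h1
  omega

lemma slit_le_of_subharmonic {f : ℤ × ℤ → ℝ} {C : ℝ} (hC : 0 ≤ C)
    (hoff : ∀ x y : ℤ, (y < 0 ∨ Odd (x + y)) → f (x, y) = 0)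
    (hneg : ∀ x : ℤ, x < 0 → f (x, 0) = 0)
    (hharm : ∀ x y : ℤ, 1 ≤ y → Even (x + y) →
      4 * f (x, y) =
        f (x - 1, y - 1) + f (x + 1, y - 1) + f (x - 1, y + 1) + f (x + 1, y + 1))
    (hrefl : ∀ x : ℤ, 0 < x → Even x → 2 * f (x, 0) = f (x - 1, 1) + f (x + 1, 1))
    (hzero : C < f (0, 0) → 2 * f (0, 0) ≤ f (-1, 1) + f (1, 1))
    (hf : ∀ ε : ℝ, 0 < ε → ∃ N : ℕ, ∀ x y : ℤ, (N : ℤ) ≤ |x| + |y| → |f (x, y)| < ε)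
    (p : ℤ × ℤ) : f p ≤ C := by
  refine le_of_forall_isMax_shift hC hf (fun x y hxy hmax => ?_) p
  have hne : f (x, y) ≠ 0 := (hC.trans_lt hxy).ne'
  have hnot : ¬ (y < 0 ∨ Odd (x + y)) := fun h => hne (hoff x y h)
  push Not at hnot
  obtain ⟨hy, hpar⟩ := hnot
  rw [Int.not_odd_iff_even] at hpar
  refine le_antisymm (hmax _) ?_
  rcases hy.eq_or_lt with rfl | hy
  · have hx : 0 ≤ x := by
      by_contra! h
      exact hne (hneg x h)
    have h1 := hmax (x - 1, 1)
    rcases hx.eq_or_lt with rfl | hx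
    · have h2 := hzero hxy
      norm_num at h1 h2 ⊢
      linarith
    · have h2 := hrefl x hx (by simpa using hpar)
      norm_num
      linarith
  · have := hharm x y hy hpar
    linarith [hmax (x - 1, y - 1), hmax (x + 1, y - 1), hmax (x - 1, y + 1)]

section Integrals
open Real intervalIntegral MeasureTheory Filter Topology
open scoped FourierTransform

lemma hasDerivAt_arcsin_sin_sub_cos {φ : ℝ} (hφ : φ ∈ Set.Ioo 0 π) :
    HasDerivAt (fun t => arcsin (sin (t / 2) - cos (t / 2)))
      (sin (1 / 2 * φ + π / 4) / √(sin φ) / √2) φ := by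
  have hs : 0 < sin φ := sin_pos_of_mem_Ioo hφ
  have hsq : 1 - (sin (φ / 2) - cos (φ / 2)) ^ 2 = sin φ := by
    have h := sin_two_mul (φ / 2)
    rw [mul_div_cancel₀ _ (two_ne_zero' ℝ)] at h
    nlinarith [sin_sq_add_cos_sq (φ / 2)]
  have hlt : (sin (φ / 2) - cos (φ / 2)) ^ 2 < 1 := by linarith
  have h1 : sin (φ / 2) - cos (φ / 2) ≠ -1 := by
    intro h; rw [h] at hlt; norm_num at hlt
  have h2 : sin (φ / 2) - cos (φ / 2) ≠ 1 := by
    intro h; rw [h] at hlt; norm_num at hlt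
  have hd : HasDerivAt (fun t : ℝ => t / 2) (1 / 2) φ := (hasDerivAt_id φ).div_const 2
  have hu := hd.sin.sub hd.cos
  have := (hasDerivAt_arcsin h1 h2).comp φ hu
  refine this.congr_deriv ?_
  rw [hsq, sin_add, cos_pi_div_four, sin_pi_div_four, show 1 / 2 * φ = φ / 2 by ring]
  have : 0 < √(sin φ) := sqrt_pos.2 hs
  field_simp
  ring

lemma continuous_arcsin_sin_sub_cos :
    Continuous (fun t : ℝ => arcsin (sin (t / 2) - cos (t / 2))) := by
  fun_prop

lemma inv_sqrt_two_le_sin {φ : ℝ} (hφ : φ ∈ Set.Icc 0 π) :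
    √2 / 2 ≤ sin (1 / 2 * φ + π / 4) := by
  rw [← cos_pi_div_four, ← cos_pi_div_two_sub, ← cos_abs (π / 2 - _)]
  apply cos_le_cos_of_nonneg_of_le_pi (abs_nonneg _) (by linarith [pi_pos])
  rw [abs_le]
  constructor <;> linarith [hφ.1, hφ.2]

lemma intervalIntegrable_sin_div_sqrt_sin :
    IntervalIntegrable (fun φ => sin (1 / 2 * φ + π / 4) / √(sin φ) / √2) volume 0 π := by
  refine intervalIntegrable_deriv_of_nonneg continuous_arcsin_sin_sub_cos.continuousOn ?_ ?_
  · intro φ hφ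
    rw [min_eq_left pi_pos.le, max_eq_right pi_pos.le] at hφ
    exact hasDerivAt_arcsin_sin_sub_cos hφ
  · intro φ hφ
    rw [min_eq_left pi_pos.le, max_eq_right pi_pos.le] at hφ
    have := inv_sqrt_two_le_sin (Set.Ioo_subset_Icc_self hφ)
    have : 0 ≤ sin (1 / 2 * φ + π / 4) := le_trans (by positivity) this
    positivity

lemma intervalIntegrable_inv_sqrt_sin :
    IntervalIntegrable (fun φ => (√(sin φ))⁻¹) volume 0 π := by
  refine (intervalIntegrable_sin_div_sqrt_sin.const_mul 2).mono_fun ?_ ?_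
  · exact (Measurable.aestronglyMeasurable (by fun_prop))
  · rw [EventuallyLE, ae_restrict_iff' measurableSet_uIoc]
    refine Eventually.of_forall fun φ hφ => ?_
    rw [Set.uIoc_of_le pi_pos.le] at hφ
    have h := inv_sqrt_two_le_sin (Set.Ioc_subset_Icc_self hφ)
    have h0 : 0 ≤ sin (1 / 2 * φ + π / 4) := le_trans (by positivity) h
    rw [norm_of_nonneg (by positivity), norm_of_nonneg (by positivity)]
    have h2 : 1 ≤ 2 * sin (1 / 2 * φ + π / 4) / √2 := by
      rw [le_div_iff₀ (by positivity)]; linarith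
    calc (√(sin φ))⁻¹ ≤ (2 * sin (1 / 2 * φ + π / 4) / √2) * (√(sin φ))⁻¹ :=
          le_mul_of_one_le_left (by positivity) h2
      _ = _ := by ring

lemma intervalIntegrable_continuousOn_div_sqrt_sin {f : ℝ → ℝ}
    (hf : ContinuousOn f (Set.Icc 0 π)) :
    IntervalIntegrable (fun φ => f φ / √(sin φ)) volume 0 π := by
  simp only [div_eq_mul_inv]
  exact intervalIntegrable_inv_sqrt_sin.continuousOn_mul (by rwa [Set.uIcc_of_le pi_pos.le])

lemma integral_sin_half_div_sqrt_sin :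
    ∫ φ in 0..π, sin (1 / 2 * φ + π / 4) / √(sin φ) = √2 * π := by
  have := integral_eq_sub_of_hasDerivAt_of_le pi_pos.le
    continuous_arcsin_sin_sub_cos.continuousOn
    (fun φ hφ => hasDerivAt_arcsin_sin_sub_cos hφ) intervalIntegrable_sin_div_sqrt_sin
  rw [intervalIntegral.integral_div] at this
  have h2 : √2 ≠ 0 := by positivity
  rw [div_eq_iff h2] at this
  rw [this]
  simp
  ring

lemma integral_sin_div_sqrt_sin_rec (b c : ℝ) :
    (1 / 2 + b) * (∫ φ in 0..π, sin ((b + 1) * φ + c) / √(sin φ)) +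
      (1 / 2 - b) * (∫ φ in 0..π, sin ((b - 1) * φ + c) / √(sin φ)) = 0 := by
  have hi (b' : ℝ) : IntervalIntegrable (fun φ => sin (b' * φ + c) / √(sin φ)) volume 0 π :=
    intervalIntegrable_continuousOn_div_sqrt_sin (by fun_prop)
  have hint := ((hi (b + 1)).const_mul (1 / 2 + b)).add ((hi (b - 1)).const_mul (1 / 2 - b))
  have := integral_eq_sub_of_hasDerivAt_of_le (f := fun φ => 2 * (√(sin φ) * sin (b * φ + c)))
    pi_pos.le (by fun_prop) (fun φ hφ => ?_) hint
  · rw [integral_add ((hi (b + 1)).const_mul _) ((hi (b - 1)).const_mul _),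
      intervalIntegral.integral_const_mul, intervalIntegral.integral_const_mul] at this
    rw [this]
    simp
  · have hs : 0 < sin φ := sin_pos_of_mem_Ioo hφ
    have hd : HasDerivAt (fun t : ℝ => b * t + c) b φ := by
      simpa using ((hasDerivAt_id φ).const_mul b).add_const c
    have h := (((hasDerivAt_sin φ).sqrt hs.ne').mul hd.sin).const_mul 2
    refine h.congr_deriv ?_
    have hq : 0 < √(sin φ) := sqrt_pos.2 hs
    have hqq : √(sin φ) ^ 2 = sin φ := sq_sqrt hs.le
    rw [show (b + 1) * φ + c = (b * φ + c) + φ by ring,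
      show (b - 1) * φ + c = (b * φ + c) - φ by ring, sin_add _ φ, sin_sub _ φ]
    field_simp
    rw [hqq]
    ring

lemma integral_sin_div_sqrt_sin_eq_zero (c : ℝ) (m : ℕ) :
    ∫ φ in 0..π, sin ((2 * m + 3 / 2) * φ + c) / √(sin φ) = 0 := by
  induction m with
  | zero =>
    have := integral_sin_div_sqrt_sin_rec (1 / 2) c
    norm_num at this ⊢
    exact this
  | succ m ih =>
    have := integral_sin_div_sqrt_sin_rec (2 * m + 5 / 2) c
    rw [show (2 * (m : ℝ) + 5 / 2 - 1) = 2 * m + 3 / 2 by ring, ih, mul_zero, add_zero] at this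
    push_cast
    rw [show (2 * ((m : ℝ) + 1) + 3 / 2) = 2 * m + 5 / 2 + 1 by ring]
    exact (mul_eq_zero.1 this).resolve_left (by positivity)


/-- The unnormalised Fourier integral of the Green's function of the slit plane. -/
noncomputable def slitIntegral (x : ℤ) (n : ℕ) : ℝ :=
  ∫ φ in 0..π, cos ((x + 1 / 2) * φ - π / 4) * (cos φ / (1 + sin φ)) ^ n / √(sin φ)

lemma one_add_sin_pos {φ : ℝ} (hφ : φ ∈ Set.Icc 0 π) : 0 < 1 + sin φ := by
  linarith [sin_nonneg_of_mem_Icc hφ]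

lemma continuousOn_cos_div_one_add_sin :
    ContinuousOn (fun φ => cos φ / (1 + sin φ)) (Set.Icc 0 π) :=
  continuousOn_cos.div (by fun_prop) fun _ hφ => (one_add_sin_pos hφ).ne'

lemma intervalIntegrable_slitIntegrand (x : ℤ) (n : ℕ) :
    IntervalIntegrable
      (fun φ => cos ((x + 1 / 2) * φ - π / 4) * (cos φ / (1 + sin φ)) ^ n / √(sin φ))
      volume 0 π :=
  intervalIntegrable_continuousOn_div_sqrt_sin
    (ContinuousOn.mul (by fun_prop) (continuousOn_cos_div_one_add_sin.pow n))

lemma cos_mul_one_add_sq {φ : ℝ} (hφ : φ ∈ Set.Icc 0 π) :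
    cos φ * (1 + (cos φ / (1 + sin φ)) ^ 2) = 2 * (cos φ / (1 + sin φ)) := by
  have := one_add_sin_pos hφ
  field_simp
  linear_combination cos φ * sin_sq_add_cos_sq φ

lemma cos_mul_cos_div_one_add_sin {φ : ℝ} (hφ : φ ∈ Set.Icc 0 π) :
    cos φ * (cos φ / (1 + sin φ)) = 1 - sin φ := by
  have := one_add_sin_pos hφ
  field_simp
  linear_combination sin_sq_add_cos_sq φ

lemma cos_pred_add_cos_succ (x : ℤ) (φ : ℝ) :
    cos (((x - 1 : ℤ) + 1 / 2) * φ - π / 4) + cos (((x + 1 : ℤ) + 1 / 2) * φ - π / 4) =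
      2 * cos φ * cos ((x + 1 / 2) * φ - π / 4) := by
  push_cast
  rw [show ((x : ℝ) - 1 + 1 / 2) * φ - π / 4 = ((x + 1 / 2) * φ - π / 4) - φ by ring,
    show ((x : ℝ) + 1 + 1 / 2) * φ - π / 4 = ((x + 1 / 2) * φ - π / 4) + φ by ring,
    cos_add _ φ, cos_sub _ φ]
  ring

lemma slitIntegral_harmonic (x : ℤ) (n : ℕ) :
    4 * slitIntegral x (n + 1) =
      slitIntegral (x - 1) n + slitIntegral (x + 1) n +
        slitIntegral (x - 1) (n + 2) + slitIntegral (x + 1) (n + 2) := by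
  have hi := intervalIntegrable_slitIntegrand
  unfold slitIntegral
  rw [← intervalIntegral.integral_const_mul, ← integral_add (hi _ _) (hi _ _),
    ← integral_add ((hi _ _).add (hi _ _)) (hi _ _),
    ← integral_add (((hi _ _).add (hi _ _)).add (hi _ _)) (hi _ _)]
  refine integral_congr fun φ hφ => ?_
  rw [Set.uIcc_of_le pi_pos.le] at hφ
  have h1 := cos_mul_one_add_sq hφ
  have h2 := cos_pred_add_cos_succ x φ
  set l := cos φ / (1 + sin φ)
  linear_combination (-l ^ n * (1 + l ^ 2) / √(sin φ)) * h2 -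
    (2 * cos ((x + 1 / 2) * φ - π / 4) * l ^ n / √(sin φ)) * h1

lemma slitIntegral_flux (x : ℤ) :
    2 * slitIntegral x 0 - slitIntegral (x - 1) 1 - slitIntegral (x + 1) 1 =
      (∫ φ in 0..π, sin ((x + 3 / 2) * φ + -(π / 4)) / √(sin φ)) -
        ∫ φ in 0..π, sin ((x - 1 / 2) * φ + -(π / 4)) / √(sin φ) := by
  have hi := intervalIntegrable_slitIntegrand
  have hj (b c : ℝ) : IntervalIntegrable (fun φ => sin (b * φ + c) / √(sin φ)) volume 0 π :=
    intervalIntegrable_continuousOn_div_sqrt_sin (by fun_prop)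
  unfold slitIntegral
  rw [← intervalIntegral.integral_const_mul, ← integral_sub ((hi _ _).const_mul _) (hi _ _),
    ← integral_sub (((hi _ _).const_mul _).sub (hi _ _)) (hi _ _),
    ← integral_sub (hj _ _) (hj _ _)]
  refine integral_congr fun φ hφ => ?_
  rw [Set.uIcc_of_le pi_pos.le] at hφ
  have h1 := cos_mul_cos_div_one_add_sin hφ
  have h2 := cos_pred_add_cos_succ x φ
  set l := cos φ / (1 + sin φ)
  rw [show ((x : ℝ) + 3 / 2) * φ + -(π / 4) = ((x + 1 / 2) * φ - π / 4) + φ by ring,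
    show ((x : ℝ) - 1 / 2) * φ + -(π / 4) = ((x + 1 / 2) * φ - π / 4) - φ by ring,
    sin_add _ φ, sin_sub _ φ]
  linear_combination (-l / √(sin φ)) * h2 -
    (2 * cos ((x + 1 / 2) * φ - π / 4) / √(sin φ)) * h1

lemma slitIntegral_zero_zero : slitIntegral 0 0 = √2 * π := by
  rw [← integral_sin_half_div_sqrt_sin]
  refine integral_congr fun φ _ => ?_
  simp only [pow_zero, mul_one, Int.cast_zero, zero_add]
  rw [← cos_pi_div_two_sub (1 / 2 * φ + π / 4), ← cos_neg]
  congr 2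
  ring

lemma slitIntegral_neg_even (m : ℕ) : slitIntegral (-(2 * (m + 1))) 0 = 0 := by
  rw [← integral_sin_div_sqrt_sin_eq_zero (3 * π / 4) m]
  refine integral_congr fun φ _ => ?_
  simp only [pow_zero, mul_one]
  rw [← cos_pi_div_two_sub ((2 * m + 3 / 2) * φ + 3 * π / 4)]
  push_cast
  congr 2
  ring

lemma slitIntegral_flux_zero :
    2 * slitIntegral 0 0 - slitIntegral (-1) 1 - slitIntegral 1 1 = √2 * π := by
  have h := slitIntegral_flux 0
  have h0 := integral_sin_div_sqrt_sin_eq_zero (-(π / 4)) 0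
  simp only [Nat.cast_zero, mul_zero, Int.cast_zero, zero_sub, zero_add] at h h0
  rw [h0] at h
  rw [h, ← integral_sin_half_div_sqrt_sin, zero_sub, ← intervalIntegral.integral_neg]
  refine integral_congr fun φ _ => ?_
  rw [show -(1 / 2) * φ + -(π / 4) = -(1 / 2 * φ + π / 4) by ring, sin_neg]
  ring

lemma slitIntegral_flux_even (m : ℕ) :
    2 * slitIntegral (2 * (m + 1)) 0 =
      slitIntegral (2 * (m + 1) - 1) 1 + slitIntegral (2 * (m + 1) + 1) 1 := by
  have h := slitIntegral_flux (2 * (m + 1))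
  have h0 := integral_sin_div_sqrt_sin_eq_zero (-(π / 4)) m
  have h1 := integral_sin_div_sqrt_sin_eq_zero (-(π / 4)) (m + 1)
  push_cast at h h1
  rw [h1, show (2 * ((m : ℝ) + 1) - 1 / 2) = 2 * m + 3 / 2 by ring, h0] at h
  linarith

lemma abs_cos_div_one_add_sin_lt_one {φ : ℝ} (hφ : φ ∈ Set.Ioo 0 π) :
    |cos φ / (1 + sin φ)| < 1 := by
  have hs := sin_pos_of_mem_Ioo hφ
  rw [abs_div, abs_of_pos (by linarith : 0 < 1 + sin φ), div_lt_one (by linarith)]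
  linarith [abs_cos_le_one φ]

lemma abs_slitIntegral_le (x : ℤ) (n : ℕ) :
    |slitIntegral x n| ≤ ∫ φ in 0..π, |cos φ / (1 + sin φ)| ^ n / √(sin φ) := by
  rw [← norm_eq_abs]
  refine norm_integral_le_of_norm_le pi_pos.le (Eventually.of_forall fun φ _ => ?_)
    (intervalIntegrable_continuousOn_div_sqrt_sin (continuousOn_cos_div_one_add_sin.abs.pow n))
  rw [norm_eq_abs, abs_div, abs_mul, abs_pow, abs_of_nonneg (sqrt_nonneg _)]
  gcongr
  exact mul_le_of_le_one_left (by positivity) (abs_cos_le_one _)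

lemma tendsto_integral_pow_div_sqrt_sin :
    Tendsto (fun n : ℕ => ∫ φ in 0..π, |cos φ / (1 + sin φ)| ^ n / √(sin φ)) atTop (𝓝 0) := by
  have hae : ∀ᵐ φ : ℝ, φ ∈ Set.uIoc 0 π → φ ∈ Set.Ioo 0 π := by
    filter_upwards [compl_mem_ae_iff.2 (measure_singleton π)] with φ hne hφ
    rw [Set.uIoc_of_le pi_pos.le] at hφ
    exact ⟨hφ.1, lt_of_le_of_ne hφ.2 hne⟩
  have := tendsto_integral_filter_of_dominated_convergence (μ := volume) (a := 0) (b := π)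
    (F := fun (n : ℕ) φ => |cos φ / (1 + sin φ)| ^ n / √(sin φ)) (f := fun _ => 0) (l := atTop)
    (fun φ => (√(sin φ))⁻¹) ?_ ?_ intervalIntegrable_inv_sqrt_sin ?_
  · simpa using this
  · exact Eventually.of_forall fun n => Measurable.aestronglyMeasurable (by fun_prop)
  · refine Eventually.of_forall fun n => ?_
    filter_upwards [hae] with φ hφ hmem
    rw [norm_of_nonneg (by positivity), div_eq_mul_inv]
    exact mul_le_of_le_one_left (by positivity)
      (pow_le_one₀ (abs_nonneg _) (abs_cos_div_one_add_sin_lt_one (hφ hmem)).le)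
  · filter_upwards [hae] with φ hφ hmem
    simpa using (tendsto_pow_atTop_nhds_zero_of_lt_one (abs_nonneg _)
      (abs_cos_div_one_add_sin_lt_one (hφ hmem))).div_const (√(sin φ))

lemma tendsto_slitIntegral_cofinite (n : ℕ) :
    Tendsto (fun x : ℤ => slitIntegral x n) cofinite (𝓝 0) := by
  let f : ℝ → ℂ := fun φ => Complex.exp ((1 / 2 * φ - π / 4 : ℝ) * Complex.I) *
    (((cos φ / (1 + sin φ)) ^ n : ℝ) : ℂ) * (((√(sin φ))⁻¹ : ℝ) : ℂ)
  have hw : Tendsto (fun x : ℤ => (x : ℝ) * (-(2 * π)⁻¹)) cofinite (cocompact ℝ) :=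
    (Homeomorph.mulRight₀ (-(2 * π)⁻¹) (by simp [pi_ne_zero])).isClosedEmbedding
      |>.tendsto_cocompact.comp Int.tendsto_coe_cofinite
  have hRL := (Real.tendsto_integral_exp_smul_cocompact
    ((Set.Ioc 0 π).indicator f)).comp hw
  have hre := (Complex.continuous_re.tendsto _).comp hRL
  rw [Complex.zero_re] at hre
  refine hre.congr fun x => ?_
  have hind (v : ℝ) : 𝐞 (-(v * (x * (-(2 * π)⁻¹)))) • (Set.Ioc 0 π).indicator f v =
      (Set.Ioc 0 π).indicator (fun v => Complex.exp ((x * v : ℝ) * Complex.I) * f v) v := by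
    by_cases hv : v ∈ Set.Ioc 0 π
    · rw [Set.indicator_of_mem hv, Set.indicator_of_mem hv, Circle.smul_def, smul_eq_mul,
        Real.fourierChar_apply]
      congr 4
      field_simp
    · rw [Set.indicator_of_notMem hv, Set.indicator_of_notMem hv, smul_zero]
  simp only [Function.comp_apply, hind]
  rw [MeasureTheory.integral_indicator measurableSet_Ioc, ← integral_of_le pi_pos.le, slitIntegral]
  have hint : IntervalIntegrable (fun v => Complex.exp ((x * v : ℝ) * Complex.I) * f v)
      volume 0 π := by
    have hof : IntervalIntegrable (fun φ => (((√(sin φ))⁻¹ : ℝ) : ℂ)) volume 0 π :=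
      ⟨intervalIntegrable_inv_sqrt_sin.1.ofReal, intervalIntegrable_inv_sqrt_sin.2.ofReal⟩
    simp only [f, ← mul_assoc]
    refine hof.continuousOn_mul ?_
    rw [Set.uIcc_of_le pi_pos.le]
    exact ContinuousOn.mul (by fun_prop)
      (Complex.continuous_ofReal.comp_continuousOn (continuousOn_cos_div_one_add_sin.pow n))
  have hcomm := Complex.reCLM.intervalIntegral_comp_comm hint
  rw [Complex.reCLM_apply] at hcomm
  rw [← hcomm]
  refine integral_congr fun φ _ => ?_
  simp only [f, Complex.reCLM_apply]
  rw [← mul_assoc, ← mul_assoc, ← Complex.exp_add, ← add_mul, ← Complex.ofReal_add,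
    Complex.re_mul_ofReal, Complex.re_mul_ofReal, Complex.exp_ofReal_mul_I_re, div_eq_mul_inv]
  ring_nf

lemma exists_forall_abs_slitIntegral_lt {ε : ℝ} (hε : 0 < ε) :
    ∃ N : ℕ, ∀ (x : ℤ) (n : ℕ), (N : ℤ) ≤ |x| + n → |slitIntegral x n| < ε := by
  obtain ⟨Y, hY⟩ := eventually_atTop.1 (tendsto_integral_pow_div_sqrt_sin.eventually_lt_const hε)
  have hrow (n : ℕ) : ∃ N : ℕ, ∀ x : ℤ, (N : ℤ) ≤ |x| → |slitIntegral x n| < ε := by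
    have h := (tendsto_slitIntegral_cofinite n).abs.eventually_lt_const (by simpa using hε)
    rw [Int.cofinite_eq, eventually_sup, eventually_atBot, eventually_atTop] at h
    obtain ⟨⟨a, ha⟩, b, hb⟩ := h
    refine ⟨a.natAbs + b.natAbs, fun x hx => ?_⟩
    rcases le_total 0 x with h0 | h0
    · exact hb x (by rw [abs_of_nonneg h0] at hx; omega)
    · exact ha x (by rw [abs_of_nonpos h0] at hx; omega)
  choose M hM using hrow
  refine ⟨Y + ∑ n ∈ Finset.range Y, M n, fun x n h => ?_⟩
  rcases le_or_gt Y n with hn | hn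
  · exact (abs_slitIntegral_le x n).trans_lt (hY n hn)
  · refine hM n x ?_
    have : M n ≤ ∑ n ∈ Finset.range Y, M n :=
      Finset.single_le_sum (f := M) (fun _ _ => Nat.zero_le _) (Finset.mem_range.2 hn)
    push_cast at h
    have : (M n : ℤ) ≤ ∑ n ∈ Finset.range Y, (M n : ℤ) := by exact_mod_cast this
    omega

/-- The Green's function of the slit plane. -/
noncomputable def slitGreen (p : ℤ × ℤ) : ℝ :=
  if p.2 < 0 ∨ Odd (p.1 + p.2) then 0 else slitIntegral p.1 p.2.toNat / (√2 * π)

end Integrals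

lemma slitGreen_of_off {x y : ℤ} (h : y < 0 ∨ Odd (x + y)) : slitGreen (x, y) = 0 :=
  if_pos h

lemma slitGreen_of_even {x : ℤ} {n : ℕ} (h : Even (x + n)) :
    slitGreen (x, n) = slitIntegral x n / (√2 * Real.pi) := by
  have : ¬ ((n : ℤ) < 0 ∨ Odd (x + n)) := by
    rw [not_or, Int.not_odd_iff_even]
    exact ⟨by omega, h⟩
  simp only [slitGreen, if_neg this, Int.toNat_natCast]

lemma slitGreen_neg_zero (x : ℤ) (hx : x < 0) : slitGreen (x, 0) = 0 := by
  rcases Int.even_or_odd x with h | h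
  · obtain ⟨m, rfl⟩ : ∃ m : ℕ, x = -(2 * (m + 1)) := by
      obtain ⟨k, rfl⟩ := h
      exact ⟨(-k - 1).toNat, by omega⟩
    have := slitGreen_of_even (x := -(2 * ((m : ℤ) + 1))) (n := 0) (by simp)
    rw [slitIntegral_neg_even, zero_div] at this
    exact this
  · exact slitGreen_of_off (Or.inr (by simpa using h))

lemma slitGreen_harmonic (x y : ℤ) (hy : 1 ≤ y) (h : Even (x + y)) :
    4 * slitGreen (x, y) =
      slitGreen (x - 1, y - 1) + slitGreen (x + 1, y - 1) +
        slitGreen (x - 1, y + 1) + slitGreen (x + 1, y + 1) := by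
  obtain ⟨n, rfl⟩ : ∃ n : ℕ, y = (n + 1 : ℕ) := ⟨(y - 1).toNat, by omega⟩
  have h1 : ((n + 1 : ℕ) : ℤ) - 1 = (n : ℕ) := by omega
  have h2 : ((n + 1 : ℕ) : ℤ) + 1 = (n + 2 : ℕ) := by omega
  rw [h1, h2, slitGreen_of_even h]
  push_cast [Int.even_iff] at h
  repeat rw [slitGreen_of_even (by push_cast [Int.even_iff]; omega)]
  rw [← mul_div_assoc, slitIntegral_harmonic]
  ring

lemma slitGreen_reflecting (x : ℤ) (hx : 0 < x) (h : Even x) :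
    2 * slitGreen (x, 0) = slitGreen (x - 1, 1) + slitGreen (x + 1, 1) := by
  obtain ⟨m, rfl⟩ : ∃ m : ℕ, x = 2 * (m + 1) := by
    obtain ⟨k, rfl⟩ := h
    exact ⟨(k - 1).toNat, by omega⟩
  have h0 := slitGreen_of_even (x := 2 * ((m : ℤ) + 1)) (n := 0) (by simp)
  have h1 := slitGreen_of_even (x := 2 * ((m : ℤ) + 1) - 1) (n := 1)
    (by push_cast [Int.even_iff]; omega)
  have h2 := slitGreen_of_even (x := 2 * ((m : ℤ) + 1) + 1) (n := 1)
    (by push_cast [Int.even_iff]; omega)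
  rw [Nat.cast_zero] at h0
  rw [Nat.cast_one] at h1 h2
  rw [h0, h1, h2, ← mul_div_assoc, slitIntegral_flux_even]
  ring

lemma slitGreen_zero_zero : slitGreen (0, 0) = 1 := by
  have h0 := slitGreen_of_even (x := 0) (n := 0) (by simp)
  rw [slitIntegral_zero_zero, div_self (by positivity)] at h0
  exact h0

lemma slitGreen_source :
    2 * slitGreen (0, 0) - slitGreen (1, 1) - slitGreen (-1, 1) = 1 := by
  have h0 := slitGreen_of_even (x := 0) (n := 0) (by simp)
  have h1 := slitGreen_of_even (x := 1) (n := 1) (by decide)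
  have h2 := slitGreen_of_even (x := -1) (n := 1) (by decide)
  rw [Nat.cast_zero] at h0
  rw [Nat.cast_one] at h1 h2
  have hpos : √2 * Real.pi ≠ 0 := by positivity
  rw [h0, h1, h2, ← div_self hpos]
  nth_rewrite 4 [← slitIntegral_flux_zero]
  ring

lemma slitGreen_decay (ε : ℝ) (hε : 0 < ε) :
    ∃ N : ℕ, ∀ x y : ℤ, (N : ℤ) ≤ |x| + |y| → |slitGreen (x, y)| < ε := by
  have hpos : 0 < √2 * Real.pi := by positivity
  obtain ⟨N, hN⟩ := exists_forall_abs_slitIntegral_lt (mul_pos hε hpos)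
  refine ⟨N, fun x y hxy => ?_⟩
  by_cases h : y < 0 ∨ Odd (x + y)
  · rwa [slitGreen_of_off h, abs_zero]
  · push Not at h
    obtain ⟨n, rfl⟩ := Int.eq_ofNat_of_zero_le h.1
    rw [slitGreen_of_even (Int.not_odd_iff_even.1 h.2), abs_div, abs_of_pos hpos,
      div_lt_iff₀ hpos]
    exact hN x n (by simpa using hxy)

lemma slitGreen_nonneg (p : ℤ × ℤ) : 0 ≤ slitGreen p := by
  have := slit_le_of_subharmonic (f := fun q => -slitGreen q) le_rfl
    (fun x y h => by simp only [slitGreen_of_off h, neg_zero])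
    (fun x h => by simp only [slitGreen_neg_zero x h, neg_zero])
    (fun x y hy h => by linarith [slitGreen_harmonic x y hy h])
    (fun x hx h => by linarith [slitGreen_reflecting x hx h])
    (fun _ => by linarith [slitGreen_source])
    (fun ε hε => by simpa only [abs_neg] using slitGreen_decay ε hε) p
  simpa using this

lemma slitGreen_le_one (p : ℤ × ℤ) : slitGreen p ≤ 1 :=
  slit_le_of_subharmonic zero_le_one (fun _ _ => slitGreen_of_off) slitGreen_neg_zero
    slitGreen_harmonic slitGreen_reflecting (fun h => absurd h slitGreen_zero_zero.not_gt)
    slitGreen_decay p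

lemma isSlitGreen_slitGreen : IsSlitGreen slitGreen :=
  ⟨fun _ _ => slitGreen_of_off, slitGreen_neg_zero, slitGreen_harmonic, slitGreen_reflecting,
    slitGreen_source, fun _ _ => ⟨slitGreen_nonneg _, slitGreen_le_one _⟩, slitGreen_decay⟩

lemma IsSlitGreen.le {g h : ℤ × ℤ → ℝ} (hg : IsSlitGreen g) (hh : IsSlitGreen h) (p : ℤ × ℤ) :
    g p ≤ h p := by
  obtain ⟨g1, g2, g3, g4, g5, -, g6⟩ := hg
  obtain ⟨h1, h2, h3, h4, h5, -, h6⟩ := hh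
  have := slit_le_of_subharmonic (f := fun q => g q - h q) le_rfl
    (fun x y hxy => by simp only [g1 x y hxy, h1 x y hxy, sub_zero])
    (fun x hx => by simp only [g2 x hx, h2 x hx, sub_zero])
    (fun x y hy hxy => by linarith [g3 x y hy hxy, h3 x y hy hxy])
    (fun x hx hx' => by linarith [g4 x hx hx', h4 x hx hx'])
    (fun _ => by linarith)
    (fun ε hε => by
      obtain ⟨N, hN⟩ := g6 (ε / 2) (by positivity)
      obtain ⟨M, hM⟩ := h6 (ε / 2) (by positivity)
      refine ⟨N + M, fun x y hxy => ?_⟩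
      push_cast at hxy
      have := hN x y (by omega)
      have := hM x y (by omega)
      have := abs_sub (g (x, y)) (h (x, y))
      linarith) p
  linarith

/-- There exists exactly one slit-plane Green's function. -/
theorem slitGreen_existsUnique : ∃! g : ℤ × ℤ → ℝ, IsSlitGreen g :=
  ⟨slitGreen, isSlitGreen_slitGreen, fun _ hg => funext fun p =>
    le_antisymm (hg.le isSlitGreen_slitGreen p) (isSlitGreen_slitGreen.le hg p)⟩
end

section
/- For every integer k ≥ 0, g(2k,0) = binom(2k,k)/4^k. Equivalently, for every real z with |z| < 1, the generating function of axis values satisfies ∑_{k≥0} g(2k,0)·z^{2k} = 1/√(1−z²). -/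
section SlitPotential

open Real MeasureTheory Filter Topology Set

/-- Maximum principle: a function on the even half-plane lattice that decays at infinity, is
nonpositive on the negative axis and subharmonic elsewhere (with reflection on the nonnegative
axis) is nonpositive. -/
theorem nonpos_of_subharmonic_slit (f : ℤ → ℕ → ℝ)
    (hneg : ∀ x : ℤ, x < 0 → Even x → f x 0 ≤ 0)
    (haxis : ∀ x : ℤ, 0 ≤ x → Even x → 2 * f x 0 ≤ f (x - 1) 1 + f (x + 1) 1)
    (hint : ∀ (x : ℤ) (n : ℕ), Even (x + ((n + 1 : ℕ) : ℤ)) →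
      4 * f x (n + 1) ≤ f (x - 1) n + f (x + 1) n + f (x - 1) (n + 2) + f (x + 1) (n + 2))
    (hdecay : ∀ ε : ℝ, 0 < ε → ∃ N : ℕ, ∀ (x : ℤ) (n : ℕ), (N : ℤ) ≤ |x| + n → |f x n| < ε)
    (x : ℤ) (n : ℕ) (hxn : Even (x + n)) : f x n ≤ 0 := by
  by_contra! hpos
  obtain ⟨N, hN⟩ := hdecay _ hpos
  let S : Finset (ℤ × ℕ) :=
    (Finset.Icc (-(N : ℤ)) N ×ˢ Finset.range (N + 1)).filter fun p => Even (p.1 + p.2)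
  have hS : ∀ (a : ℤ) (b : ℕ), Even (a + b) → |a| + b < N → (a, b) ∈ S := by
    intro a b hab hlt
    have := abs_nonneg a
    simp only [S, Finset.mem_filter, Finset.mem_product, Finset.mem_Icc, Finset.mem_range]
    refine ⟨⟨abs_le.1 ?_, ?_⟩, hab⟩ <;> omega
  have hmem : (x, n) ∈ S := hS x n hxn <| by
    by_contra! h
    exact absurd (hN x n h) (not_lt.2 (le_abs_self _))
  obtain ⟨⟨a, b⟩, hab, hmax⟩ := S.exists_max_image (fun p => f p.1 p.2) ⟨_, hmem⟩
  have hc : f x n ≤ f a b := hmax _ hmem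
  have hle : ∀ (u : ℤ) (v : ℕ), Even (u + v) → f u v ≤ f a b := by
    intro u v huv
    by_cases h : |u| + (v : ℤ) < N
    · exact hmax _ (hS u v huv h)
    · exact ((le_abs_self _).trans (hN u v (not_lt.1 h)).le).trans hc
  have hab' : Even (a + (b : ℤ)) := (Finset.mem_filter.1 hab).2
  have hstep : ∀ (u : ℤ) (v : ℕ), Even (u + v) → f u v = f a b → f (u + 1) (v + 1) = f a b := by
    intro u v huv h
    rcases v with _ | v
    · have hu : Even u := by simpa using huv
      have hu0 : 0 ≤ u := by
        by_contra! hlt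
        linarith [hneg u hlt hu]
      have h1 := haxis u hu0 hu
      have h2 := hle (u - 1) 1 (by grind)
      have h3 := hle (u + 1) 1 (by grind)
      simp only [zero_add]
      linarith
    · have h1 := hint u v huv
      have h2 := hle (u - 1) v (by grind)
      have h3 := hle (u + 1) v (by grind)
      have h4 := hle (u - 1) (v + 2) (by grind)
      have h5 := hle (u + 1) (v + 2) (by grind)
      change f (u + 1) (v + 2) = _
      linarith
  have hdiag : ∀ k : ℕ, f (a + k) (b + k) = f a b := by
    intro k
    induction k with
    | zero => simp
    | succ k ih =>
      have := hstep (a + k) (b + k) (by push_cast; grind) ih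
      convert this using 2 <;> push_cast <;> ring
  have hfar := hN (a + N) (b + N) (by have := abs_nonneg (a + N); push_cast; omega)
  rw [hdiag] at hfar
  linarith [le_abs_self (f a b)]

/-- The binomial coefficient of `-1/2` in terms of the central binomial coefficient. -/
theorem choose_neg_half (n : ℕ) :
    Ring.choose (-(1 / 2) : ℝ) n * (-1) ^ n = (Nat.choose (2 * n) n : ℝ) / 4 ^ n := by
  change _ = (Nat.centralBinom n : ℝ) / 4 ^ n
  induction n with
  | zero => simp
  | succ n ih =>
    have h1 : Ring.choose (-(1 / 2) : ℝ) (n + 1) * (n + 1)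
        = Ring.choose (-(1 / 2) : ℝ) n * (-(1 / 2) - n) := by
      simp only [Ring.choose_eq_smul, descPochhammer_succ_right, Polynomial.smeval_mul,
        Polynomial.smeval_sub, Polynomial.smeval_X, Polynomial.smeval_natCast, smul_eq_mul,
        Nat.factorial_succ, Nat.cast_mul]
      have : ((n.factorial : ℕ) : ℝ) ≠ 0 := by positivity
      push_cast
      field_simp
      simp [mul_comm]
    have h2 : ((n : ℝ) + 1) * (n + 1).centralBinom = 2 * (2 * n + 1) * n.centralBinom := by
      exact_mod_cast Nat.succ_mul_centralBinom_succ n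
    have hn : (n : ℝ) + 1 ≠ 0 := by positivity
    apply mul_left_cancel₀ hn
    have h4 : (4 : ℝ) ^ n ≠ 0 := by positivity
    rw [eq_div_iff h4] at ih
    rw [pow_succ, pow_succ, mul_div_assoc', h2, eq_div_iff (by positivity)]
    linear_combination (-4 * (-1) ^ n * 4 ^ n) * h1 + (4 * n + 2) * ih

/-- The generating function of the central binomial coefficients. -/
theorem hasSum_centralBinom (z : ℝ) (hz : |z| < 1) :
    HasSum (fun k : ℕ => (Nat.choose (2 * k) k : ℝ) / 4 ^ k * z ^ (2 * k))
      (1 / √(1 - z ^ 2)) := by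
  have hz2 : z ^ 2 < 1 := by rwa [sq_lt_one_iff_abs_lt_one]
  have h := (Real.one_add_rpow_hasFPowerSeriesOnBall_zero (a := -(1 / 2))).hasSum (y := -z ^ 2)
    (by rw [← ENNReal.ofReal_one, Metric.eball_ofReal]; simpa using hz)
  have hval : (1 + (0 + -z ^ 2)) ^ (-(1 / 2) : ℝ) = 1 / √(1 - z ^ 2) := by
    rw [zero_add, ← sub_eq_add_neg, Real.rpow_neg (by linarith), Real.sqrt_eq_rpow, one_div, one_div]
  rw [hval] at h
  convert! h using 2 with k
  rw [← choose_neg_half, binomialSeries_apply]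
  simp
  rw [neg_pow (z ^ 2), pow_mul]
  ring

/-- The integrable weight `1 / √(2 cos 2t)` on `[-π/4, π/4]`. -/
noncomputable def slitWeight (t : ℝ) : ℝ := (√(2 * cos (2 * t)))⁻¹

/-- The phase of the `x`-th Fourier mode in the integral defining `slitPotential`. -/
noncomputable def slitPhase (x : ℤ) (t : ℝ) : ℝ := (2 * x + 1) * t + x * (π / 2)

/-- An integral formula for the slit-plane Green's function: a superposition of the discrete
harmonic modes `(-tan t) ^ n * cos (slitPhase x t)`. -/
noncomputable def slitPotential (x : ℤ) (n : ℕ) : ℝ :=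
  2 / π * ∫ t in (-(π / 4))..(π / 4), (-tan t) ^ n * cos (slitPhase x t) * slitWeight t

theorem uIcc_quarter : uIcc (-(π / 4)) (π / 4) = Icc (-(π / 4)) (π / 4) :=
  uIcc_of_le (by linarith [pi_pos])

theorem cos_two_mul_pos {t : ℝ} (ht : t ∈ Ioo (-(π / 4)) (π / 4)) : 0 < cos (2 * t) :=
  cos_pos_of_mem_Ioo ⟨by linarith [ht.1], by linarith [ht.2]⟩

theorem cos_two_mul_nonneg {t : ℝ} (ht : t ∈ Icc (-(π / 4)) (π / 4)) : 0 ≤ cos (2 * t) :=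
  cos_nonneg_of_mem_Icc ⟨by linarith [ht.1], by linarith [ht.2]⟩

theorem cos_pos_of_mem_quarter {t : ℝ} (ht : t ∈ Icc (-(π / 4)) (π / 4)) : 0 < cos t :=
  cos_pos_of_mem_Ioo ⟨by linarith [ht.1, pi_pos], by linarith [ht.2, pi_pos]⟩

theorem continuous_slitPhase (x : ℤ) : Continuous (slitPhase x) := by
  unfold slitPhase; fun_prop

theorem continuousOn_tan_quarter : ContinuousOn tan (Icc (-(π / 4)) (π / 4)) :=
  continuousOn_tan.mono fun _ ht => (cos_pos_of_mem_quarter ht).ne'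

theorem abs_tan_le_one {t : ℝ} (ht : t ∈ Icc (-(π / 4)) (π / 4)) : |tan t| ≤ 1 := by
  have hc := cos_pos_of_mem_quarter ht
  have h2 := cos_two_mul_nonneg ht
  rw [tan_eq_sin_div_cos, abs_div, div_le_one (abs_pos.2 hc.ne'), ← sq_le_sq]
  rw [cos_two_mul] at h2
  linarith [sin_sq_add_cos_sq t]

theorem abs_tan_lt_one {t : ℝ} (ht : t ∈ Ioo (-(π / 4)) (π / 4)) : |tan t| < 1 := by
  have hc := cos_pos_of_mem_quarter (Ioo_subset_Icc_self ht)
  have h2 := cos_two_mul_pos ht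
  rw [tan_eq_sin_div_cos, abs_div, div_lt_one (abs_pos.2 hc.ne'), ← sq_lt_sq]
  rw [cos_two_mul] at h2
  linarith [sin_sq_add_cos_sq t]

theorem hasDerivAt_arcsin_sqrt_two_mul_sin {t : ℝ} (ht : t ∈ Ioo (-(π / 4)) (π / 4)) :
    HasDerivAt (fun t => arcsin (√2 * sin t)) (2 * cos t * slitWeight t) t := by
  have h2 := cos_two_mul_pos ht
  have hs : (√2 * sin t) ^ 2 = 1 - cos (2 * t) := by
    rw [mul_pow, sq_sqrt (by norm_num), cos_two_mul, cos_sq']; ring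
  have hlt : |√2 * sin t| < 1 := by
    rw [← sq_lt_one_iff_abs_lt_one, hs]; linarith
  have h := (hasDerivAt_arcsin (abs_lt.1 hlt).1.ne' (abs_lt.1 hlt).2.ne).comp t
    ((hasDerivAt_sin t).const_mul √2)
  convert! h using 1
  rw [hs, slitWeight, sqrt_mul (by norm_num)]
  have hc : √(cos (2 * t)) ≠ 0 := (sqrt_pos.2 h2).ne'
  have h22 : √2 * √2 = 2 := mul_self_sqrt (by norm_num)
  field_simp
  rw [sub_sub_cancel]
  field_simp
  linear_combination (-cos t) * h22

theorem intervalIntegrable_cos_mul_slitWeight :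
    IntervalIntegrable (fun t => 2 * cos t * slitWeight t) volume (-(π / 4)) (π / 4) := by
  rw [intervalIntegrable_iff_integrableOn_Ioc_of_le (by linarith [pi_pos])]
  refine intervalIntegral.integrableOn_deriv_of_nonneg
    (g := fun t => arcsin (√2 * sin t)) (by fun_prop)
    (fun t ht => hasDerivAt_arcsin_sqrt_two_mul_sin ht) fun t ht => ?_
  have := cos_pos_of_mem_quarter (Ioo_subset_Icc_self ht)
  have : 0 ≤ slitWeight t := inv_nonneg.2 (sqrt_nonneg _)
  positivity

theorem intervalIntegrable_slitWeight :
    IntervalIntegrable slitWeight volume (-(π / 4)) (π / 4) := by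
  have h := intervalIntegrable_cos_mul_slitWeight.continuousOn_mul (g := fun t => (2 * cos t)⁻¹) <|
    ContinuousOn.inv₀ (by fun_prop) fun t ht =>
      (mul_pos two_pos (cos_pos_of_mem_quarter (uIcc_quarter ▸ ht))).ne'
  refine h.congr fun t ht => ?_
  rw [uIoc_of_le (by linarith [pi_pos])] at ht
  have := cos_pos_of_mem_quarter (Ioc_subset_Icc_self ht)
  field_simp

theorem intervalIntegrable_mul_slitWeight {f : ℝ → ℝ}
    (hf : ContinuousOn f (Icc (-(π / 4)) (π / 4))) :
    IntervalIntegrable (fun t => f t * slitWeight t) volume (-(π / 4)) (π / 4) :=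
  intervalIntegrable_slitWeight.continuousOn_mul (uIcc_quarter ▸ hf)

theorem continuousOn_tan_pow_mul_cos (x : ℤ) (n : ℕ) :
    ContinuousOn (fun t => (-tan t) ^ n * cos (slitPhase x t)) (Icc (-(π / 4)) (π / 4)) :=
  (continuousOn_tan_quarter.neg.pow n).mul
    (continuous_cos.comp (continuous_slitPhase x)).continuousOn

theorem intervalIntegrable_slitPotential (x : ℤ) (n : ℕ) :
    IntervalIntegrable (fun t => (-tan t) ^ n * cos (slitPhase x t) * slitWeight t) volume
      (-(π / 4)) (π / 4) :=
  intervalIntegrable_mul_slitWeight (continuousOn_tan_pow_mul_cos x n)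

theorem cos_slitPhase_add_one (x : ℤ) (t : ℝ) :
    cos (slitPhase (x + 1) t) =
      -(cos (slitPhase x t) * sin (2 * t)) - sin (slitPhase x t) * cos (2 * t) := by
  have : slitPhase (x + 1) t = slitPhase x t + (2 * t + π / 2) := by
    unfold slitPhase; push_cast; ring
  rw [this, cos_add, cos_add_pi_div_two, sin_add_pi_div_two]; ring

theorem cos_slitPhase_sub_one (x : ℤ) (t : ℝ) :
    cos (slitPhase (x - 1) t) =
      -(cos (slitPhase x t) * sin (2 * t)) + sin (slitPhase x t) * cos (2 * t) := by
  have : slitPhase (x - 1) t = slitPhase x t - (2 * t + π / 2) := by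
    unfold slitPhase; push_cast; ring
  rw [this, cos_sub, cos_add_pi_div_two, sin_add_pi_div_two]; ring

theorem slitPotential_harmonic (x : ℤ) (n : ℕ) :
    4 * slitPotential x (n + 1) = slitPotential (x - 1) n + slitPotential (x + 1) n +
      slitPotential (x - 1) (n + 2) + slitPotential (x + 1) (n + 2) := by
  have hI := intervalIntegrable_slitPotential
  simp only [slitPotential]
  rw [← mul_add, ← mul_add, ← mul_add, mul_left_comm, ← intervalIntegral.integral_const_mul,
    ← intervalIntegral.integral_add (hI _ _) (hI _ _),
    ← intervalIntegral.integral_add ((hI _ _).add (hI _ _)) (hI _ _),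
    ← intervalIntegral.integral_add (((hI _ _).add (hI _ _)).add (hI _ _)) (hI _ _)]
  congr 1
  refine intervalIntegral.integral_congr fun t ht => ?_
  have hc := (cos_pos_of_mem_quarter (uIcc_quarter ▸ ht)).ne'
  have htan : (1 + tan t ^ 2) * sin (2 * t) = 2 * tan t := by
    rw [tan_eq_sin_div_cos, sin_two_mul]
    field_simp
    linear_combination sin t * sin_sq_add_cos_sq t
  simp only [cos_slitPhase_add_one, cos_slitPhase_sub_one]
  linear_combination (2 * (-tan t) ^ n * cos (slitPhase x t) * slitWeight t) * htan

theorem two_mul_cos_mul_slitWeight {t : ℝ} (ht : t ∈ Icc (-(π / 4)) (π / 4)) :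
    2 * cos (2 * t) * slitWeight t = √(2 * cos (2 * t)) := by
  have h : 0 ≤ 2 * cos (2 * t) := by linarith [cos_two_mul_nonneg ht]
  rw [slitWeight, ← div_eq_mul_inv, div_sqrt]

theorem slitPotential_flux_eq_integral (x : ℤ) :
    2 * slitPotential x 0 - slitPotential (x - 1) 1 - slitPotential (x + 1) 1 =
      2 / π * ∫ t in (-(π / 4))..(π / 4), cos (slitPhase x t) * √(2 * cos (2 * t)) := by
  have hI := intervalIntegrable_slitPotential
  simp only [slitPotential]
  rw [mul_left_comm, ← mul_sub, ← mul_sub, ← intervalIntegral.integral_const_mul,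
    ← intervalIntegral.integral_sub ((hI _ _).const_mul _) (hI _ _),
    ← intervalIntegral.integral_sub (((hI _ _).const_mul _).sub (hI _ _)) (hI _ _)]
  congr 1
  refine intervalIntegral.integral_congr fun t ht => ?_
  rw [uIcc_quarter] at ht
  have hc := (cos_pos_of_mem_quarter ht).ne'
  have htan : tan t * sin (2 * t) = 1 - cos (2 * t) := by
    rw [tan_eq_sin_div_cos, sin_two_mul, cos_two_mul]
    field_simp
    linear_combination 2 * sin_sq_add_cos_sq t
  simp only [cos_slitPhase_add_one, cos_slitPhase_sub_one, ← two_mul_cos_mul_slitWeight ht]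
  linear_combination (-2 * cos (slitPhase x t) * slitWeight t) * htan

theorem hasDerivAt_sqrt_two_mul_cos {t : ℝ} (ht : t ∈ Ioo (-(π / 4)) (π / 4)) :
    HasDerivAt (fun t => √(2 * cos (2 * t))) (-2 * sin (2 * t) * slitWeight t) t := by
  have h2 := cos_two_mul_pos ht
  have h := ((((hasDerivAt_id' t).const_mul 2).cos).const_mul 2).sqrt (by positivity)
  convert! h using 1
  rw [slitWeight]
  have : √(2 * cos (2 * t)) ≠ 0 := (sqrt_pos.2 (by positivity)).ne'
  field_simp

theorem hasDerivAt_slitPhase (x : ℤ) (t : ℝ) : HasDerivAt (slitPhase x) (2 * x + 1) t := by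
  have h := ((hasDerivAt_id' t).const_mul (2 * (x : ℝ) + 1)).add_const (x * (π / 2))
  rwa [mul_one] at h

theorem integral_deriv_mul_sqrt_eq_zero {F f : ℝ → ℝ} (hF : Continuous F)
    (hd : ∀ t ∈ Ioo (-(π / 4)) (π / 4),
      HasDerivAt (fun t => F t * √(2 * cos (2 * t))) (f t * slitWeight t) t)
    (hf : ContinuousOn f (Icc (-(π / 4)) (π / 4))) :
    ∫ t in (-(π / 4))..(π / 4), f t * slitWeight t = 0 := by
  rw [intervalIntegral.integral_eq_sub_of_hasDerivAt_of_le (by linarith [pi_pos])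
    (by fun_prop) hd (intervalIntegrable_mul_slitWeight hf)]
  have h : 2 * (π / 4) = π / 2 := by ring
  simp [h]

/-- Integration by parts gives a first-order recurrence for the values on the axis. -/
theorem slitPotential_axis_recurrence (x : ℤ) :
    (x + 1 : ℝ) * slitPotential (x + 1) 0 = x * slitPotential (x - 1) 0 := by
  have hI := intervalIntegrable_slitPotential
  have key := integral_deriv_mul_sqrt_eq_zero (F := fun t => cos (slitPhase x t))
    (f := fun t => 2 * (x + 1) * cos (slitPhase (x + 1) t) - 2 * x * cos (slitPhase (x - 1) t))
    (continuous_cos.comp (continuous_slitPhase x))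
    (fun t ht => by
      convert! (hasDerivAt_slitPhase x t).cos.mul (hasDerivAt_sqrt_two_mul_cos ht) using 1
      rw [cos_slitPhase_add_one, cos_slitPhase_sub_one,
        ← two_mul_cos_mul_slitWeight (Ioo_subset_Icc_self ht)]
      ring)
    (by have := continuous_slitPhase; fun_prop)
  have heq : ∫ t in (-(π / 4))..(π / 4), (2 * (x + 1) * cos (slitPhase (x + 1) t)
        - 2 * x * cos (slitPhase (x - 1) t)) * slitWeight t =
      2 * (x + 1) * (∫ t in (-(π / 4))..(π / 4),
        (-tan t) ^ 0 * cos (slitPhase (x + 1) t) * slitWeight t)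
      - 2 * x * ∫ t in (-(π / 4))..(π / 4),
        (-tan t) ^ 0 * cos (slitPhase (x - 1) t) * slitWeight t := by
    rw [← intervalIntegral.integral_const_mul, ← intervalIntegral.integral_const_mul,
      ← intervalIntegral.integral_sub ((hI _ _).const_mul _) ((hI _ _).const_mul _)]
    exact intervalIntegral.integral_congr fun t _ => by ring
  rw [heq] at key
  simp only [slitPotential]
  linear_combination (1 / π) * key

theorem integral_flux_recurrence (x : ℤ) :
    (x + 2 : ℝ) * (∫ t in (-(π / 4))..(π / 4), cos (slitPhase (x + 1) t) * √(2 * cos (2 * t))) =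
      (x - 1) * ∫ t in (-(π / 4))..(π / 4), cos (slitPhase (x - 1) t) * √(2 * cos (2 * t)) := by
  have key := integral_deriv_mul_sqrt_eq_zero
    (F := fun t => 2 * cos (2 * t) * cos (slitPhase x t))
    (f := fun t => 2 * cos (2 * t) * (2 * (x + 2) * cos (slitPhase (x + 1) t)
      - 2 * (x - 1) * cos (slitPhase (x - 1) t)))
    (by have := continuous_slitPhase; fun_prop)
    (fun t ht => by
      have hc := ((hasDerivAt_id' t).const_mul 2).cos.const_mul 2
      convert! (hc.mul (hasDerivAt_slitPhase x t).cos).mul (hasDerivAt_sqrt_two_mul_cos ht) using 1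
      rw [cos_slitPhase_add_one, cos_slitPhase_sub_one,
        ← two_mul_cos_mul_slitWeight (Ioo_subset_Icc_self ht)]
      simp only [Pi.mul_apply]
      ring)
    (by have := continuous_slitPhase; fun_prop)
  have hI : ∀ x : ℤ, IntervalIntegrable
      (fun t => cos (slitPhase x t) * √(2 * cos (2 * t))) volume (-(π / 4)) (π / 4) := fun x =>
    Continuous.intervalIntegrable (by have := continuous_slitPhase; fun_prop) _ _
  have heq : ∫ t in (-(π / 4))..(π / 4), 2 * cos (2 * t) * (2 * (x + 2) * cos (slitPhase (x + 1) t)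
        - 2 * (x - 1) * cos (slitPhase (x - 1) t)) * slitWeight t =
      2 * (x + 2) * (∫ t in (-(π / 4))..(π / 4), cos (slitPhase (x + 1) t) * √(2 * cos (2 * t)))
      - 2 * (x - 1) * ∫ t in (-(π / 4))..(π / 4),
        cos (slitPhase (x - 1) t) * √(2 * cos (2 * t)) := by
    rw [← intervalIntegral.integral_const_mul, ← intervalIntegral.integral_const_mul,
      ← intervalIntegral.integral_sub ((hI _).const_mul _) ((hI _).const_mul _)]
    refine intervalIntegral.integral_congr fun t ht => ?_
    simp only [← two_mul_cos_mul_slitWeight (uIcc_quarter ▸ ht)]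
    ring
  rw [heq] at key
  linear_combination (1 / 2) * key

theorem integral_cos_mul_slitWeight :
    ∫ t in (-(π / 4))..(π / 4), cos t * slitWeight t = π / 2 := by
  have h := intervalIntegral.integral_eq_sub_of_hasDerivAt_of_le (by linarith [pi_pos])
    (by fun_prop) (fun t ht => hasDerivAt_arcsin_sqrt_two_mul_sin ht)
    intervalIntegrable_cos_mul_slitWeight
  have h2 : √2 * (√2 / 2) = 1 := by
    rw [mul_div_assoc', mul_self_sqrt (by norm_num)]; norm_num
  simp only [mul_assoc, intervalIntegral.integral_const_mul, sin_neg, sin_pi_div_four, mul_neg,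
    h2, arcsin_neg, arcsin_one] at h
  linarith

theorem slitPotential_zero_zero : slitPotential 0 0 = 1 := by
  simp [slitPotential, slitPhase, integral_cos_mul_slitWeight, pi_ne_zero]

theorem integral_cos_mul_sqrt :
    ∫ t in (-(π / 4))..(π / 4), cos t * √(2 * cos (2 * t)) = π / 2 := by
  have key := integral_deriv_mul_sqrt_eq_zero (F := sin)
    (f := fun t => 2 * (2 * cos (2 * t) * cos t - cos t)) continuous_sin
    (fun t ht => by
      convert! (hasDerivAt_sin t).mul (hasDerivAt_sqrt_two_mul_cos ht) using 1
      rw [← two_mul_cos_mul_slitWeight (Ioo_subset_Icc_self ht), cos_two_mul, sin_two_mul]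
      linear_combination (4 * cos t * slitWeight t) * sin_sq_add_cos_sq t)
    (by fun_prop)
  have heq : ∫ t in (-(π / 4))..(π / 4), 2 * (2 * cos (2 * t) * cos t - cos t) * slitWeight t =
      2 * ((∫ t in (-(π / 4))..(π / 4), cos t * √(2 * cos (2 * t)))
      - ∫ t in (-(π / 4))..(π / 4), cos t * slitWeight t) := by
    rw [← intervalIntegral.integral_sub (Continuous.intervalIntegrable (by fun_prop) _ _)
      (intervalIntegrable_mul_slitWeight (by fun_prop)), ← intervalIntegral.integral_const_mul]
    refine intervalIntegral.integral_congr fun t ht => ?_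
    simp only [← two_mul_cos_mul_slitWeight (uIcc_quarter ▸ ht)]
    ring
  rw [heq, integral_cos_mul_slitWeight] at key
  linarith

theorem slitPotential_flux_origin :
    2 * slitPotential 0 0 - slitPotential (0 - 1) 1 - slitPotential (0 + 1) 1 = 1 := by
  rw [slitPotential_flux_eq_integral]
  have h : ∀ t, slitPhase 0 t = t := fun t => by simp [slitPhase]
  simp only [h, integral_cos_mul_sqrt]
  have := pi_ne_zero
  field_simp

theorem integral_flux_pos_eq_zero (m : ℕ) :
    ∫ t in (-(π / 4))..(π / 4), cos (slitPhase (2 * m + 2) t) * √(2 * cos (2 * t)) = 0 := by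
  induction m with
  | zero =>
    have h := integral_flux_recurrence 1
    norm_num at h ⊢
    exact h
  | succ m ih =>
    have h := integral_flux_recurrence (2 * m + 3)
    rw [show (2 * (m : ℤ) + 3 - 1) = 2 * m + 2 by ring, ih, mul_zero] at h
    have hne : (((2 * m + 3 : ℤ) : ℝ) + 2) ≠ 0 := by push_cast; positivity
    convert (mul_eq_zero.1 h).resolve_left hne using 6
    push_cast
    ring

theorem slitPotential_reflecting {x : ℤ} (hx : 0 < x) (he : Even x) :
    2 * slitPotential x 0 = slitPotential (x - 1) 1 + slitPotential (x + 1) 1 := by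
  obtain ⟨m, rfl⟩ : ∃ m : ℕ, x = 2 * m + 2 := by
    obtain ⟨k, rfl⟩ := he
    exact ⟨(k - 1).toNat, by omega⟩
  have h := slitPotential_flux_eq_integral (2 * m + 2)
  rw [integral_flux_pos_eq_zero, mul_zero] at h
  linarith

theorem slitPotential_axis_neg {x : ℤ} (hx : x < 0) (he : Even x) : slitPotential x 0 = 0 := by
  obtain ⟨m, rfl⟩ : ∃ m : ℕ, x = -(2 * m + 2) := by
    obtain ⟨k, rfl⟩ := he
    exact ⟨(-k - 1).toNat, by omega⟩
  clear hx he
  induction m with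
  | zero =>
    have h := slitPotential_axis_recurrence (-1)
    norm_num at h ⊢
    exact h
  | succ m ih =>
    have h := slitPotential_axis_recurrence (-(2 * m + 3))
    rw [show -(2 * (m : ℤ) + 3) + 1 = -(2 * m + 2) by ring, ih, mul_zero] at h
    have hne : ((-(2 * m + 3) : ℤ) : ℝ) ≠ 0 := by
      push_cast; exact neg_ne_zero.2 (by positivity)
    convert (mul_eq_zero.1 h.symm).resolve_left hne using 2
    push_cast
    ring

theorem slitPotential_axis (m : ℕ) :
    slitPotential (2 * m) 0 = (Nat.choose (2 * m) m : ℝ) / 4 ^ m := by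
  change _ = (Nat.centralBinom m : ℝ) / 4 ^ m
  induction m with
  | zero => simp [slitPotential_zero_zero]
  | succ m ih =>
    have h := slitPotential_axis_recurrence (2 * m + 1)
    rw [add_sub_cancel_right, ih] at h
    have h2 : ((m : ℝ) + 1) * (m + 1).centralBinom = 2 * (2 * m + 1) * m.centralBinom := by
      exact_mod_cast Nat.succ_mul_centralBinom_succ m
    have hm : (m : ℝ) + 1 ≠ 0 := by positivity
    rw [show (2 * ((m + 1 : ℕ) : ℤ)) = 2 * m + 1 + 1 by push_cast; ring]
    apply mul_left_cancel₀ hm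
    rw [mul_div_assoc', h2]
    push_cast at h
    field_simp at h ⊢
    rw [pow_succ]
    linarith

theorem abs_slitPotential_le_integral (x : ℤ) (n : ℕ) :
    |slitPotential x n| ≤
      2 / π * ∫ t in (-(π / 4))..(π / 4), |tan t| ^ n * slitWeight t := by
  rw [slitPotential, abs_mul, abs_of_pos (by positivity : 0 < 2 / π)]
  gcongr
  refine (intervalIntegral.abs_integral_le_integral_abs (by linarith [pi_pos])).trans ?_
  refine intervalIntegral.integral_mono_on (by linarith [pi_pos])
    (intervalIntegrable_slitPotential x n).abs
    (intervalIntegrable_mul_slitWeight (continuousOn_tan_quarter.abs.pow n)) fun t ht => ?_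
  have hw : 0 ≤ slitWeight t := inv_nonneg.2 (sqrt_nonneg _)
  rw [abs_mul, abs_mul, abs_pow, abs_neg, abs_of_nonneg hw]
  gcongr
  exact mul_le_of_le_one_right (by positivity) (abs_cos_le_one _)

theorem tendsto_integral_tan_pow_mul_slitWeight :
    Tendsto (fun n : ℕ => ∫ t in (-(π / 4))..(π / 4), |tan t| ^ n * slitWeight t) atTop (𝓝 0) := by
  rw [← intervalIntegral.integral_zero (a := -(π / 4)) (b := π / 4) (μ := volume)]
  refine intervalIntegral.tendsto_integral_filter_of_dominated_convergence slitWeight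
    (Eventually.of_forall fun n => (intervalIntegrable_mul_slitWeight
      (continuousOn_tan_quarter.abs.pow n)).def'.aestronglyMeasurable)
    (Eventually.of_forall fun n => Eventually.of_forall fun t ht => ?_)
    intervalIntegrable_slitWeight ?_
  · rw [uIoc_of_le (by linarith [pi_pos])] at ht
    have hw : 0 ≤ slitWeight t := inv_nonneg.2 (sqrt_nonneg _)
    rw [norm_of_nonneg (by positivity)]
    exact mul_le_of_le_one_left hw
      (pow_le_one₀ (abs_nonneg _) (abs_tan_le_one (Ioc_subset_Icc_self ht)))
  · filter_upwards [compl_mem_ae_iff.2 (measure_singleton (π / 4))] with t hne ht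
    rw [uIoc_of_le (by linarith [pi_pos])] at ht
    have h := tendsto_pow_atTop_nhds_zero_of_lt_one (abs_nonneg (tan t))
      (abs_tan_lt_one ⟨ht.1, lt_of_le_of_ne ht.2 hne⟩)
    simpa using h.mul_const (slitWeight t)

theorem tendsto_slitPotential_cofinite (n : ℕ) :
    Tendsto (fun x : ℤ => slitPotential x n) cofinite (𝓝 0) := by
  let A : ℝ → ℂ := fun t => ((-tan t) ^ n * slitWeight t : ℝ) * Complex.exp (t * Complex.I)
  let f : ℝ → ℂ := (Ioc (-(π / 4)) (π / 4)).indicator A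
  have hlim : Tendsto (fun x : ℤ => -(x : ℝ) / π) cofinite (cocompact ℝ) := by
    have h : Tendsto (fun y : ℝ => -y / π) (cocompact ℝ) (cocompact ℝ) := by
      have := tendsto_cocompact_mul_right₀ (a := -π⁻¹) (by simp [pi_ne_zero])
      refine this.congr fun y => by ring
    exact h.comp Int.tendsto_coe_cofinite
  have hRL := (((Real.tendsto_integral_exp_smul_cocompact f).comp hlim).norm).const_mul (2 / π)
  rw [norm_zero, mul_zero] at hRL
  refine squeeze_zero_norm (fun x => ?_) hRL
  have hA : IntervalIntegrable (fun t : ℝ => Complex.exp (slitPhase x t * Complex.I) *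
      ((-tan t) ^ n * slitWeight t : ℝ)) volume (-(π / 4)) (π / 4) := by
    refine IntervalIntegrable.continuousOn_mul ?_ ?_
    · have h := intervalIntegrable_mul_slitWeight (continuousOn_tan_quarter.neg.pow n)
      exact ⟨h.1.ofReal, h.2.ofReal⟩
    · have := continuous_slitPhase x
      fun_prop
  have hre : slitPotential x n = 2 / π * (∫ t in (-(π / 4))..(π / 4),
      Complex.exp (slitPhase x t * Complex.I) * ((-tan t) ^ n * slitWeight t : ℝ)).re := by
    rw [← Complex.reCLM_apply, ← ContinuousLinearMap.intervalIntegral_comp_comm _ hA, slitPotential]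
    congr 1
    refine intervalIntegral.integral_congr fun t _ => ?_
    simp only [Complex.reCLM_apply, Complex.re_mul_ofReal, Complex.exp_ofReal_mul_I_re]
    ring
  have hfac : ∫ t in (-(π / 4))..(π / 4),
      Complex.exp (slitPhase x t * Complex.I) * ((-tan t) ^ n * slitWeight t : ℝ) =
      Complex.exp ((x * (π / 2) : ℝ) * Complex.I) *
        ∫ v : ℝ, Real.fourierChar (-(v * (-(x : ℝ) / π))) • f v := by
    have : ∀ v : ℝ, Real.fourierChar (-(v * (-(x : ℝ) / π))) • f v =
        (Ioc (-(π / 4)) (π / 4)).indicator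
          (fun v => Real.fourierChar (-(v * (-(x : ℝ) / π))) • A v) v := fun v => by
      by_cases hv : v ∈ Ioc (-(π / 4)) (π / 4) <;> simp [f, hv]
    simp only [this]
    rw [integral_indicator measurableSet_Ioc,
      ← intervalIntegral.integral_of_le (by linarith [pi_pos]),
      ← intervalIntegral.integral_const_mul]
    refine intervalIntegral.integral_congr fun t _ => ?_
    simp only [Circle.smul_def, Real.fourierChar_apply, A, smul_eq_mul]
    rw [mul_comm ((((-tan t) ^ n * slitWeight t : ℝ)) : ℂ), ← mul_assoc, ← mul_assoc,
      ← Complex.exp_add, ← Complex.exp_add]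
    congr 2
    have hpi : (π : ℂ) ≠ 0 := by exact_mod_cast pi_ne_zero
    simp only [slitPhase]
    push_cast
    field_simp
    ring
  rw [hre, hfac, norm_mul, norm_of_nonneg (by positivity : 0 ≤ 2 / π)]
  simp only [Function.comp_apply]
  gcongr
  refine (Complex.abs_re_le_norm _).trans ?_
  rw [norm_mul, Complex.norm_exp_ofReal_mul_I, one_mul]

theorem slitPotential_decay (ε : ℝ) (hε : 0 < ε) :
    ∃ N : ℕ, ∀ (x : ℤ) (n : ℕ), (N : ℤ) ≤ |x| + n → |slitPotential x n| < ε := by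
  have h1 := tendsto_integral_tan_pow_mul_slitWeight.const_mul (2 / π)
  rw [mul_zero] at h1
  obtain ⟨Y, hY⟩ := eventually_atTop.1 (h1.eventually (gt_mem_nhds hε))
  have hX : ∀ n : ℕ, ∃ X : ℕ, ∀ x : ℤ, (X : ℤ) ≤ |x| → |slitPotential x n| < ε := by
    intro n
    have h : ∀ᶠ x in cofinite, |slitPotential x n| < ε := by
      filter_upwards [(tendsto_slitPotential_cofinite n).eventually (Metric.ball_mem_nhds 0 hε)]
        with x hx
      simpa using hx
    obtain ⟨B, hB⟩ := ((eventually_cofinite.1 h).image fun x => x.natAbs).bddAbove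
    refine ⟨B + 1, fun x hx => ?_⟩
    by_contra hcon
    have : x.natAbs ≤ B := hB (mem_image_of_mem _ hcon)
    rw [Int.abs_eq_natAbs] at hx
    omega
  choose X hX using hX
  refine ⟨Y + ∑ n ∈ Finset.range Y, X n, fun x n hxn => ?_⟩
  by_cases hn : Y ≤ n
  · exact (abs_slitPotential_le_integral x n).trans_lt (hY n hn)
  · push Not at hn
    have := Finset.single_le_sum (f := X) (fun _ _ => Nat.zero_le _) (Finset.mem_range.2 hn)
    exact hX n x (by push_cast at hxn; zify at this hn; linarith)

theorem IsSlitGreen.eq_slitPotential {g : ℤ × ℤ → ℝ} (hg : IsSlitGreen g) (x : ℤ) (n : ℕ)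
    (hxn : Even (x + n)) : g (x, n) = slitPotential x n := by
  obtain ⟨-, hneg, hint, hpos, horig, -, hdec⟩ := hg
  have hg_int : ∀ (x : ℤ) (n : ℕ), Even (x + ((n + 1 : ℕ) : ℤ)) → 4 * g (x, (n + 1 : ℕ)) =
      g (x - 1, n) + g (x + 1, n) + g (x - 1, (n + 2 : ℕ)) + g (x + 1, (n + 2 : ℕ)) := by
    intro x n h
    have := hint x (n + 1 : ℕ) (by push_cast; omega) h
    rwa [show ((n + 1 : ℕ) : ℤ) - 1 = n by push_cast; ring,
      show ((n + 1 : ℕ) : ℤ) + 1 = (n + 2 : ℕ) by push_cast; ring] at this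
  have hg_axis : ∀ x : ℤ, 0 ≤ x → Even x →
      2 * g (x, 0) - g (x - 1, 1) - g (x + 1, 1) =
        2 * slitPotential x 0 - slitPotential (x - 1) 1 - slitPotential (x + 1) 1 := by
    intro x hx he
    rcases hx.eq_or_lt with rfl | hx
    · rw [slitPotential_flux_origin, ← horig]
      norm_num
      ring
    · linarith [hpos x hx he, slitPotential_reflecting hx he]
  have hdecay : ∀ ε : ℝ, 0 < ε → ∃ N : ℕ, ∀ (x : ℤ) (n : ℕ), (N : ℤ) ≤ |x| + n →
      |g (x, n) - slitPotential x n| < ε := by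
    intro ε hε
    obtain ⟨N₁, h₁⟩ := hdec (ε / 2) (by positivity)
    obtain ⟨N₂, h₂⟩ := slitPotential_decay (ε / 2) (by positivity)
    refine ⟨N₁ + N₂, fun x n h => ?_⟩
    push_cast at h
    have h₁' := h₁ x n (by rw [Nat.abs_cast]; omega)
    have h₂' := h₂ x n (by omega)
    exact (abs_sub _ _).trans_lt (by linarith)
  refine le_antisymm (sub_nonpos.1 ?_) (sub_nonpos.1 ?_)
  · refine nonpos_of_subharmonic_slit (fun x n => g (x, n) - slitPotential x n)
      (fun x hx he => ?_) (fun x hx he => ?_) (fun x n he => ?_) hdecay x n hxn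
    · simp [hneg x hx, slitPotential_axis_neg hx he]
    · have := hg_axis x hx he
      push_cast
      linarith
    · have h1 := hg_int x n he
      have h2 := slitPotential_harmonic x n
      linarith
  · refine nonpos_of_subharmonic_slit (fun x n => slitPotential x n - g (x, n))
      (fun x hx he => ?_) (fun x hx he => ?_) (fun x n he => ?_)
      (by simpa only [abs_sub_comm] using hdecay) x n hxn
    · simp [hneg x hx, slitPotential_axis_neg hx he]
    · have := hg_axis x hx he
      push_cast
      linarith
    · have h1 := hg_int x n he
      have h2 := slitPotential_harmonic x n
      linarith

end SlitPotential

/-- Values of the slit-plane Green's function on the positive `x`-axis: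
`g(2k,0) = binom(2k,k)/4^k`; equivalently the generating function of the axis values
is `1/√(1-z²)`. -/
theorem slitGreen_axis_values (g : ℤ × ℤ → ℝ) (hg : IsSlitGreen g) :
    (∀ k : ℕ, g (2 * (k : ℤ), 0) = (Nat.choose (2 * k) k : ℝ) / 4 ^ k) ∧
    (∀ z : ℝ, |z| < 1 →
      HasSum (fun k : ℕ => g (2 * (k : ℤ), 0) * z ^ (2 * k))
        (1 / Real.sqrt (1 - z ^ 2))) := by
  have haxis : ∀ k : ℕ, g (2 * (k : ℤ), 0) = (Nat.choose (2 * k) k : ℝ) / 4 ^ k := fun k => by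
    rw [← slitPotential_axis]
    exact hg.eq_slitPotential (2 * k) 0 (by simp)
  refine ⟨haxis, fun z hz => ?_⟩
  simpa only [haxis] using hasSum_centralBinom z hz
end

section
/- For every integer k ≥ 1, g(−2k−1,1) + g(−2k+1,1) = binom(2k,k)/((2k−1)·4^k). (The left side is the current exiting the network at the Dirichlet boundary vertex (−2k,0), so this is the paper's identity C(z) = √(1 − 1/z²) for the generating function of exit currents: it equals the probability that the random walk exits at (−2k,0).) -/
namespace SlitGreen

open Real Set Filter Topology MeasureTheory
open scoped FourierTransform

/-- A function on the half-plane that decays at infinity and whose positive maxima propagate along the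
diagonal is nonpositive. -/
theorem nonpos_of_max_propagates {u : ℤ × ℕ → ℝ} (hu : Tendsto u cofinite (𝓝 0))
    (h : ∀ x n, 0 < u (x, n) → (∀ q, u q ≤ u (x, n)) → u (x + 1, n + 1) = u (x, n)) (p : ℤ × ℕ) :
    u p ≤ 0 := by
  by_contra! hp
  have hfin : ∀ ε > 0, {q | ε ≤ u q}.Finite := fun ε hε => by
    have := hu.eventually (gt_mem_nhds hε)
    simpa [Filter.eventually_cofinite] using this
  obtain ⟨⟨x, n⟩, hq, hmax⟩ := (hfin _ hp).exists_maximalFor u _ ⟨p, le_refl (u p)⟩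
  simp only [mem_ofPred_eq] at hq hmax
  have hmax' : ∀ r, u r ≤ u (x, n) := fun r => by
    by_cases hr : u p ≤ u r
    · by_contra! hlt
      exact absurd (hmax hr hlt.le) (not_le.2 hlt)
    · exact (not_le.1 hr).le.trans hq
  have hdiag : ∀ k : ℕ, u (x + k, n + k) = u (x, n) := by
    intro k
    induction k with
    | zero => simp
    | succ k ih =>
      have := h (x + k) (n + k) (by rw [ih]; exact hp.trans_le hq) (by rw [ih]; exact hmax')
      rw [ih] at this
      rw [← this]
      push_cast
      simp only [add_assoc]
  refine (Set.infinite_range_of_injective (f := fun k : ℕ => (x + (k : ℤ), n + k)) ?_)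
    ((hfin _ hp).subset ?_)
  · intro a b hab
    simpa using (Prod.ext_iff.1 hab).2
  · rintro _ ⟨k, rfl⟩
    exact hq.trans (hdiag k).ge

/-- Uniqueness for the mixed Dirichlet–Neumann problem in the half-plane. -/
theorem eq_zero_of_harmonic {u : ℤ × ℕ → ℝ} (hu : Tendsto u cofinite (𝓝 0))
    (hharm : ∀ x n, 4 * u (x, n + 1) =
      u (x - 1, n) + u (x + 1, n) + u (x - 1, n + 2) + u (x + 1, n + 2))
    (hbdry : ∀ x, u (x, 0) = 0 ∨ 2 * u (x, 0) = u (x - 1, 1) + u (x + 1, 1)) : u = 0 := by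
  have key : ∀ v : ℤ × ℕ → ℝ, Tendsto v cofinite (𝓝 0) →
      (∀ x n, 4 * v (x, n + 1) =
        v (x - 1, n) + v (x + 1, n) + v (x - 1, n + 2) + v (x + 1, n + 2)) →
      (∀ x, v (x, 0) = 0 ∨ 2 * v (x, 0) = v (x - 1, 1) + v (x + 1, 1)) → ∀ p, v p ≤ 0 := by
    intro v hv hharm hbdry
    refine nonpos_of_max_propagates hv fun x n hpos hmax => ?_
    cases n with
    | zero =>
      have h := (hbdry x).resolve_left hpos.ne'
      exact le_antisymm (hmax _) (by linarith [hmax (x - 1, 1)])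
    | succ n =>
      have h := hharm x n
      exact le_antisymm (hmax _)
        (by linarith [hmax (x - 1, n), hmax (x + 1, n), hmax (x - 1, n + 2)])
  ext p
  refine le_antisymm (key u hu hharm hbdry p) ?_
  have := key (fun q => -u q) (by simpa using hu.neg) (fun x n => by linarith [hharm x n])
    (fun x => (hbdry x).imp (by simp) fun h => by linarith) p
  simpa using this

/-- The Riemann–Lebesgue lemma with a nonstationary phase. -/
theorem tendsto_integral_exp_phase {φ φ' : ℝ → ℝ} {s : Set ℝ} (hs : MeasurableSet s)
    (hφ : ∀ t ∈ s, HasDerivAt φ (φ' t) t) (hφ' : ∀ t ∈ s, φ' t ≠ 0) (hinj : InjOn φ s)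
    (w : ℝ → ℂ) :
    Tendsto (fun c : ℝ => ∫ t in s, Complex.exp (c * φ t * Complex.I) * w t)
      (cocompact ℝ) (𝓝 0) := by
  have himg : MeasurableSet (φ '' s) :=
    hs.image_of_continuousOn_injOn (fun t ht => (hφ t ht).continuousAt.continuousWithinAt) hinj
  set ψ := Function.invFunOn φ s
  have hψ : ∀ t ∈ s, ψ (φ t) = t := fun t ht => hinj.leftInvOn_invFunOn ht
  have hRL := Real.tendsto_integral_exp_smul_cocompact
    ((φ '' s).indicator fun v => (|φ' (ψ v)|⁻¹ : ℝ) • w (ψ v))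
  have hscale : Tendsto (fun c : ℝ => -(2 * π)⁻¹ * c) (cocompact ℝ) (cocompact ℝ) :=
    tendsto_cocompact_mul_left₀ (by simp [pi_ne_zero])
  refine (hRL.comp hscale).congr fun c => ?_
  have : (fun v : ℝ => 𝐞 (-(v * (-(2 * π)⁻¹ * c))) •
      (φ '' s).indicator (fun v => (|φ' (ψ v)|⁻¹ : ℝ) • w (ψ v)) v) =
      (φ '' s).indicator (fun v => 𝐞 (-(v * (-(2 * π)⁻¹ * c))) •
        ((|φ' (ψ v)|⁻¹ : ℝ) • w (ψ v))) := by
    ext v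
    by_cases hv : v ∈ φ '' s <;> simp [hv]
  rw [Function.comp_apply, this, integral_indicator himg,
    integral_image_eq_integral_abs_deriv_smul hs (fun t ht => (hφ t ht).hasDerivWithinAt) hinj]
  refine setIntegral_congr_fun hs fun t ht => ?_
  have h0 : |φ' t| ≠ 0 := abs_ne_zero.2 (hφ' t ht)
  simp only [hψ t ht, Circle.smul_def, Real.fourierChar_apply, smul_eq_mul, Complex.real_smul]
  have harg : ((2 * π * -(φ t * (-(2 * π)⁻¹ * c)) : ℝ) : ℂ) = c * φ t := by
    rw [← Complex.ofReal_mul]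
    congr 1
    field_simp
  rw [harg]
  have h0' : ((|φ' t| : ℝ) : ℂ) ≠ 0 := by exact_mod_cast h0
  push_cast
  field_simp

/-- The phase of the Fourier representation of the slit-plane Green's function. -/
noncomputable def phase (t : ℝ) : ℝ := arcsin (sin t / √2)

theorem sin_div_sqrt_two_sq (t : ℝ) : (sin t / √2) ^ 2 = sin t ^ 2 / 2 := by
  rw [div_pow, sq_sqrt (by norm_num)]

theorem sq_sin_div_sqrt_two_lt (t : ℝ) : (sin t / √2) ^ 2 < 1 := by
  rw [sin_div_sqrt_two_sq]
  nlinarith [sin_sq_le_one t]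

theorem sin_phase (t : ℝ) : sin (phase t) = sin t / √2 := by
  have := abs_lt.1 ((sq_lt_one_iff_abs_lt_one _).1 (sq_sin_div_sqrt_two_lt t))
  exact sin_arcsin this.1.le this.2.le

theorem sin_eq_sin_phase (t : ℝ) : sin t = √2 * sin (phase t) := by
  rw [sin_phase]
  field_simp

theorem cos_phase_pos (t : ℝ) : 0 < cos (phase t) := by
  rw [phase, cos_arcsin]
  exact sqrt_pos.2 (by linarith [sq_sin_div_sqrt_two_lt t])

theorem cos_sq_phase (t : ℝ) : cos (phase t) ^ 2 = 1 - sin t ^ 2 / 2 := by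
  rw [cos_sq', sin_phase, sin_div_sqrt_two_sq]

theorem cos_sq_eq (t : ℝ) : cos t ^ 2 = cos (2 * phase t) := by
  rw [cos_two_mul, cos_sq_phase, sin_sq]
  ring

theorem abs_tan_phase_le (t : ℝ) : |tan (phase t)| ≤ |sin t| := by
  rw [← sq_le_sq, tan_eq_sin_div_cos, div_pow, cos_sq_phase, sin_phase, sin_div_sqrt_two_sq,
    div_le_iff₀ (by nlinarith [sin_sq_le_one t])]
  nlinarith [sin_sq_le_one t, sq_nonneg (sin t)]

theorem inv_cos_phase_le (t : ℝ) : (cos (phase t))⁻¹ ≤ 2 := by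
  rw [inv_le_comm₀ (cos_phase_pos t) two_pos]
  nlinarith [cos_sq_phase t, cos_phase_pos t, sin_sq_le_one t]

theorem hasDerivAt_phase (t : ℝ) :
    HasDerivAt phase (cos t / (√2 * cos (phase t))) t := by
  have h := abs_lt.1 ((sq_lt_one_iff_abs_lt_one _).1 (sq_sin_div_sqrt_two_lt t))
  have := (hasDerivAt_arcsin h.1.ne' h.2.ne).comp t ((hasDerivAt_sin t).div_const √2)
  convert! this using 1
  rw [← cos_arcsin]
  change _ = 1 / cos (phase t) * _
  have := (cos_phase_pos t).ne'
  field_simp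

theorem continuous_phase : Continuous phase :=
  continuous_iff_continuousAt.2 fun t => (hasDerivAt_phase t).continuousAt

theorem continuous_tan_phase : Continuous fun t => tan (phase t) := by
  simp only [tan_eq_sin_div_cos]
  exact (continuous_sin.comp continuous_phase).div (continuous_cos.comp continuous_phase)
    fun t => (cos_phase_pos t).ne'

theorem injOn_phase : InjOn phase (Ioo (-(π / 2)) (π / 2)) := by
  intro a ha b hb hab
  refine injOn_sin (Ioo_subset_Icc_self ha) (Ioo_subset_Icc_self hb) ?_
  rw [sin_eq_sin_phase a, sin_eq_sin_phase b, hab]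

/-- Moments of the boundary Fourier representation. -/
noncomputable def moment (m : ℕ) (c d : ℝ) : ℝ :=
  ∫ t in -(π / 2)..π / 2, cos t ^ m * (cos (c * phase t + d) / cos (phase t))

theorem continuous_moment_integrand (m : ℕ) (c d : ℝ) :
    Continuous fun t => cos t ^ m * (cos (c * phase t + d) / cos (phase t)) := by
  have := continuous_phase
  exact (by fun_prop : Continuous fun t => cos t ^ m).mul
    ((by fun_prop : Continuous fun t => cos (c * phase t + d)).div (by fun_prop)
      fun t => (cos_phase_pos t).ne')

theorem moment_recurrence (m : ℕ) (c d : ℝ) :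
    (c + m + 1) * moment m (c + 2) d + (c - m - 1) * moment m (c - 2) d = 0 := by
  have hderiv : ∀ t, HasDerivAt (fun t => 2 * √2 * (cos t ^ (m + 1) * sin (c * phase t + d)))
      ((c + m + 1) * (cos t ^ m * (cos ((c + 2) * phase t + d) / cos (phase t))) +
        (c - m - 1) * (cos t ^ m * (cos ((c - 2) * phase t + d) / cos (phase t)))) t := by
    intro t
    have h := ((((hasDerivAt_cos t).pow (m + 1)).mul
      ((((hasDerivAt_phase t).const_mul c).add_const d).sin)).const_mul (2 * √2))
    convert! h using 1
    have hc := (cos_phase_pos t).ne'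
    have h2 : (√2) ^ 2 = 2 := sq_sqrt (by norm_num)
    have e1 : (c + 2) * phase t + d = (c * phase t + d) + 2 * phase t := by ring
    have e2 : (c - 2) * phase t + d = (c * phase t + d) - 2 * phase t := by ring
    have hcos := cos_sq_eq t
    simp only [Nat.add_sub_cancel, Pi.pow_apply]
    rw [e1, e2, cos_add, cos_sub, sin_eq_sin_phase t, ← hcos, sin_two_mul]
    push_cast
    field_simp
    rw [h2]
    ring
  have hint := intervalIntegral.integral_eq_sub_of_hasDerivAt (fun t _ => hderiv t)
    ((((continuous_moment_integrand m (c + 2) d).const_mul _).add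
      ((continuous_moment_integrand m (c - 2) d).const_mul _)).intervalIntegrable
        (-(π / 2)) (π / 2))
  rw [intervalIntegral.integral_add
    (((continuous_moment_integrand m (c + 2) d).const_mul _).intervalIntegrable _ _)
    (((continuous_moment_integrand m (c - 2) d).const_mul _).intervalIntegrable _ _),
    intervalIntegral.integral_const_mul, intervalIntegral.integral_const_mul] at hint
  simpa [moment] using hint

theorem moment_add_pi (m : ℕ) (c d : ℝ) : moment m c (d + π) = -moment m c d := by
  simp only [moment, ← add_assoc, cos_add_pi, neg_div, mul_neg, intervalIntegral.integral_neg]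

/-- The boundary moment at `x`, with the phase shift appropriate to the diagonal lattice. -/
noncomputable def boundaryMoment (m : ℕ) (x : ℤ) : ℝ := moment m (2 * x + 1) (x * (π / 2))

theorem boundaryMoment_recurrence (m : ℕ) (x : ℤ) :
    (2 * x + 4 + m) * boundaryMoment m (x + 2) = (2 * x + 2 - m) * boundaryMoment m x := by
  have h := moment_recurrence m (2 * x + 3) (x * (π / 2))
  have e : boundaryMoment m (x + 2) = -moment m (2 * x + 3 + 2) (x * (π / 2)) := by
    rw [← moment_add_pi, boundaryMoment]
    push_cast
    congr 1 <;> ring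
  have e' : boundaryMoment m x = moment m (2 * x + 3 - 2) (x * (π / 2)) := by
    rw [boundaryMoment]
    congr 1
    ring
  rw [e, e']
  linarith

theorem boundaryMoment_zero_neg (k : ℕ) : boundaryMoment 0 (-(2 * ((k : ℤ) + 1))) = 0 := by
  induction k with
  | zero =>
    have h := boundaryMoment_recurrence 0 (-2)
    norm_num at h ⊢
    linarith
  | succ k ih =>
    have h := boundaryMoment_recurrence 0 (-(2 * ((k : ℤ) + 1 + 1)))
    rw [show -(2 * ((k : ℤ) + 1 + 1)) + 2 = -(2 * ((k : ℤ) + 1)) by ring, ih] at h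
    push_cast at h ⊢
    have h0 : (2 * (-(2 * ((k : ℝ) + 1 + 1))) + 2 - 0) ≠ 0 := by
      have : (0 : ℝ) ≤ k := k.cast_nonneg
      linarith
    rw [mul_zero] at h
    exact (mul_eq_zero.1 h.symm).resolve_left h0

theorem boundaryMoment_two_pos (k : ℕ) : boundaryMoment 2 (2 * ((k : ℤ) + 1)) = 0 := by
  have key : ∀ j : ℕ, (2 * (2 * (j : ℝ)) + 4 + 2) ≠ 0 := fun j => by positivity
  induction k with
  | zero =>
    have h := boundaryMoment_recurrence 2 0
    norm_num at h ⊢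
    linarith
  | succ k ih =>
    have h := boundaryMoment_recurrence 2 (2 * ((k : ℤ) + 1))
    rw [ih, show 2 * ((k : ℤ) + 1) + 2 = 2 * (((k + 1 : ℕ) : ℤ) + 1) by push_cast; ring] at h
    have := key (k + 1)
    push_cast at h this ⊢
    simpa [this] using h

theorem boundaryMoment_two_zero : boundaryMoment 2 0 = π / 2 := by
  have : ∀ t, cos t ^ 2 * (cos ((2 * ((0 : ℤ) : ℝ) + 1) * phase t + ((0 : ℤ) : ℝ) * (π / 2)) /
      cos (phase t)) = cos t ^ 2 := fun t => by
    simp [(cos_phase_pos t).ne']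
  simp only [boundaryMoment, moment, this, integral_cos_sq]
  simp

theorem boundaryMoment_two_neg (k : ℕ) :
    boundaryMoment 2 (-(2 * (k : ℤ))) =
      -(π / 2) * ((Nat.choose (2 * k) k : ℝ) / ((2 * (k : ℝ) - 1) * 4 ^ k)) := by
  induction k with
  | zero => simp [boundaryMoment_two_zero]
  | succ k ih =>
    have h := boundaryMoment_recurrence 2 (-(2 * ((k + 1 : ℕ) : ℤ)))
    rw [show -(2 * ((k + 1 : ℕ) : ℤ)) + 2 = -(2 * (k : ℤ)) by push_cast; ring, ih] at h
    have hc : ((k : ℝ) + 1) * (Nat.choose (2 * (k + 1)) (k + 1) : ℝ) =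
        2 * (2 * k + 1) * Nat.choose (2 * k) k := by
      exact_mod_cast Nat.succ_mul_centralBinom_succ k
    have hk : (k : ℝ) + 1 ≠ 0 := by positivity
    have hk' : 2 * (k : ℝ) + 1 ≠ 0 := by positivity
    have hk'' : 2 * (k : ℝ) - 1 ≠ 0 := by
      intro h
      have : 2 * k = 1 := by exact_mod_cast sub_eq_zero.1 h
      omega
    have hc' : (Nat.choose (2 * (k + 1)) (k + 1) : ℝ) =
        2 * (2 * k + 1) * Nat.choose (2 * k) k / (k + 1) := by
      rw [eq_div_iff hk, ← hc, mul_comm]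
    rw [hc']
    have h4 : (2 * ((-(2 * ((k + 1 : ℕ) : ℤ)) : ℤ) : ℝ) + 2 - ((2 : ℕ) : ℝ)) ≠ 0 := by
      push_cast
      intro h
      apply hk
      linarith
    rw [← mul_right_inj' h4, ← h]
    push_cast
    rw [show 2 * ((k : ℝ) + 1) - 1 = 2 * k + 1 by ring]
    field_simp
    ring

/-- The integrand of `kernel`. -/
noncomputable def kernelIntegrand (x : ℤ) (n : ℕ) (t : ℝ) : ℝ :=
  cos ((2 * x + 1) * phase t + x * (π / 2)) * ((-tan (phase t)) ^ n / cos (phase t))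

/-- The Fourier representation of the slit-plane Green's function. -/
noncomputable def kernel (x : ℤ) (n : ℕ) : ℝ :=
  π⁻¹ * ∫ t in -(π / 2)..π / 2, kernelIntegrand x n t

theorem continuous_weight (n : ℕ) :
    Continuous fun t => (-tan (phase t)) ^ n / cos (phase t) :=
  (continuous_tan_phase.neg.pow n).div (continuous_cos.comp continuous_phase)
    fun t => (cos_phase_pos t).ne'

theorem continuous_kernelIntegrand (x : ℤ) (n : ℕ) : Continuous (kernelIntegrand x n) := by
  have := continuous_phase
  exact (by fun_prop : Continuous fun t =>
    cos ((2 * x + 1) * phase t + x * (π / 2))).mul (continuous_weight n)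

theorem intervalIntegrable_kernelIntegrand (x : ℤ) (n : ℕ) (a b : ℝ) :
    IntervalIntegrable (kernelIntegrand x n) volume a b :=
  (continuous_kernelIntegrand x n).intervalIntegrable a b

theorem cos_phase_neighbors (x : ℤ) (t : ℝ) :
    cos ((2 * ((x - 1 : ℤ) : ℝ) + 1) * phase t + ((x - 1 : ℤ) : ℝ) * (π / 2)) +
      cos ((2 * ((x + 1 : ℤ) : ℝ) + 1) * phase t + ((x + 1 : ℤ) : ℝ) * (π / 2)) =
    -(4 * sin (phase t) * cos (phase t)) * cos ((2 * x + 1) * phase t + x * (π / 2)) := by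
  push_cast
  rw [show (2 * ((x : ℝ) - 1) + 1) * phase t + (x - 1) * (π / 2) =
      ((2 * x + 1) * phase t + x * (π / 2)) - (2 * phase t + π / 2) by ring,
    show (2 * ((x : ℝ) + 1) + 1) * phase t + (x + 1) * (π / 2) =
      ((2 * x + 1) * phase t + x * (π / 2)) + (2 * phase t + π / 2) by ring,
    cos_sub, cos_add _ (2 * phase t + π / 2), cos_add_pi_div_two, sin_two_mul]
  ring

theorem kernelIntegrand_neighbors (x : ℤ) (n : ℕ) (t : ℝ) :
    kernelIntegrand (x - 1) n t + kernelIntegrand (x + 1) n t =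
      -(4 * sin (phase t) * cos (phase t)) * kernelIntegrand x n t := by
  simp only [kernelIntegrand, ← add_mul, cos_phase_neighbors, mul_assoc]

theorem kernelIntegrand_succ (x : ℤ) (n : ℕ) (t : ℝ) :
    kernelIntegrand x (n + 1) t = -tan (phase t) * kernelIntegrand x n t := by
  simp only [kernelIntegrand, pow_succ]
  ring

theorem kernel_add_neighbors (x : ℤ) (n : ℕ) :
    kernel (x - 1) n + kernel (x + 1) n =
      π⁻¹ * ∫ t in -(π / 2)..π / 2,
        -(4 * sin (phase t) * cos (phase t)) * kernelIntegrand x n t := by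
  simp only [kernel, ← mul_add, ← kernelIntegrand_neighbors]
  rw [intervalIntegral.integral_add (intervalIntegrable_kernelIntegrand ..)
    (intervalIntegrable_kernelIntegrand ..)]

theorem kernel_harmonic (x : ℤ) (n : ℕ) :
    4 * kernel x (n + 1) = kernel (x - 1) n + kernel (x + 1) n + kernel (x - 1) (n + 2) +
      kernel (x + 1) (n + 2) := by
  have hc := continuous_phase
  have hi : ∀ m, IntervalIntegrable (fun t =>
      -(4 * sin (phase t) * cos (phase t)) * kernelIntegrand x m t) volume (-(π / 2)) (π / 2) :=
    fun m => ((by fun_prop : Continuous fun t => -(4 * sin (phase t) * cos (phase t))).mul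
      (continuous_kernelIntegrand x m)).intervalIntegrable _ _
  rw [add_assoc (kernel (x - 1) n + _), kernel_add_neighbors, kernel_add_neighbors, ← mul_add,
    ← intervalIntegral.integral_add (hi _) (hi _), kernel, mul_left_comm,
    ← intervalIntegral.integral_const_mul]
  congr 2
  ext t
  have h := (cos_phase_pos t).ne'
  simp only [kernelIntegrand_succ, tan_eq_sin_div_cos]
  field_simp
  linear_combination sin (phase t) * kernelIntegrand x n t * sin_sq_add_cos_sq (phase t)

theorem kernel_zero (x : ℤ) : kernel x 0 = π⁻¹ * boundaryMoment 0 x := by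
  simp [kernel, boundaryMoment, moment, kernelIntegrand, div_eq_mul_inv]

theorem kernel_boundary (x : ℤ) :
    2 * kernel x 0 - (kernel (x - 1) 1 + kernel (x + 1) 1) = 2 / π * boundaryMoment 2 x := by
  have hc := continuous_phase
  have hi : IntervalIntegrable (fun t =>
      -(4 * sin (phase t) * cos (phase t)) * kernelIntegrand x 1 t) volume (-(π / 2)) (π / 2) :=
    ((by fun_prop : Continuous fun t => -(4 * sin (phase t) * cos (phase t))).mul
      (continuous_kernelIntegrand x 1)).intervalIntegrable _ _
  rw [kernel_add_neighbors, kernel, mul_left_comm, ← intervalIntegral.integral_const_mul, ← mul_sub,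
    ← intervalIntegral.integral_sub ((intervalIntegrable_kernelIntegrand ..).const_mul _) hi,
    boundaryMoment, moment, show 2 / π = π⁻¹ * 2 by ring, mul_assoc,
    ← intervalIntegral.integral_const_mul (2 : ℝ)]
  congr 2
  ext t
  have h := (cos_phase_pos t).ne'
  rw [kernelIntegrand_succ x 0 t, tan_eq_sin_div_cos, kernelIntegrand, cos_sq_eq,
    cos_two_mul]
  generalize cos ((2 * x + 1) * phase t + x * (π / 2)) = a
  field_simp
  linear_combination (-4) * a * sin_sq_add_cos_sq (phase t)

theorem abs_kernel_le (x : ℤ) (n : ℕ) :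
    |kernel x n| ≤ π⁻¹ * ∫ t in -(π / 2)..π / 2, 2 * |sin t| ^ n := by
  rw [kernel, abs_mul, abs_of_pos (inv_pos.2 pi_pos)]
  gcongr
  have hc : Continuous fun t => 2 * |sin t| ^ n := by fun_prop
  rw [← norm_eq_abs]
  refine intervalIntegral.norm_integral_le_of_norm_le (by linarith [pi_pos])
    (Eventually.of_forall fun t _ => ?_)
    (hc.intervalIntegrable (μ := volume) _ _)
  rw [kernelIntegrand, norm_mul, norm_div, norm_pow, norm_neg, norm_eq_abs, norm_eq_abs,
    norm_eq_abs, abs_of_pos (cos_phase_pos t), div_eq_inv_mul (|tan (phase t)| ^ n)]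
  have hw : (cos (phase t))⁻¹ * |tan (phase t)| ^ n ≤ 2 * |sin t| ^ n :=
    mul_le_mul (inv_cos_phase_le t) (pow_le_pow_left₀ (abs_nonneg _) (abs_tan_phase_le t) n)
      (by positivity) two_pos.le
  exact (mul_le_of_le_one_left (mul_nonneg (inv_nonneg.2 (cos_phase_pos t).le) (by positivity))
    (abs_cos_le_one _)).trans hw

theorem tendsto_integral_abs_sin_pow :
    Tendsto (fun n : ℕ => π⁻¹ * ∫ t in -(π / 2)..π / 2, 2 * |sin t| ^ n) atTop (𝓝 0) := by
  have h : Tendsto (fun n : ℕ => ∫ t in -(π / 2)..π / 2, 2 * |sin t| ^ n) atTop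
      (𝓝 (∫ _ in -(π / 2)..π / 2, (0 : ℝ))) := by
    refine intervalIntegral.tendsto_integral_filter_of_dominated_convergence (fun _ => 2)
      (Eventually.of_forall fun n => ?_) (Eventually.of_forall fun n => ?_)
      intervalIntegrable_const ?_
    · exact (by fun_prop : Continuous fun t => 2 * |sin t| ^ n).aestronglyMeasurable
    · refine Eventually.of_forall fun t _ => ?_
      have := pow_le_one₀ (n := n) (abs_nonneg (sin t)) (abs_sin_le_one t)
      rw [norm_of_nonneg (by positivity)]
      linarith
    · filter_upwards [Measure.ae_ne volume (π / 2)] with t ht hmem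
      rw [uIoc_of_le (by linarith [pi_pos])] at hmem
      have hcos := cos_pos_of_mem_Ioo ⟨hmem.1, lt_of_le_of_ne hmem.2 ht⟩
      have : |sin t| < 1 := by
        rw [← sq_lt_one_iff_abs_lt_one, sin_sq]
        nlinarith
      simpa using (tendsto_pow_atTop_nhds_zero_of_lt_one (abs_nonneg _) this).const_mul 2
  simpa using h.const_mul π⁻¹

theorem tendsto_kernel_row (n : ℕ) : Tendsto (fun x : ℤ => kernel x n) cofinite (𝓝 0) := by
  have hderiv : ∀ t ∈ Ioo (-(π / 2)) (π / 2), cos t / (√2 * cos (phase t)) ≠ 0 := fun t ht =>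
    (div_pos (cos_pos_of_mem_Ioo ht) (mul_pos (by positivity) (cos_phase_pos t))).ne'
  have hRL := tendsto_integral_exp_phase measurableSet_Ioo (fun t _ => hasDerivAt_phase t) hderiv
    injOn_phase fun t => (((-tan (phase t)) ^ n / cos (phase t) : ℝ) : ℂ)
  have hfreq : Tendsto (fun x : ℤ => (2 * (x : ℝ) + 1)) cofinite (cocompact ℝ) := by
    refine ((Homeomorph.addRight (1 : ℝ)).isClosedEmbedding.tendsto_cocompact.comp
      ((tendsto_cocompact_mul_left₀ (two_ne_zero' ℝ)).comp
        Int.isClosedEmbedding_coe_real.tendsto_cocompact)).mono_left ?_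
    rw [cocompact_eq_cofinite]
  have hbound := ((hRL.comp hfreq).norm.const_mul π⁻¹)
  rw [norm_zero, mul_zero] at hbound
  refine squeeze_zero_norm (fun x => ?_) hbound
  rw [kernel, norm_mul, norm_of_nonneg (inv_pos.2 pi_pos).le]
  gcongr
  rw [intervalIntegral.integral_of_le (by linarith [pi_pos]), integral_Ioc_eq_integral_Ioo]
  set μ := volume.restrict (Ioo (-(π / 2)) (π / 2))
  set F : ℝ → ℂ := fun t => Complex.exp (((2 * (x : ℝ) + 1 : ℝ) : ℂ) * phase t * Complex.I) *
    (((-tan (phase t)) ^ n / cos (phase t) : ℝ) : ℂ)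
  set d : ℂ := Complex.exp (((x * (π / 2) : ℝ) : ℂ) * Complex.I)
  have hre : ∀ t, kernelIntegrand x n t = (d * F t).re := fun t => by
    simp only [d, F]
    rw [← mul_assoc, ← Complex.exp_add, Complex.re_mul_ofReal, kernelIntegrand, ← add_mul,
      ← Complex.ofReal_mul, ← Complex.ofReal_add, Complex.exp_ofReal_mul_I_re, add_comm]
  have hF : Continuous F := by
    have := continuous_phase
    exact (by fun_prop : Continuous fun t => Complex.exp (((2 * (x : ℝ) + 1 : ℝ) : ℂ) * phase t *
      Complex.I)).mul (Complex.continuous_ofReal.comp (continuous_weight n))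
  have hint : Integrable (fun t => d * F t) μ :=
    (((continuous_const.mul hF).continuousOn (s := Icc (-(π / 2)) (π / 2))).integrableOn_compact
      isCompact_Icc).mono_set Ioo_subset_Icc_self
  simp only [hre]
  have := integral_re hint
  simp only [RCLike.re_to_complex] at this
  rw [this, integral_const_mul]
  refine (Complex.abs_re_le_norm _).trans ?_
  rw [norm_mul, Complex.norm_exp_ofReal_mul_I, one_mul]
  rfl

theorem tendsto_kernel : Tendsto (fun p : ℤ × ℕ => kernel p.1 p.2) cofinite (𝓝 0) := by
  rw [Metric.tendsto_nhds]
  intro ε hε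
  obtain ⟨N, hN⟩ := eventually_atTop.1 (tendsto_integral_abs_sin_pow.eventually (gt_mem_nhds hε))
  rw [eventually_cofinite]
  have hrow : ∀ n, {x : ℤ | ε ≤ |kernel x n|}.Finite := fun n => by
    have := (tendsto_kernel_row n).abs.eventually (gt_mem_nhds (by simpa using hε))
    rw [eventually_cofinite] at this
    simpa using this
  refine ((finite_lt_nat N).biUnion fun n _ =>
    (hrow n).image fun x => (x, n)).subset fun p hp => ?_
  simp only [dist_zero_right, norm_eq_abs, not_lt, mem_ofPred_eq] at hp
  simp only [mem_iUnion, mem_image, mem_ofPred_eq]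
  refine ⟨p.2, ?_, p.1, hp, rfl⟩
  by_contra! h
  exact absurd (hN p.2 h) (not_lt.2 (hp.trans (abs_kernel_le _ _)))

theorem kernel_boundary_neg (k : ℕ) : kernel (-(2 * ((k : ℤ) + 1))) 0 = 0 := by
  rw [kernel_zero, boundaryMoment_zero_neg, mul_zero]

/-- The difference of a function and `kernel` on the even sublattice. -/
noncomputable def discrepancy (g : ℤ × ℤ → ℝ) (p : ℤ × ℕ) : ℝ :=
  if Even (p.1 + p.2) then g (p.1, p.2) - kernel p.1 p.2 else 0

theorem discrepancy_of_even (g : ℤ × ℤ → ℝ) {x : ℤ} {n : ℕ} (h : Even (x + n)) :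
    discrepancy g (x, n) = g (x, n) - kernel x n := if_pos h

theorem discrepancy_of_not_even (g : ℤ × ℤ → ℝ) {x : ℤ} {n : ℕ} (h : ¬Even (x + n)) :
    discrepancy g (x, n) = 0 := if_neg h

theorem discrepancy_harmonic {g : ℤ × ℤ → ℝ} (hg : IsSlitGreen g) (x : ℤ) (n : ℕ) :
    4 * discrepancy g (x, n + 1) = discrepancy g (x - 1, n) + discrepancy g (x + 1, n) +
      discrepancy g (x - 1, n + 2) + discrepancy g (x + 1, n + 2) := by
  obtain ⟨-, -, hharm, -⟩ := hg
  by_cases h : Even (x + (n + 1 : ℕ))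
  · have h1 : Even (x - 1 + n) := by push_cast at h; grind
    have h2 : Even (x + 1 + n) := by push_cast at h; grind
    have h3 : Even (x - 1 + (n + 2 : ℕ)) := by push_cast at h ⊢; grind
    have h4 : Even (x + 1 + (n + 2 : ℕ)) := by push_cast at h ⊢; grind
    rw [discrepancy_of_even g h, discrepancy_of_even g h1, discrepancy_of_even g h2,
      discrepancy_of_even g h3, discrepancy_of_even g h4]
    have hk := kernel_harmonic x n
    have := hharm x (n + 1 : ℕ) (by push_cast; linarith [n.cast_nonneg (α := ℤ)]) h
    rw [show ((n + 1 : ℕ) : ℤ) - 1 = n by push_cast; ring,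
      show ((n + 1 : ℕ) : ℤ) + 1 = (n + 2 : ℕ) by push_cast; ring] at this
    linarith
  · have h1 : ¬Even (x - 1 + n) := by push_cast at h; grind
    have h2 : ¬Even (x + 1 + n) := by push_cast at h; grind
    have h3 : ¬Even (x - 1 + (n + 2 : ℕ)) := by push_cast at h ⊢; grind
    have h4 : ¬Even (x + 1 + (n + 2 : ℕ)) := by push_cast at h ⊢; grind
    simp [discrepancy_of_not_even g h, discrepancy_of_not_even g h1, discrepancy_of_not_even g h2,
      discrepancy_of_not_even g h3, discrepancy_of_not_even g h4]

theorem discrepancy_boundary {g : ℤ × ℤ → ℝ} (hg : IsSlitGreen g) (x : ℤ) :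
    discrepancy g (x, 0) = 0 ∨
      2 * discrepancy g (x, 0) = discrepancy g (x - 1, 1) + discrepancy g (x + 1, 1) := by
  obtain ⟨-, hneg, -, hpos, hzero, -⟩ := hg
  by_cases h : Even x
  swap
  · exact .inl (discrepancy_of_not_even g (by simpa using h))
  have h0 : Even (x + (0 : ℕ)) := by simpa using h
  have h1 : Even (x - 1 + (1 : ℕ)) := by simpa using h
  have h2 : Even (x + 1 + (1 : ℕ)) := by push_cast; grind
  rw [discrepancy_of_even g h0, discrepancy_of_even g h1, discrepancy_of_even g h2]
  have hk := kernel_boundary x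
  rcases lt_trichotomy x 0 with hx | rfl | hx
  · obtain ⟨j, hj⟩ := h
    obtain rfl : x = -(2 * (((-j - 1).toNat : ℤ) + 1)) := by omega
    left
    rw [kernel_boundary_neg, Nat.cast_zero, hneg _ hx, sub_zero]
  · right
    rw [boundaryMoment_two_zero] at hk
    field_simp at hk
    norm_num at hk ⊢
    linarith
  · obtain ⟨j, hj⟩ := h
    right
    have h3 : x = 2 * (((j - 1).toNat : ℤ) + 1) := by omega
    have h4 : boundaryMoment 2 x = 0 := by rw [h3]; exact boundaryMoment_two_pos _
    rw [h4, mul_zero] at hk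
    have := hpos x hx ⟨j, hj⟩
    push_cast
    linarith

theorem tendsto_discrepancy {g : ℤ × ℤ → ℝ} (hg : IsSlitGreen g) :
    Tendsto (discrepancy g) cofinite (𝓝 0) := by
  obtain ⟨-, -, -, -, -, -, hdecay⟩ := hg
  have hlim : Tendsto (fun p : ℤ × ℕ => g (p.1, p.2)) cofinite (𝓝 0) := by
    rw [Metric.tendsto_nhds]
    intro ε hε
    obtain ⟨N, hN⟩ := hdecay ε hε
    rw [eventually_cofinite]
    refine ((finite_Icc (-(N : ℤ)) N).prod (finite_Iic N)).subset fun p hp => ?_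
    simp only [dist_zero_right, norm_eq_abs, not_lt, mem_ofPred_eq] at hp
    have h : |p.1| + |(p.2 : ℤ)| < N := by
      by_contra! h
      exact absurd (hN _ _ h) (not_lt.2 hp)
    rw [Nat.abs_cast] at h
    simp only [mem_prod, mem_Icc, mem_Iic, ← abs_le]
    have := abs_nonneg p.1
    omega
  refine squeeze_zero_norm (fun p => ?_) (by simpa using (hlim.sub tendsto_kernel).norm)
  rw [discrepancy]
  split_ifs
  · rfl
  · simp

theorem eq_kernel_of_isSlitGreen {g : ℤ × ℤ → ℝ} (hg : IsSlitGreen g) {x : ℤ} {n : ℕ}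
    (h : Even (x + n)) : g (x, n) = kernel x n := by
  rw [← sub_eq_zero, ← discrepancy_of_even g h]
  exact congr_fun (eq_zero_of_harmonic (tendsto_discrepancy hg) (discrepancy_harmonic hg)
    (discrepancy_boundary hg)) (x, n)

end SlitGreen

/-- Exit currents on the Dirichlet boundary of the slit plane: for `k ≥ 1`,
`g(-2k-1,1) + g(-2k+1,1) = binom(2k,k)/((2k-1)·4^k)`, the paper's identity
`C(z) = √(1 - 1/z²)`. -/
theorem slitGreen_exit_currents (g : ℤ × ℤ → ℝ) (hg : IsSlitGreen g) :
    ∀ k : ℕ, 1 ≤ k →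
      g (-(2 * (k : ℤ)) - 1, 1) + g (-(2 * (k : ℤ)) + 1, 1) =
        (Nat.choose (2 * k) k : ℝ) / ((2 * (k : ℝ) - 1) * 4 ^ k) := by
  intro k hk
  have hpar : ∀ j : ℤ, Even j → Even (j - 1 + (1 : ℕ)) ∧ Even (j + 1 + (1 : ℕ)) := fun j hj => by
    push_cast
    grind
  have heven : Even (-(2 * (k : ℤ))) := (even_two_mul _).neg
  have h1 := SlitGreen.eq_kernel_of_isSlitGreen hg (hpar _ heven).1
  have h2 := SlitGreen.eq_kernel_of_isSlitGreen hg (hpar _ heven).2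
  rw [Nat.cast_one] at h1 h2
  have h := SlitGreen.kernel_boundary (-(2 * (k : ℤ)))
  have h0 := SlitGreen.kernel_boundary_neg (k - 1)
  rw [show -(2 * (((k - 1 : ℕ) : ℤ) + 1)) = -(2 * (k : ℤ)) by omega] at h0
  rw [h0, SlitGreen.boundaryMoment_two_neg] at h
  rw [h1, h2]
  have hpi := Real.pi_ne_zero
  rw [← mul_assoc, show 2 / Real.pi * -(Real.pi / 2) = -1 by field_simp] at h
  linarith
end

section
/- g(1,1) = 2 − √2 and g(−1,1) = √2 − 1. -/
open Real Set Filter Topology MeasureTheory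
open scoped FourierTransform

/-- Maximum principle for the slit half-plane with mixed boundary conditions. -/
theorem nonpos_of_slit_harmonic {h : ℤ → ℕ → ℝ}
    (hneg : ∀ x : ℤ, x < 0 → Even x → h x 0 = 0)
    (hint : ∀ (x : ℤ) (n : ℕ), Even (x + (n + 1 : ℕ)) → 4 * h x (n + 1) =
      h (x - 1) n + h (x + 1) n + h (x - 1) (n + 2) + h (x + 1) (n + 2))
    (hbdry : ∀ x : ℤ, 0 ≤ x → Even x → 2 * h x 0 = h (x - 1) 1 + h (x + 1) 1)
    (hdecay : ∀ ε : ℝ, 0 < ε → ∃ N : ℕ, ∀ (x : ℤ) (n : ℕ), (N : ℤ) ≤ |x| + n → |h x n| < ε)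
    (x : ℤ) (n : ℕ) (hxn : Even (x + n)) : h x n ≤ 0 := by
  by_contra! hpos
  obtain ⟨N, hN⟩ := hdecay _ hpos
  let s : Finset (ℤ × ℕ) :=
    ((Finset.Icc (-(N : ℤ)) N) ×ˢ (Finset.range (N + 1))).filter (fun p => Even (p.1 + p.2))
  have hmem : ∀ (a : ℤ) (b : ℕ), Even (a + b) → |a| + b ≤ N → (a, b) ∈ s := by
    intro a b hab hle
    simp only [s, Finset.mem_filter, Finset.mem_product, Finset.mem_Icc, Finset.mem_range]
    have := abs_le.1 (show |a| ≤ (N : ℤ) by omega)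
    have := abs_nonneg a
    refine ⟨⟨⟨by omega, by omega⟩, by omega⟩, hab⟩
  have hsx : (x, n) ∈ s := by
    refine hmem x n hxn ?_
    by_contra! hlt
    exact absurd (hN x n hlt.le) (not_lt.2 (le_abs_self _))
  obtain ⟨⟨a, b⟩, hab, hmax⟩ := s.exists_max_image (fun p => h p.1 p.2) ⟨_, hsx⟩
  have hM : h x n ≤ h a b := hmax _ hsx
  have hle : ∀ (c : ℤ) (d : ℕ), Even (c + d) → h c d ≤ h a b := by
    intro c d hcd
    by_cases hc : |c| + d ≤ N
    · exact hmax _ (hmem c d hcd hc)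
    · exact ((le_abs_self _).trans (hN c d (not_le.1 hc).le).le).trans hM
  have hEven : Even (a + b) := (Finset.mem_filter.1 hab).2
  have hup : ∀ k : ℕ, h (a + k) (b + k) = h a b := by
    intro k
    induction k with
    | zero => simp
    | succ k ih =>
      generalize hc : a + (k : ℤ) = c at ih
      generalize hd : b + k = d at ih
      have hcd : Even (c + d) := by subst hc hd; grind
      have e1 : a + ((k + 1 : ℕ) : ℤ) = c + 1 := by subst hc; push_cast; ring
      have e2 : b + (k + 1) = d + 1 := by omega
      rw [e1, e2]
      cases d with
      | zero =>
        have hc0 : 0 ≤ c := by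
          by_contra! hlt
          rw [hneg c hlt (by simpa using hcd)] at ih
          linarith
        have h1 := hbdry c hc0 (by simpa using hcd)
        have h2 := hle (c - 1) 1 (by grind)
        have h3 := hle (c + 1) 1 (by grind)
        simp only [zero_add]
        linarith
      | succ d =>
        have h1 := hint c d hcd
        have h2 := hle (c - 1) d (by grind)
        have h3 := hle (c + 1) d (by grind)
        have h4 := hle (c - 1) (d + 2) (by grind)
        have h5 := hle (c + 1) (d + 2) (by grind)
        show h (c + 1) (d + 2) = _
        linarith
  have := hN (a + N) (b + N) (by have := abs_nonneg (a + (N : ℤ)); push_cast; omega)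
  rw [hup] at this
  exact absurd (this.trans_le hM) (not_lt.2 (le_abs_self _))

/-- The integral of `cos (s t) / √(cos t)` over `[-π/2, π/2]`. -/
noncomputable def weightedCos (s : ℝ) : ℝ := ∫ t in (-(π / 2))..(π / 2), cos (s * t) / √(cos t)

theorem cos_half_pos {t : ℝ} (ht : t ∈ Icc (-(π / 2)) (π / 2)) : 0 < cos (t / 2) :=
  cos_pos_of_mem_Ioo ⟨by linarith [ht.1, pi_pos], by linarith [ht.2, pi_pos]⟩

theorem cos_eq_half (t : ℝ) : cos t = 2 * cos (t / 2) ^ 2 - 1 := by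
  rw [← cos_two_mul]; congr 1; ring

theorem hasDerivAt_arcsin_sin {t : ℝ} (ht : t ∈ Ioo (-(π / 2)) (π / 2)) :
    HasDerivAt (fun t => √2 * arcsin (√2 * sin (t / 2))) (cos (t / 2) / √(cos t)) t := by
  have hc := cos_pos_of_mem_Ioo ht
  have hs : 1 - (√2 * sin (t / 2)) ^ 2 = cos t := by
    rw [mul_pow, sq_sqrt (by norm_num), cos_eq_half, cos_sq']; ring
  have h1 : √2 * sin (t / 2) ≠ -1 := fun h => by rw [h] at hs; norm_num at hs; linarith
  have h2 : √2 * sin (t / 2) ≠ 1 := fun h => by rw [h] at hs; norm_num at hs; linarith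
  have h3 : HasDerivAt (fun t : ℝ => √2 * sin (t / 2)) (√2 * (cos (t / 2) * (1 / 2))) t :=
    (((hasDerivAt_id t).div_const 2).sin).const_mul _
  have h4 := ((hasDerivAt_arcsin h1 h2).comp t h3).const_mul (√2)
  refine h4.congr_deriv ?_
  rw [hs]
  have : √2 * √2 = 2 := mul_self_sqrt (by norm_num)
  field_simp
  linear_combination cos (t / 2) * this

theorem hasDerivAt_arcsin_tan {t : ℝ} (ht : t ∈ Ioo (-(π / 2)) (π / 2)) :
    HasDerivAt (fun t => 2 * arcsin (tan (t / 2))) (1 / cos (t / 2) / √(cos t)) t := by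
  have hc := cos_pos_of_mem_Ioo ht
  have hh := cos_half_pos (Ioo_subset_Icc_self ht)
  have hs : 1 - tan (t / 2) ^ 2 = cos t / cos (t / 2) ^ 2 := by
    rw [tan_eq_sin_div_cos, cos_eq_half t, div_pow, sin_sq]; field_simp; ring
  have hs0 : 0 < 1 - tan (t / 2) ^ 2 := by rw [hs]; positivity
  have h1 : tan (t / 2) ≠ -1 := fun h => by rw [h] at hs0; norm_num at hs0
  have h2 : tan (t / 2) ≠ 1 := fun h => by rw [h] at hs0; norm_num at hs0
  have h3 : HasDerivAt (fun t : ℝ => tan (t / 2)) (1 / cos (t / 2) ^ 2 * (1 / 2)) t :=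
    HasDerivAt.comp t (h₂ := tan) (hasDerivAt_tan hh.ne') ((hasDerivAt_id t).div_const 2)
  have h4 := ((hasDerivAt_arcsin h1 h2).comp t h3).const_mul 2
  refine h4.congr_deriv ?_
  rw [hs, sqrt_div hc.le, sqrt_sq hh.le]
  field_simp

theorem neg_pi_div_two_le_pi_div_two : -(π / 2) ≤ π / 2 := by linarith [pi_pos]

theorem continuousOn_tan_half : ContinuousOn (fun t => tan (t / 2)) (Icc (-(π / 2)) (π / 2)) := by
  simp only [tan_eq_sin_div_cos]
  exact (by fun_prop : Continuous fun t : ℝ => sin (t / 2)).continuousOn.div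
    (by fun_prop : Continuous fun t : ℝ => cos (t / 2)).continuousOn
    fun t ht => (cos_half_pos ht).ne'

theorem intervalIntegrable_cos_half :
    IntervalIntegrable (fun t => cos (t / 2) / √(cos t)) volume (-(π / 2)) (π / 2) := by
  rw [intervalIntegrable_iff_integrableOn_Ioc_of_le neg_pi_div_two_le_pi_div_two]
  refine intervalIntegral.integrableOn_deriv_of_nonneg
    (g := fun t => √2 * arcsin (√2 * sin (t / 2))) ?_ (fun t ht => hasDerivAt_arcsin_sin ht) ?_
  · exact Continuous.continuousOn (by fun_prop)
  · intro t ht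
    have := cos_half_pos (Ioo_subset_Icc_self ht)
    positivity

theorem intervalIntegrable_div_sqrt_cos {f : ℝ → ℝ} (hf : ContinuousOn f (Icc (-(π / 2)) (π / 2))) :
    IntervalIntegrable (fun t => f t / √(cos t)) volume (-(π / 2)) (π / 2) := by
  have h : ContinuousOn (fun t => f t / cos (t / 2)) (uIcc (-(π / 2)) (π / 2)) := by
    rw [uIcc_of_le neg_pi_div_two_le_pi_div_two]
    exact hf.div (by fun_prop) fun t ht => (cos_half_pos ht).ne'
  refine (intervalIntegrable_cos_half.mul_continuousOn h).congr ?_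
  intro t ht
  rw [uIoc_of_le neg_pi_div_two_le_pi_div_two] at ht
  have := cos_half_pos (Ioc_subset_Icc_self ht)
  simp only
  field_simp

theorem weightedCos_neg (s : ℝ) : weightedCos (-s) = weightedCos s := by
  simp [weightedCos]

theorem weightedCos_half : weightedCos (1 / 2) = √2 * π := by
  have h := intervalIntegral.integral_eq_sub_of_hasDerivAt_of_le neg_pi_div_two_le_pi_div_two
    (f := fun t => √2 * arcsin (√2 * sin (t / 2)))
    (Continuous.continuousOn (by fun_prop)) (fun t ht => hasDerivAt_arcsin_sin ht)
    intervalIntegrable_cos_half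
  have e : √2 * (√2 / 2) = 1 := by rw [← mul_div_assoc, mul_self_sqrt (by norm_num)]; norm_num
  have e1 : π / 2 / 2 = π / 4 := by ring
  rw [neg_div, e1, sin_neg, sin_pi_div_four, mul_neg, e, arcsin_neg, arcsin_one] at h
  rw [weightedCos]
  simp only [one_div, inv_mul_eq_div]
  rw [h]; ring

theorem integral_inv_cos_half :
    ∫ t in (-(π / 2))..(π / 2), 1 / cos (t / 2) / √(cos t) = 2 * π := by
  have h := intervalIntegral.integral_eq_sub_of_hasDerivAt_of_le neg_pi_div_two_le_pi_div_two
    (f := fun t => 2 * arcsin (tan (t / 2)))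
    (continuousOn_const.mul (continuous_arcsin.comp_continuousOn continuousOn_tan_half))
    (fun t ht => hasDerivAt_arcsin_tan ht)
    (intervalIntegrable_div_sqrt_cos (continuousOn_const.div (by fun_prop)
      fun t ht => (cos_half_pos ht).ne'))
  have e1 : π / 2 / 2 = π / 4 := by ring
  rw [neg_div, e1, tan_neg, tan_pi_div_four, arcsin_neg, arcsin_one] at h
  rw [h]; ring

theorem weightedCos_rec (s : ℝ) :
    (2 * s + 1) * weightedCos (s + 1) + (2 * s - 1) * weightedCos (s - 1) = 0 := by
  have hi1 := intervalIntegrable_div_sqrt_cos (f := fun t => cos ((s + 1) * t)) (by fun_prop)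
  have hi2 := intervalIntegrable_div_sqrt_cos (f := fun t => cos ((s - 1) * t)) (by fun_prop)
  have hi := (hi1.const_mul (2 * s + 1)).add (hi2.const_mul (2 * s - 1))
  have h := intervalIntegral.integral_eq_sub_of_hasDerivAt_of_le neg_pi_div_two_le_pi_div_two
    (f := fun t => 4 * (√(cos t) * sin (s * t)))
    (Continuous.continuousOn (by fun_prop)) (fun t ht => ?_) hi
  · simp only [cos_neg, cos_pi_div_two, sqrt_zero, zero_mul, mul_zero, sub_zero] at h
    rw [intervalIntegral.integral_add (hi1.const_mul _) (hi2.const_mul _),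
      intervalIntegral.integral_const_mul, intervalIntegral.integral_const_mul] at h
    exact h
  · have hc := cos_pos_of_mem_Ioo ht
    have h1 := (hasDerivAt_cos t).sqrt hc.ne'
    have h2 : HasDerivAt (fun t => sin (s * t)) (cos (s * t) * (s * 1)) t :=
      ((hasDerivAt_id t).const_mul s).sin
    refine ((h1.mul h2).const_mul 4).congr_deriv ?_
    have e1 : (s + 1) * t = s * t + t := by ring
    have e2 : (s - 1) * t = s * t - t := by ring
    have e3 : √(cos t) * √(cos t) = cos t := mul_self_sqrt hc.le
    have e4 : 0 < √(cos t) := sqrt_pos.2 hc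
    rw [e1, e2, cos_add, cos_sub]
    field_simp
    rw [sq, e3]
    ring

theorem weightedCos_eq_zero (k : ℕ) : weightedCos (2 * k + 3 / 2) = 0 := by
  induction k with
  | zero =>
    have h := weightedCos_rec (1 / 2)
    norm_num at h ⊢
    exact h
  | succ k ih =>
    have h := weightedCos_rec (2 * k + 5 / 2)
    rw [show (2 * (k : ℝ) + 5 / 2 - 1) = 2 * k + 3 / 2 by ring, ih,
      show (2 * (k : ℝ) + 5 / 2 + 1) = 2 * (k + 1 : ℕ) + 3 / 2 by push_cast; ring,
      mul_zero, add_zero] at h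
    exact (mul_eq_zero.1 h).resolve_left (by positivity)


/-- The integrand of `slitKernel`. -/
noncomputable def slitIntegrand (x : ℤ) (n : ℕ) (t : ℝ) : ℝ :=
  (-tan (t / 2)) ^ n * cos ((x + 1 / 2) * t + x * (π / 2)) / √(cos t)

/-- An explicit integral formula for the slit-plane Green's function. -/
noncomputable def slitKernel (x : ℤ) (n : ℕ) : ℝ :=
  (√2 * π)⁻¹ * ∫ t in (-(π / 2))..(π / 2), slitIntegrand x n t

theorem intervalIntegrable_slitIntegrand_s3 (x : ℤ) (n : ℕ) :
    IntervalIntegrable (slitIntegrand x n) volume (-(π / 2)) (π / 2) :=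
  intervalIntegrable_div_sqrt_cos ((continuousOn_tan_half.neg.pow n).mul (by fun_prop))

theorem cos_shift_add (x : ℤ) (t : ℝ) :
    cos (((x - 1 : ℤ) + 1 / 2) * t + (x - 1 : ℤ) * (π / 2)) +
      cos (((x + 1 : ℤ) + 1 / 2) * t + (x + 1 : ℤ) * (π / 2)) =
    -(2 * sin t) * cos ((x + 1 / 2) * t + x * (π / 2)) := by
  have e1 : ((x - 1 : ℤ) + 1 / 2) * t + (x - 1 : ℤ) * (π / 2) =
    ((x + 1 / 2) * t + x * (π / 2)) - (t + π / 2) := by push_cast; ring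
  have e2 : ((x + 1 : ℤ) + 1 / 2) * t + (x + 1 : ℤ) * (π / 2) =
    ((x + 1 / 2) * t + x * (π / 2)) + (t + π / 2) := by push_cast; ring
  rw [e1, e2, cos_sub, cos_add _ (t + π / 2), cos_add_pi_div_two]
  ring

theorem sin_mul_one_add_tan_half_sq {t : ℝ} (ht : t ∈ Icc (-(π / 2)) (π / 2)) :
    sin t * (1 + tan (t / 2) ^ 2) = 2 * tan (t / 2) := by
  have hh := cos_half_pos ht
  have e : sin t = 2 * sin (t / 2) * cos (t / 2) := by rw [← sin_two_mul]; congr 1; ring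
  have := sin_sq_add_cos_sq (t / 2)
  rw [e, tan_eq_sin_div_cos]
  field_simp
  linear_combination sin (t / 2) * this

theorem tan_half_mul_sin {t : ℝ} (ht : t ∈ Icc (-(π / 2)) (π / 2)) :
    tan (t / 2) * sin t = 1 - cos t := by
  have hh := cos_half_pos ht
  have e : sin t = 2 * sin (t / 2) * cos (t / 2) := by rw [← sin_two_mul]; congr 1; ring
  have := sin_sq_add_cos_sq (t / 2)
  rw [e, cos_eq_half t, tan_eq_sin_div_cos]
  field_simp
  linear_combination 2 * this

theorem slitKernel_harmonic (x : ℤ) (n : ℕ) :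
    4 * slitKernel x (n + 1) = slitKernel (x - 1) n + slitKernel (x + 1) n +
      slitKernel (x - 1) (n + 2) + slitKernel (x + 1) (n + 2) := by
  have hi := intervalIntegrable_slitIntegrand_s3
  simp only [slitKernel]
  rw [← mul_add, ← mul_add, ← mul_add,
    ← intervalIntegral.integral_add (hi _ _) (hi _ _),
    ← intervalIntegral.integral_add ((hi _ _).add (hi _ _)) (hi _ _),
    ← intervalIntegral.integral_add (((hi _ _).add (hi _ _)).add (hi _ _)) (hi _ _),
    mul_left_comm, ← intervalIntegral.integral_const_mul]
  congr 1
  refine intervalIntegral.integral_congr fun t ht => ?_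
  rw [uIcc_of_le neg_pi_div_two_le_pi_div_two] at ht
  have h1 := cos_shift_add x t
  have h2 := sin_mul_one_add_tan_half_sq ht
  simp only [slitIntegrand]
  rw [← mul_div_assoc, ← add_div, ← add_div, ← add_div]
  congr 1
  linear_combination
    -((-tan (t / 2)) ^ n + (-tan (t / 2)) ^ (n + 2)) * h1 +
    2 * (-tan (t / 2)) ^ n * cos ((x + 1 / 2) * t + x * (π / 2)) * h2

theorem cos_even_shift (m : ℤ) (t : ℝ) :
    cos (((2 * m : ℤ) + 1 / 2) * t + (2 * m : ℤ) * (π / 2)) =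
      cos (m * π) * cos ((2 * m + 1 / 2) * t) := by
  have e : ((2 * m : ℤ) + 1 / 2) * t + (2 * m : ℤ) * (π / 2) =
    (2 * m + 1 / 2) * t + m * π := by push_cast; ring
  rw [e, cos_add, sin_int_mul_pi]; ring

theorem slitKernel_even_zero (m : ℤ) :
    slitKernel (2 * m) 0 = (√2 * π)⁻¹ * (cos (m * π) * weightedCos (2 * m + 1 / 2)) := by
  rw [slitKernel, weightedCos, ← intervalIntegral.integral_const_mul (cos (m * π))]
  congr 1
  refine intervalIntegral.integral_congr fun t _ => ?_
  simp only [slitIntegrand]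
  rw [cos_even_shift]; ring

theorem slitKernel_zero_zero : slitKernel 0 0 = 1 := by
  have h := slitKernel_even_zero 0
  simp only [mul_zero, Int.cast_zero, zero_mul, cos_zero, one_mul, zero_add, weightedCos_half] at h
  rw [h, inv_mul_cancel₀ (by positivity)]

theorem slitKernel_of_neg {x : ℤ} (hx : x < 0) (he : Even x) : slitKernel x 0 = 0 := by
  obtain ⟨m, rfl⟩ := even_iff_exists_two_mul.1 he
  obtain ⟨k, rfl⟩ : ∃ k : ℕ, m = -1 - k := ⟨(-1 - m).toNat, by omega⟩
  have e : 2 * ((-1 - k : ℤ) : ℝ) + 1 / 2 = -(2 * k + 3 / 2) := by push_cast; ring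
  rw [slitKernel_even_zero, e, weightedCos_neg, weightedCos_eq_zero, mul_zero, mul_zero]

theorem slitKernel_flux (m : ℤ) :
    2 * slitKernel (2 * m) 0 - (slitKernel (2 * m - 1) 1 + slitKernel (2 * m + 1) 1) =
      (√2 * π)⁻¹ * (cos (m * π) *
        (weightedCos (2 * m + 3 / 2) + weightedCos (2 * m - 1 / 2))) := by
  have hi := intervalIntegrable_slitIntegrand_s3
  have hi1 := intervalIntegrable_div_sqrt_cos
    (f := fun t => cos ((2 * m + 3 / 2) * t)) (by fun_prop)
  have hi2 := intervalIntegrable_div_sqrt_cos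
    (f := fun t => cos ((2 * m - 1 / 2) * t)) (by fun_prop)
  simp only [slitKernel, weightedCos]
  rw [mul_left_comm, ← intervalIntegral.integral_const_mul, ← mul_add, ← mul_sub,
    ← intervalIntegral.integral_add (hi _ _) (hi _ _),
    ← intervalIntegral.integral_sub ((hi _ _).const_mul _) ((hi _ _).add (hi _ _)),
    ← intervalIntegral.integral_add hi1 hi2, ← intervalIntegral.integral_const_mul (cos (m * π))]
  congr 1
  refine intervalIntegral.integral_congr fun t ht => ?_
  rw [uIcc_of_le neg_pi_div_two_le_pi_div_two] at ht
  have h1 := cos_shift_add (2 * m) t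
  have h2 := tan_half_mul_sin ht
  have h3 := cos_even_shift m t
  have e1 : (2 * m + 3 / 2) * t = (2 * m + 1 / 2) * t + t := by ring
  have e2 : (2 * m - 1 / 2) * t = (2 * m + 1 / 2) * t - t := by ring
  simp only [slitIntegrand]
  rw [← mul_div_assoc, ← add_div, ← add_div, ← sub_div, ← mul_div_assoc (cos (m * π)), e1, e2,
    cos_add _ t,
    cos_sub]
  congr 1
  linear_combination tan (t / 2) * h1 + (2 - 2 * (1 - cos t)) * h3 -
    2 * cos (((2 * m : ℤ) + 1 / 2) * t + (2 * m : ℤ) * (π / 2)) * h2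

theorem slitKernel_flux_of_pos {x : ℤ} (hx : 0 < x) (he : Even x) :
    2 * slitKernel x 0 = slitKernel (x - 1) 1 + slitKernel (x + 1) 1 := by
  obtain ⟨m, rfl⟩ := even_iff_exists_two_mul.1 he
  obtain ⟨k, rfl⟩ : ∃ k : ℕ, m = k + 1 := ⟨(m - 1).toNat, by omega⟩
  have h := slitKernel_flux (k + 1)
  have e1 : 2 * ((k + 1 : ℤ) : ℝ) + 3 / 2 = 2 * (k + 1 : ℕ) + 3 / 2 := by push_cast; ring
  have e2 : 2 * ((k + 1 : ℤ) : ℝ) - 1 / 2 = 2 * k + 3 / 2 := by push_cast; ring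
  rw [e1, e2, weightedCos_eq_zero, weightedCos_eq_zero] at h
  linarith

theorem slitKernel_flux_zero :
    2 * slitKernel 0 0 - (slitKernel (-1) 1 + slitKernel 1 1) = 1 := by
  have h := slitKernel_flux 0
  have h0 := weightedCos_eq_zero 0
  simp only [Nat.cast_zero, mul_zero, zero_add] at h0
  simp only [mul_zero, Int.cast_zero, zero_mul, cos_zero, one_mul, zero_add, h0, zero_sub,
    weightedCos_neg, weightedCos_half] at h
  rw [h, inv_mul_cancel₀ (by positivity)]

theorem slitKernel_neg_one_one : slitKernel (-1) 1 = √2 - 1 := by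
  have hi1 := intervalIntegrable_div_sqrt_cos (f := fun t => 1 / cos (t / 2))
    (continuousOn_const.div (by fun_prop) fun t ht => (cos_half_pos ht).ne')
  have hi2 := intervalIntegrable_div_sqrt_cos (f := fun t => cos (1 / 2 * t)) (by fun_prop)
  have h : ∫ t in (-(π / 2))..(π / 2), slitIntegrand (-1) 1 t = 2 * π - √2 * π := by
    rw [← integral_inv_cos_half, ← weightedCos_half, weightedCos,
      ← intervalIntegral.integral_sub hi1 hi2]
    refine intervalIntegral.integral_congr fun t ht => ?_
    rw [uIcc_of_le neg_pi_div_two_le_pi_div_two] at ht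
    have hh := cos_half_pos ht
    have e : ((-1 : ℤ) + 1 / 2) * t + (-1 : ℤ) * (π / 2) = -(t / 2 + π / 2) := by push_cast; ring
    have := sin_sq_add_cos_sq (t / 2)
    simp only [slitIntegrand]
    rw [e, cos_neg, cos_add_pi_div_two, tan_eq_sin_div_cos, ← sub_div, one_div_mul_eq_div]
    congr 1
    field_simp
    linear_combination this
  have e : √2 * √2 = 2 := mul_self_sqrt (by norm_num)
  rw [slitKernel, h]
  field_simp
  linear_combination -e

theorem abs_tan_half_lt_one {t : ℝ} (ht : t ∈ Ioo (-(π / 2)) (π / 2)) : |tan (t / 2)| < 1 := by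
  have hc := cos_pos_of_mem_Ioo ht
  have hh := cos_half_pos (Ioo_subset_Icc_self ht)
  rw [← sq_lt_one_iff_abs_lt_one, tan_eq_sin_div_cos, div_pow, div_lt_one (by positivity), sin_sq]
  linarith [cos_eq_half t]

theorem ae_mem_Ioo : ∀ᵐ t : ℝ, t ∈ uIoc (-(π / 2)) (π / 2) → t ∈ Ioo (-(π / 2)) (π / 2) := by
  have : ∀ᵐ t : ℝ, t ≠ π / 2 := by simp [ae_iff]
  filter_upwards [this] with t ht h
  rw [uIoc_of_le neg_pi_div_two_le_pi_div_two] at h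
  exact ⟨h.1, lt_of_le_of_ne h.2 ht⟩

theorem tendsto_integral_tan_half_pow :
    Tendsto (fun n : ℕ => ∫ t in (-(π / 2))..(π / 2), |tan (t / 2)| ^ n / √(cos t))
      atTop (𝓝 0) := by
  have h := intervalIntegral.tendsto_integral_filter_of_dominated_convergence (μ := volume)
    (a := -(π / 2)) (b := π / 2) (l := atTop)
    (F := fun (n : ℕ) t => |tan (t / 2)| ^ n / √(cos t)) (f := fun _ => 0)
    (fun t => 1 / √(cos t)) ?_ ?_ (intervalIntegrable_div_sqrt_cos continuousOn_const) ?_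
  · simpa using h
  · exact Eventually.of_forall fun n => ((intervalIntegrable_iff.1 (intervalIntegrable_div_sqrt_cos
      (continuousOn_tan_half.abs.pow n))).aestronglyMeasurable)
  · refine Eventually.of_forall fun n => ?_
    filter_upwards [ae_mem_Ioo] with t ht h
    rw [norm_of_nonneg (by positivity)]
    gcongr
    exact pow_le_one₀ (abs_nonneg _) (abs_tan_half_lt_one (ht h)).le
  · filter_upwards [ae_mem_Ioo] with t ht h
    simpa using (tendsto_pow_atTop_nhds_zero_of_lt_one (abs_nonneg _)
      (abs_tan_half_lt_one (ht h))).div_const (√(cos t))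

theorem abs_slitKernel_le (x : ℤ) (n : ℕ) : |slitKernel x n| ≤
    (√2 * π)⁻¹ * ∫ t in (-(π / 2))..(π / 2), |tan (t / 2)| ^ n / √(cos t) := by
  rw [slitKernel, ← norm_eq_abs, norm_mul, norm_of_nonneg (by positivity)]
  gcongr
  refine intervalIntegral.norm_integral_le_of_norm_le neg_pi_div_two_le_pi_div_two ?_
    (intervalIntegrable_div_sqrt_cos (continuousOn_tan_half.abs.pow n))
  refine Eventually.of_forall fun t _ => ?_
  rw [slitIntegrand, norm_div, norm_mul, norm_pow, norm_neg, norm_of_nonneg (sqrt_nonneg _)]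
  gcongr
  exact mul_le_of_le_one_right (by positivity) (abs_cos_le_one _)

theorem tendsto_slitKernel_cofinite (n : ℕ) :
    Tendsto (fun x : ℤ => slitKernel x n) cofinite (𝓝 0) := by
  let F : ℝ → ℂ := (Ioc (-(π / 2)) (π / 2)).indicator
    fun t => (((-tan (t / 2)) ^ n / √(cos t) : ℝ) : ℂ)
  have hRL := Real.tendsto_integral_exp_smul_cocompact F
  have hx : Tendsto (fun x : ℤ => -((x : ℝ) + 1 / 2) / (2 * π)) cofinite (cocompact ℝ) := by
    have h1 : Tendsto (fun x : ℤ => (x : ℝ)) cofinite (cocompact ℝ) :=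
      Int.tendsto_coe_cofinite
    let e : ℝ ≃ₜ ℝ := ((Homeomorph.addRight (1 / 2 : ℝ)).trans (Homeomorph.neg ℝ)).trans
      (Homeomorph.mulRight₀ (2 * π)⁻¹ (by positivity))
    exact (e.isClosedEmbedding.tendsto_cocompact.comp h1)
  have h := (hRL.comp hx).norm.const_mul ((√2 * π)⁻¹)
  rw [norm_zero, mul_zero] at h
  refine squeeze_zero_norm (fun x => ?_) h
  rw [slitKernel, norm_mul, norm_of_nonneg (by positivity)]
  gcongr
  have hre : (∫ t in (-(π / 2))..(π / 2), slitIntegrand x n t) =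
      (Complex.exp ((x * (π / 2) : ℝ) * Complex.I) *
        ∫ v : ℝ, 𝐞 (-(v * (-((x : ℝ) + 1 / 2) / (2 * π)))) • F v).re := by
    have hF : (fun v : ℝ => 𝐞 (-(v * (-((x : ℝ) + 1 / 2) / (2 * π)))) • F v) =
        (Ioc (-(π / 2)) (π / 2)).indicator fun t =>
          Complex.exp (((x + 1 / 2) * t : ℝ) * Complex.I) *
            (((-tan (t / 2)) ^ n / √(cos t) : ℝ) : ℂ) := by
      ext t
      by_cases ht : t ∈ Ioc (-(π / 2)) (π / 2)
      · have e : 2 * π * -(t * (-((x : ℝ) + 1 / 2) / (2 * π))) = (x + 1 / 2) * t := by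
          field_simp
        simp only [F, indicator_of_mem ht, Circle.smul_def, fourierChar_apply, e, smul_eq_mul]
      · simp only [F, indicator_of_notMem ht, smul_zero]
    have hf := intervalIntegrable_div_sqrt_cos (continuousOn_tan_half.neg.pow n)
    have hi : IntervalIntegrable (fun t : ℝ => Complex.exp ((x * (π / 2) : ℝ) * Complex.I) *
        (Complex.exp (((x + 1 / 2) * t : ℝ) * Complex.I) *
          (((-tan (t / 2)) ^ n / √(cos t) : ℝ) : ℂ))) volume (-(π / 2)) (π / 2) := by
      refine IntervalIntegrable.const_mul (IntervalIntegrable.continuousOn_mul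
        (⟨hf.1.ofReal, hf.2.ofReal⟩) ?_) _
      exact Continuous.continuousOn (by fun_prop)
    rw [hF, integral_indicator measurableSet_Ioc, ← integral_const_mul,
      intervalIntegral.integral_of_le neg_pi_div_two_le_pi_div_two]
    rw [intervalIntegrable_iff_integrableOn_Ioc_of_le neg_pi_div_two_le_pi_div_two] at hi
    refine Eq.trans ?_ (Complex.reCLM.integral_comp_comm hi)
    refine integral_congr_ae (Eventually.of_forall fun t => ?_)
    simp only [Complex.reCLM_apply, slitIntegrand]
    rw [← mul_assoc, ← Complex.exp_add, ← add_mul, ← Complex.ofReal_add, Complex.re_mul_ofReal,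
      Complex.exp_ofReal_mul_I_re, add_comm (_ * _)]
    ring
  rw [hre]
  refine (Complex.abs_re_le_norm _).trans ?_
  rw [norm_mul, Complex.norm_exp_ofReal_mul_I, one_mul]
  rfl

theorem slitKernel_decay {ε : ℝ} (hε : 0 < ε) :
    ∃ N : ℕ, ∀ (x : ℤ) (n : ℕ), (N : ℤ) ≤ |x| + n → |slitKernel x n| < ε := by
  have h1 := tendsto_integral_tan_half_pow.const_mul ((√2 * π)⁻¹)
  rw [mul_zero] at h1
  obtain ⟨Y, hY⟩ := eventually_atTop.1 (h1.eventually (gt_mem_nhds hε))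
  have h2 : ∀ n : ℕ, ∃ B : ℕ, ∀ x : ℤ, (B : ℤ) ≤ |x| → |slitKernel x n| < ε := by
    intro n
    have h3 := (tendsto_slitKernel_cofinite n).abs
    rw [abs_zero, Int.cofinite_eq] at h3
    obtain ⟨h4, h5⟩ := eventually_sup.1 (h3.eventually (gt_mem_nhds hε))
    obtain ⟨a, ha⟩ := eventually_atBot.1 h4
    obtain ⟨b, hb⟩ := eventually_atTop.1 h5
    refine ⟨a.natAbs + b.natAbs, fun x hx => ?_⟩
    rcases le_total 0 x with h0 | h0
    · exact hb x (by rw [abs_of_nonneg h0] at hx; omega)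
    · exact ha x (by rw [abs_of_nonpos h0] at hx; omega)
  choose B hB using h2
  refine ⟨Y + ∑ n ∈ Finset.range Y, B n, fun x n hxn => ?_⟩
  by_cases hn : Y ≤ n
  · exact (abs_slitKernel_le x n).trans_lt (hY n hn)
  · refine hB n x ?_
    have := Finset.single_le_sum (f := B) (fun _ _ => Nat.zero_le _)
      (Finset.mem_range.2 (not_le.1 hn))
    push_cast at hxn
    zify at this
    omega

theorem IsSlitGreen.eq_slitKernel {g : ℤ × ℤ → ℝ} (hg : IsSlitGreen g) {x : ℤ} {n : ℕ}
    (hxn : Even (x + n)) : g (x, n) = slitKernel x n := by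
  obtain ⟨-, hneg, hharm, hrefl, hcur, -, hdecay⟩ := hg
  let h : ℤ → ℕ → ℝ := fun x n => g (x, n) - slitKernel x n
  have h1 : ∀ x : ℤ, x < 0 → Even x → h x 0 = 0 := by
    intro x hx he
    simp [h, hneg x hx, slitKernel_of_neg hx he]
  have h2 : ∀ (x : ℤ) (n : ℕ), Even (x + (n + 1 : ℕ)) → 4 * h x (n + 1) =
      h (x - 1) n + h (x + 1) n + h (x - 1) (n + 2) + h (x + 1) (n + 2) := by
    intro x n he
    have a := hharm x (n + 1 : ℕ) (by omega) he
    have b := slitKernel_harmonic x n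
    have e1 : ((n + 1 : ℕ) : ℤ) - 1 = n := by omega
    have e2 : ((n + 1 : ℕ) : ℤ) + 1 = (n + 2 : ℕ) := by omega
    rw [e1, e2] at a
    simp only [h]
    linarith
  have h3 : ∀ x : ℤ, 0 ≤ x → Even x → 2 * h x 0 = h (x - 1) 1 + h (x + 1) 1 := by
    intro x hx he
    simp only [h, Nat.cast_zero, Nat.cast_one]
    rcases hx.eq_or_lt with rfl | hx
    · have := slitKernel_flux_zero
      simp only [zero_sub, zero_add]
      linarith
    · have a := hrefl x hx he
      have b := slitKernel_flux_of_pos hx he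
      linarith
  have h4 : ∀ ε : ℝ, 0 < ε → ∃ N : ℕ, ∀ (x : ℤ) (n : ℕ), (N : ℤ) ≤ |x| + n → |h x n| < ε := by
    intro ε hε
    obtain ⟨N, hN⟩ := hdecay _ (half_pos hε)
    obtain ⟨M, hM⟩ := slitKernel_decay (half_pos hε)
    refine ⟨N + M, fun x n hxn => ?_⟩
    push_cast at hxn
    have a := hN x n (by rw [Nat.abs_cast]; omega)
    have b := hM x n (by omega)
    exact (abs_sub _ _).trans_lt (by linarith)
  have hle := nonpos_of_slit_harmonic h1 h2 h3 h4 x n hxn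
  have hge := nonpos_of_slit_harmonic (h := fun x n => -h x n)
    (fun x hx he => by rw [h1 x hx he, neg_zero])
    (fun x n he => by linarith [h2 x n he])
    (fun x hx he => by linarith [h3 x hx he])
    (by simpa only [abs_neg] using h4) x n hxn
  simp only [h] at hle hge
  linarith

/-- The values of the slit-plane Green's function at `(1,1)` and `(-1,1)`. -/
theorem slitGreen_first_row (g : ℤ × ℤ → ℝ) (hg : IsSlitGreen g) :
    g (1, 1) = 2 - Real.sqrt 2 ∧ g (-1, 1) = Real.sqrt 2 - 1 := by
  have h0 := hg.eq_slitKernel (x := 0) (n := 0) (by simp)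
  have h1 := hg.eq_slitKernel (x := -1) (n := 1) (by simp)
  have hcur := hg.2.2.2.2.1
  rw [slitKernel_zero_zero] at h0
  rw [slitKernel_neg_one_one] at h1
  push_cast at h0 h1
  rw [h0, h1] at hcur
  exact ⟨by linarith, h1⟩
end

section
/- Reflection self-duality identities: for every integer x and every integer y ≥ 1, g(x,y) + g(−x,y) = g(x−1,y−1) + g(−x−1,y−1), and g(x,y−1) − g(x−1,y) = g(−x,y−1) − g(−x−1,y). In particular, g(0,y) = g(−1,y−1) for every y ≥ 1. -/
open Finset

/-- The slit-plane Green's function in the diagonal coordinates `x = a - b`, `y = a + b`, in which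
the half-plane lattice becomes the half `a + b ≥ 0` of the standard square lattice. -/
structure DiagSlitGreen (G : ℤ → ℤ → ℝ) : Prop where
  dirichlet : ∀ a, a < 0 → G a (-a) = 0
  harmonic : ∀ a b, 1 ≤ a + b →
    4 * G a b = G (a - 1) b + G (a + 1) b + G a (b - 1) + G a (b + 1)
  reflecting : ∀ a, 0 < a → 2 * G a (-a) = G (a + 1) (-a) + G a (-a + 1)
  pole : 2 * G 0 0 - G 1 0 - G 0 1 = 1
  nonneg : ∀ a b, 0 ≤ G a b
  le_one : ∀ a b, G a b ≤ 1
  decay : ∀ ε : ℝ, 0 < ε → ∃ N : ℕ, ∀ a b : ℤ, (N : ℤ) ≤ |a| ∨ (N : ℤ) ≤ |b| → |G a b| < ε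

theorem IsSlitGreen.diagSlitGreen {g : ℤ × ℤ → ℝ} (hg : IsSlitGreen g) :
    DiagSlitGreen fun a b => g (a - b, a + b) := by
  obtain ⟨-, h1, h2, h3, h4, h5, h6⟩ := hg
  refine ⟨fun a ha => ?_, fun a b hab => ?_, fun a ha => ?_, by simpa using h4,
    fun a b => (h5 _ _).1, fun a b => (h5 _ _).2, fun ε hε => ?_⟩
  · simpa using h1 (a - -a) (by omega)
  · have h := h2 (a - b) (a + b) hab ⟨a, by ring⟩
    rw [show a - 1 - b = a - b - 1 by ring, show a - 1 + b = a + b - 1 by ring,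
      show a + 1 - b = a - b + 1 by ring, show a + 1 + b = a + b + 1 by ring,
      show a - (b - 1) = a - b + 1 by ring, show a + (b - 1) = a + b - 1 by ring,
      show a - (b + 1) = a - b - 1 by ring, show a + (b + 1) = a + b + 1 by ring]
    linarith
  · have h := h3 (a + a) (by omega) ⟨a, rfl⟩
    rw [show a - -a = a + a by ring, show a + -a = 0 by ring,
      show a + 1 - -a = a + a + 1 by ring, show a + 1 + -a = 1 by ring,
      show a - (-a + 1) = a + a - 1 by ring, show a + (-a + 1) = 1 by ring]
    linarith
  · obtain ⟨N, hN⟩ := h6 ε hε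
    refine ⟨N, fun a b hab => hN _ _ ?_⟩
    rcases hab with h | h
    · have := abs_add_le (a - b) (a + b)
      rw [show a - b + (a + b) = 2 * a by ring, abs_mul] at this
      norm_num at this
      linarith [abs_nonneg a]
    · have := abs_sub (a + b) (a - b)
      rw [show a + b - (a - b) = 2 * b by ring, abs_mul] at this
      norm_num at this
      linarith [abs_nonneg b]

/-- The defect of the first reflection identity, in diagonal coordinates. -/
def reflectionDefect (G : ℤ → ℤ → ℝ) (a b : ℤ) : ℝ :=
  G a b + G b a - G (a - 1) b - G (b - 1) a

theorem reflectionDefect_comm (G : ℤ → ℤ → ℝ) (a b : ℤ) :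
    reflectionDefect G a b = reflectionDefect G b a := by
  unfold reflectionDefect; ring

/-- Summation of harmonicity along a segment: the flux through it changes by the flux through its
two ends. -/
theorem sum_flux_segment {G : ℤ → ℤ → ℝ}
    (hG : ∀ a b, 1 ≤ a + b →
      4 * G a b = G (a - 1) b + G (a + 1) b + G a (b - 1) + G a (b + 1))
    (a b : ℤ) (hab : 1 ≤ a + b) (m : ℕ) :
    ∑ i ∈ range m, (G a (b + i) - G (a + 1) (b + i)) =
      ∑ i ∈ range m, (G (a - 1) (b + i) - G a (b + i)) +
        (G a (b + m) - G a (b + m - 1)) - (G a b - G a (b - 1)) := by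
  induction m with
  | zero => simp
  | succ m ih =>
    rw [sum_range_succ, sum_range_succ, ih]
    have h := hG a (b + m) (by omega)
    push_cast
    rw [show b + ((m : ℤ) + 1) - 1 = b + m by ring, show b + ((m : ℤ) + 1) = b + m + 1 by ring]
    linarith

namespace DiagSlitGreen

variable {G : ℤ → ℤ → ℝ}

theorem defect_harmonic (h : DiagSlitGreen G) {a b : ℤ} (hab : 2 ≤ a + b) :
    4 * reflectionDefect G a b = reflectionDefect G (a - 1) b + reflectionDefect G (a + 1) b +
      reflectionDefect G a (b - 1) + reflectionDefect G a (b + 1) := by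
  have h1 := h.harmonic a b (by omega)
  have h2 := h.harmonic b a (by omega)
  have h3 := h.harmonic (a - 1) b (by omega)
  have h4 := h.harmonic (b - 1) a (by omega)
  unfold reflectionDefect
  rw [show a + 1 - 1 = a - 1 + 1 by ring, show b + 1 - 1 = b - 1 + 1 by ring]
  linarith

theorem defect_boundary (h : DiagSlitGreen G) {a : ℤ} (ha : 2 ≤ a) :
    3 * reflectionDefect G a (1 - a) = reflectionDefect G (a + 1) (1 - a) +
      reflectionDefect G a (2 - a) + reflectionDefect G (a + 1) (-a) := by
  have h1 := h.harmonic a (1 - a) (by omega)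
  have h2 := h.harmonic (1 - a) a (by omega)
  have h3 := h.reflecting a (by omega)
  have h4 := h.reflecting (a - 1) (by omega)
  have h5 := h.dirichlet (-a) (by omega)
  have h6 := h.dirichlet (-a - 1) (by omega)
  have h7 := h.dirichlet (1 - a) (by omega)
  unfold reflectionDefect
  ring_nf at *
  linarith

theorem defect_origin (h : DiagSlitGreen G) : reflectionDefect G 1 0 = G 0 0 - 1 := by
  have h1 := h.pole
  have h2 := h.dirichlet (-1) (by norm_num)
  norm_num [reflectionDefect] at *
  linarith

theorem defect_decay (h : DiagSlitGreen G) {ε : ℝ} (hε : 0 < ε) :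
    ∃ N : ℕ, ∀ a b : ℤ, (N : ℤ) ≤ |a| ∨ (N : ℤ) ≤ |b| → |reflectionDefect G a b| < ε := by
  obtain ⟨N, hN⟩ := h.decay (ε / 4) (by linarith)
  refine ⟨N + 1, fun a b hab => ?_⟩
  push_cast at hab
  have step : ∀ c : ℤ, |c| ≤ |c - 1| + 1 := fun c => by simpa using abs_add_le (c - 1) 1
  have ha := step a
  have hb := step b
  have h1 := abs_lt.1 (hN a b (by omega))
  have h2 := abs_lt.1 (hN b a (by omega))
  have h3 := abs_lt.1 (hN (a - 1) b (by omega))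
  have h4 := abs_lt.1 (hN (b - 1) a (by omega))
  rw [abs_lt]
  unfold reflectionDefect
  constructor <;> linarith

end DiagSlitGreen

/-- A maximum principle on `a + b ≥ 1`, with a boundary condition that combines reflection with
an outward drift along the boundary. -/
theorem nonpos_of_harmonic_of_drift {H : ℤ → ℤ → ℝ} (hsymm : ∀ a b, H a b = H b a)
    (hharm : ∀ a b, 2 ≤ a + b →
      4 * H a b = H (a - 1) b + H (a + 1) b + H a (b - 1) + H a (b + 1))
    (hbdry : ∀ a, 2 ≤ a → 3 * H a (1 - a) = H (a + 1) (1 - a) + H a (2 - a) + H (a + 1) (-a))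
    (hdecay : ∀ ε : ℝ, 0 < ε → ∃ N : ℕ, ∀ a b : ℤ,
      (N : ℤ) ≤ |a| ∨ (N : ℤ) ≤ |b| → |H a b| < ε)
    (horigin : H 1 0 ≤ 0) (a b : ℤ) (hab : 1 ≤ a + b) : H a b ≤ 0 := by
  by_contra! hpos
  obtain ⟨N, hN⟩ := hdecay _ hpos
  let S : Finset (ℤ × ℤ) := {p ∈ Icc (-(N : ℤ)) N ×ˢ Icc (-(N : ℤ)) N | 1 ≤ p.1 + p.2}
  have mem_S : ∀ c d : ℤ, 1 ≤ c + d → H a b ≤ H c d → (c, d) ∈ S := by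
    intro c d hcd hle
    have hc : ¬ ((N : ℤ) ≤ |c| ∨ (N : ℤ) ≤ |d|) := fun hc =>
      absurd (abs_lt.1 (hN c d hc)).2 (not_lt.2 hle)
    simp only [S, mem_filter, mem_product, mem_Icc]
    push Not at hc
    have := abs_lt.1 hc.1
    have := abs_lt.1 hc.2
    omega
  obtain ⟨p, hpS, hp⟩ := S.exists_max_image (fun q => H q.1 q.2) ⟨_, mem_S a b hab le_rfl⟩
  have hpa : H a b ≤ H p.1 p.2 := hp _ (mem_S a b hab le_rfl)
  have hmax : ∀ c d : ℤ, 1 ≤ c + d → H c d ≤ H p.1 p.2 := by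
    intro c d hcd
    rcases le_total (H a b) (H c d) with hle | hle
    · exact hp _ (mem_S c d hcd hle)
    · exact hle.trans hpa
  have hpreg : 1 ≤ p.1 + p.2 := (mem_filter.1 hpS).2
  have climb : ∀ c d : ℤ, 1 ≤ c + d → H c d = H p.1 p.2 →
      ∃ c' d' : ℤ, c' + d' = c + d + 1 ∧ H c' d' = H p.1 p.2 := by
    intro c d hcd hM
    rcases hcd.lt_or_eq with hlt | heq
    · refine ⟨c + 1, d, by ring, ?_⟩
      have e := hharm c d (by omega)
      have := hmax (c - 1) d (by omega)
      have := hmax (c + 1) d (by omega)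
      have := hmax c (d - 1) (by omega)
      have := hmax c (d + 1) (by omega)
      linarith
    · have drift : ∀ e : ℤ, 2 ≤ e → H e (1 - e) = H p.1 p.2 →
          H (e + 1) (1 - e) = H p.1 p.2 := by
        intro e he hM
        have := hbdry e he
        have := hmax (e + 1) (1 - e) (by omega)
        have := hmax e (2 - e) (by omega)
        have := hmax (e + 1) (-e) (by omega)
        linarith
      rcases le_or_gt 2 c with hc | hc
      · obtain rfl : d = 1 - c := by omega
        exact ⟨c + 1, 1 - c, by ring, drift c hc hM⟩
      · rcases le_or_gt 2 d with hd | hd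
        · obtain rfl : c = 1 - d := by omega
          rw [hsymm] at hM
          exact ⟨d + 1, 1 - d, by ring, drift d hd hM⟩
        · exfalso
          have hcd' : c = 1 ∧ d = 0 ∨ c = 0 ∧ d = 1 := by omega
          rcases hcd' with ⟨rfl, rfl⟩ | ⟨rfl, rfl⟩
          · linarith
          · rw [hsymm] at hM
            linarith
  have far : ∀ n : ℕ, ∃ c d : ℤ, c + d = p.1 + p.2 + n ∧ H c d = H p.1 p.2 := by
    intro n
    induction n with
    | zero => exact ⟨p.1, p.2, by simp, rfl⟩
    | succ n ih =>
      obtain ⟨c, d, hcd, hM⟩ := ih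
      obtain ⟨c', d', hcd', hM'⟩ := climb c d (by omega) hM
      exact ⟨c', d', by push_cast; omega, hM'⟩
  obtain ⟨c, d, hcd, hM⟩ := far (2 * N)
  push_cast at hcd
  have h1 := le_abs_self c
  have h2 := le_abs_self d
  have := (abs_lt.1 (hN c d (by omega))).2
  linarith

namespace DiagSlitGreen

variable {G : ℤ → ℤ → ℝ}

theorem defect_nonpos (h : DiagSlitGreen G) {a b : ℤ} (hab : 1 ≤ a + b) :
    reflectionDefect G a b ≤ 0 :=
  nonpos_of_harmonic_of_drift (reflectionDefect_comm G) (fun _ _ => h.defect_harmonic)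
    (fun _ => h.defect_boundary) (fun _ => h.defect_decay)
    (by linarith [h.defect_origin, h.le_one 0 0]) a b hab

/-- Current conservation in the region `0 ≤ a ≤ n`, `b ≤ n`, `0 ≤ a + b`. -/
theorem flux_eq_one (h : DiagSlitGreen G) (n : ℕ) :
    ∑ i ∈ range (2 * n + 1), (G n (-n + i) - G (n + 1) (-n + i)) +
      ∑ i ∈ range (n + 1), (G i n - G i (n + 1)) +
      ∑ i ∈ range n, (G 0 (i + 1) - G (-1) (i + 1)) = 1 := by
  induction n with
  | zero =>
    have := h.pole
    norm_num
    linarith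
  | succ n ih =>
    have right := sum_flux_segment h.harmonic (n + 1) (-n) (by omega) (2 * n + 1)
    have top := sum_flux_segment (G := fun a b => G b a)
      (fun a b hab => by linarith [h.harmonic b a (by omega)]) (n + 1) 0 (by omega) (n + 1)
    have corner := h.harmonic (n + 1) (n + 1) (by omega)
    have bottom := h.reflecting (n + 1) (by omega)
    have left := sum_range_succ (fun i : ℕ => G 0 (i + 1) - G (-1) (i + 1)) n
    rw [show 2 * (n + 1) + 1 = 2 * n + 1 + 1 + 1 by ring, sum_range_succ, sum_range_succ',
      sum_range_succ _ (n + 1)]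
    push_cast at *
    simp only [zero_add, add_sub_cancel_right, add_zero] at *
    simp only [show ∀ i : ℤ, -((n : ℤ) + 1) + (i + 1) = -n + i by intro i; ring,
      show -(n : ℤ) + (2 * n + 1) = n + 1 by ring,
      show -((n : ℤ) + 1) + (2 * n + 2) = n + 1 by ring,
      show -((n : ℤ) + 1) + 1 = -n by ring, show -(n : ℤ) - 1 = -(n + 1) by ring,
      add_sub_cancel_right] at *
    linarith

theorem left_flux_le (h : DiagSlitGreen G) (n : ℕ) :
    G (n + 1) 0 - G 0 0 + ∑ i ∈ range (n + 1), (G 0 (i + 1) - G (-1) (i + 1)) ≤ G 0 0 - 1 := by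
  induction n with
  | zero =>
    have := h.defect_origin
    simp [reflectionDefect] at *
    linarith
  | succ n ih =>
    have := h.defect_nonpos (a := n + 2) (b := 0) (by omega)
    rw [sum_range_succ]
    simp only [reflectionDefect, show (n : ℤ) + 2 - 1 = n + 1 by ring, zero_sub] at this
    push_cast
    rw [show (n : ℤ) + 1 + 1 = n + 2 by ring]
    linarith

theorem apply_zero_zero (h : DiagSlitGreen G) : G 0 0 = 1 := by
  refine le_antisymm (h.le_one 0 0) ?_
  by_contra! hlt
  set c := 1 - G 0 0 with hc
  have hcpos : 0 < c := by linarith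
  let W : ℕ → ℝ := fun n =>
    ∑ i ∈ range (2 * n + 1), G n (-n + i) + ∑ i ∈ range (n + 1), G i n
  obtain ⟨N, hN⟩ := h.decay (c / 3) (by linarith)
  have step : ∀ n, N + 1 ≤ n → W (n + 1) ≤ W n - c := by
    intro n hn
    obtain ⟨m, rfl⟩ : ∃ m, n = m + 1 := ⟨n - 1, by omega⟩
    have flux := h.flux_eq_one (m + 1)
    have left := h.left_flux_le m
    have hm := h.nonneg (m + 1) 0
    have far := le_abs_self ((m : ℤ) + 1 + 1)
    have corner := (abs_lt.1 (hN (m + 1 + 1) (m + 1 + 1) (by omega))).2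
    have bottom := (abs_lt.1 (hN (m + 1 + 1) (-(m + 1 + 1)) (by omega))).2
    simp only [W]
    rw [show 2 * (m + 1 + 1) + 1 = 2 * (m + 1) + 1 + 1 + 1 by ring, sum_range_succ,
      sum_range_succ', sum_range_succ _ (m + 1 + 1)]
    simp only [sum_sub_distrib] at flux left
    push_cast at *
    simp only [show ∀ i : ℤ, -((m : ℤ) + 1 + 1) + (i + 1) = -(m + 1) + i by intro i; ring,
      show -((m : ℤ) + 1 + 1) + (2 * (m + 1) + 2) = m + 1 + 1 by ring, add_zero] at *
    linarith
  have descent : ∀ k : ℕ, W (N + 1 + k) ≤ W (N + 1) - k * c := by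
    intro k
    induction k with
    | zero => simp
    | succ k ih =>
      have := step (N + 1 + k) (by omega)
      push_cast
      rw [← add_assoc]
      linarith
  obtain ⟨k, hk⟩ := exists_nat_gt (W (N + 1) / c)
  rw [div_lt_iff₀ hcpos] at hk
  have hW : 0 ≤ W (N + 1 + k) :=
    add_nonneg (sum_nonneg fun _ _ => h.nonneg _ _) (sum_nonneg fun _ _ => h.nonneg _ _)
  linarith [descent k]

theorem defect_eq_zero (h : DiagSlitGreen G) {a b : ℤ} (hab : 1 ≤ a + b) :
    reflectionDefect G a b = 0 := by
  refine le_antisymm (h.defect_nonpos hab) (neg_nonpos.1 ?_)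
  refine nonpos_of_harmonic_of_drift (H := fun a b => -reflectionDefect G a b)
    (fun a b => by rw [reflectionDefect_comm]) (fun a b hab => by linarith [h.defect_harmonic hab])
    (fun a ha => by linarith [h.defect_boundary ha])
    (fun ε hε => by simpa only [abs_neg] using h.defect_decay hε) ?_ a b hab
  simp [h.defect_origin, h.apply_zero_zero]

theorem conjugate_defect_eq_zero (h : DiagSlitGreen G) {a b : ℤ} (hab : 0 ≤ a + b) :
    G a b - G a (b + 1) - G b a + G b (a + 1) = 0 := by
  have shift : ∀ n : ℕ, G (a + n) b - G (a + n) (b + 1) - G b (a + n) + G b (a + n + 1) =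
      G a b - G a (b + 1) - G b a + G b (a + 1) := by
    intro n
    induction n with
    | zero => simp
    | succ n ih =>
      rw [← ih]
      have h1 := h.harmonic b (a + n + 1) (by omega)
      have h2 := h.defect_eq_zero (a := a + n + 1) (b := b) (by omega)
      have h3 := h.defect_eq_zero (a := a + n + 1) (b := b + 1) (by omega)
      simp only [reflectionDefect, add_sub_cancel_right] at h1 h2 h3
      push_cast
      rw [← add_assoc]
      linarith
  refine abs_eq_zero.1 (le_antisymm (le_of_forall_pos_le_add fun ε hε => ?_) (abs_nonneg _))
  obtain ⟨N, hN⟩ := h.decay (ε / 4) (by linarith)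
  obtain ⟨n, hn⟩ : ∃ n : ℕ, (N : ℤ) ≤ a + n := ⟨(N - a).toNat, by omega⟩
  have h0 := le_abs_self (a + n)
  have h0_succ := le_abs_self (a + n + 1)
  have h1 := abs_lt.1 (hN (a + n) b (by omega))
  have h2 := abs_lt.1 (hN (a + n) (b + 1) (by omega))
  have h3 := abs_lt.1 (hN b (a + n) (by omega))
  have h4 := abs_lt.1 (hN b (a + n + 1) (by omega))
  rw [← shift n, abs_le]
  constructor <;> linarith

end DiagSlitGreen

/-- Reflection self-duality identities for the slit-plane Green's function. -/
theorem slitGreen_reflection_duality (g : ℤ × ℤ → ℝ) (hg : IsSlitGreen g) :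
    (∀ x y : ℤ, 1 ≤ y →
      g (x, y) + g (-x, y) = g (x - 1, y - 1) + g (-x - 1, y - 1) ∧
      g (x, y - 1) - g (x - 1, y) = g (-x, y - 1) - g (-x - 1, y)) ∧
    (∀ y : ℤ, 1 ≤ y → g (0, y) = g (-1, y - 1)) := by
  have hzero := hg.1
  have h := hg.diagSlitGreen
  have main : ∀ x y : ℤ, 1 ≤ y →
      g (x, y) + g (-x, y) = g (x - 1, y - 1) + g (-x - 1, y - 1) ∧
      g (x, y - 1) - g (x - 1, y) = g (-x, y - 1) - g (-x - 1, y) := by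
    intro x y hy
    rcases Int.even_or_odd (x + y) with ⟨a, ha⟩ | hodd
    · constructor
      · obtain ⟨b, rfl⟩ : ∃ b, y = a + b := ⟨y - a, by ring⟩
        obtain rfl : x = a - b := by omega
        have e := h.defect_eq_zero hy
        simp only [reflectionDefect] at e
        ring_nf at e ⊢
        linarith
      · rw [hzero x (y - 1), hzero (x - 1) y, hzero (-x) (y - 1), hzero (-x - 1) y] <;>
          right <;> rw [Int.odd_iff] <;> omega
    · constructor
      · rw [hzero x y, hzero (-x) y, hzero (x - 1) (y - 1), hzero (-x - 1) (y - 1)] <;>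
          right <;> rw [Int.odd_iff] at * <;> omega
      · obtain ⟨a, ha⟩ := hodd
        obtain ⟨b, rfl⟩ : ∃ b, y = a + b + 1 := ⟨y - a - 1, by ring⟩
        obtain rfl : x = a - b := by omega
        have e := h.conjugate_defect_eq_zero (a := a) (b := b) (by omega)
        ring_nf at e ⊢
        linarith
  refine ⟨main, fun y hy => ?_⟩
  have := (main 0 y hy).1
  simp only [neg_zero, zero_sub] at this
  linarith
end

section
/- For every integer k ≥ 0, g(0,2k) + g(0,2k+2) = √2 · g(2k,0). -/
open Filter Topology

/-- The properties of a slit-plane Green's function after even reflection in the `x`-axis. -/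
structure IsReflectedGreen (G : ℤ → ℤ → ℝ) : Prop where
  parity : ∀ x y, Odd (x + y) → G x y = 0
  symm : ∀ x y, G x (-y) = G x y
  slit : ∀ x, x < 0 → G x 0 = 0
  harm : ∀ x y, (y ≠ 0 ∨ 0 < x) →
    4 * G x y = G (x - 1) (y - 1) + G (x + 1) (y - 1) + G (x - 1) (y + 1) + G (x + 1) (y + 1)
  source : 2 * G 0 0 - G 1 1 - G (-1) 1 = 1
  nonneg : ∀ x y, 0 ≤ G x y
  le_one : ∀ x y, G x y ≤ 1
  decay : Tendsto (fun p : ℤ × ℤ => G p.1 p.2) cofinite (𝓝 0)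

theorem tendsto_cofinite_of_decay {G : ℤ → ℤ → ℝ}
    (h : ∀ ε : ℝ, 0 < ε → ∃ N : ℕ, ∀ x y : ℤ, (N : ℤ) ≤ |x| + |y| → |G x y| < ε) :
    Tendsto (fun p : ℤ × ℤ => G p.1 p.2) cofinite (𝓝 0) := by
  rw [Metric.tendsto_nhds]
  intro ε hε
  obtain ⟨N, hN⟩ := h ε hε
  rw [eventually_cofinite]
  refine (Set.finite_Icc ((-N : ℤ), (-N : ℤ)) ((N : ℤ), (N : ℤ))).subset ?_
  rintro ⟨x, y⟩ hxy
  simp only [Set.mem_ofPred_eq, dist_zero_right, Real.norm_eq_abs] at hxy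
  have hlt : |x| + |y| < N := by
    by_contra! hc
    exact hxy (hN x y hc)
  have hx := abs_lt.1 (lt_of_le_of_lt (le_add_of_nonneg_right (abs_nonneg y)) hlt)
  have hy := abs_lt.1 (lt_of_le_of_lt (le_add_of_nonneg_left (abs_nonneg x)) hlt)
  simp only [Set.mem_Icc, Prod.mk_le_mk]
  omega

theorem IsSlitGreen.isReflectedGreen {g : ℤ × ℤ → ℝ} (hg : IsSlitGreen g) :
    IsReflectedGreen fun x y => g (x, |y|) := by
  obtain ⟨hoff, hslit, hharm, hrefl, hsrc, hbd, hdecay⟩ := hg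
  have hodd : ∀ x y : ℤ, Odd (x + y) → g (x, |y|) = 0 := by
    intro x y h
    refine hoff _ _ (Or.inr ?_)
    rcases abs_choice y with hy | hy <;> rw [hy]
    · exact h
    · rw [Int.odd_iff] at h ⊢
      omega
  have hpos : ∀ x y : ℤ, 1 ≤ y → 4 * g (x, |y|) = g (x - 1, |y - 1|) + g (x + 1, |y - 1|)
      + g (x - 1, |y + 1|) + g (x + 1, |y + 1|) := by
    intro x y hy
    rcases Int.even_or_odd (x + y) with h | h
    · rw [abs_of_nonneg (by omega : 0 ≤ y), abs_of_nonneg (by omega : 0 ≤ y - 1),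
        abs_of_nonneg (by omega : 0 ≤ y + 1)]
      exact hharm x y hy h
    · rw [Int.odd_iff] at h
      rw [hodd x y, hodd (x - 1) (y - 1), hodd (x + 1) (y - 1), hodd (x - 1) (y + 1),
        hodd (x + 1) (y + 1)]
      · norm_num
      all_goals rw [Int.odd_iff]; omega
  refine ⟨hodd, fun x y => by rw [abs_neg], fun x hx => by simpa using hslit x hx, ?_,
    by simpa using hsrc, fun x y => (hbd _ _).1, fun x y => (hbd _ _).2, ?_⟩
  · intro x y h
    rcases lt_trichotomy y 0 with hy | rfl | hy
    · have := hpos x (-y) (by omega)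
      rw [abs_neg, show -y - 1 = -(y + 1) by ring, abs_neg, show -y + 1 = -(y - 1) by ring,
        abs_neg] at this
      linarith
    · have hx : 0 < x := by simpa using h
      rcases Int.even_or_odd x with hev | hev
      · have := hrefl x hx hev
        norm_num
        linarith
      · rw [Int.odd_iff] at hev
        rw [hodd x 0, hodd (x - 1) (0 - 1), hodd (x + 1) (0 - 1), hodd (x - 1) (0 + 1),
          hodd (x + 1) (0 + 1)]
        · norm_num
        all_goals rw [Int.odd_iff]; omega
    · exact hpos x y (by omega)
  · refine tendsto_cofinite_of_decay (G := fun x y => g (x, |y|)) fun ε hε => ?_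
    obtain ⟨N, hN⟩ := hdecay ε hε
    exact ⟨N, fun x y h => hN x |y| (by rwa [abs_abs])⟩

/-- Maximum principle on the half-plane `y ≥ 1` with an oblique, outward-pointing reflection
on the row `y = 1`. -/
theorem nonpos_of_oblique {u : ℤ → ℤ → ℝ} (heven : ∀ x y, u (-x) y = u x y)
    (hdecay : Tendsto (fun p : ℤ × ℤ => u p.1 p.2) cofinite (𝓝 0))
    (hharm : ∀ x y, 2 ≤ y → 4 * u x y =
      u (x - 1) (y - 1) + u (x + 1) (y - 1) + u (x - 1) (y + 1) + u (x + 1) (y + 1))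
    (hparity : ∀ x, Even x → u x 1 = 0)
    (hrow : ∀ x, 3 ≤ x → Odd x → 4 * u x 1 = u x 1 + u (x + 2) 1 + u (x - 1) 2 + u (x + 1) 2)
    (hone : u 1 1 ≤ 0) (x y : ℤ) (hy : 1 ≤ y) : u x y ≤ 0 := by
  by_contra! hpos
  have hfin : {p : ℤ × ℤ | u x y ≤ u p.1 p.2}.Finite := by
    have := hdecay.eventually (gt_mem_nhds hpos)
    rw [eventually_cofinite] at this
    exact this.subset fun p hp => by simpa using hp
  obtain ⟨⟨a, b⟩, ⟨hab, hb⟩, hmax⟩ := Set.exists_max_image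
    ({p : ℤ × ℤ | u x y ≤ u p.1 p.2} ∩ {p | 1 ≤ p.2}) (fun p => u p.1 p.2)
    (hfin.inter_of_left _) ⟨(x, y), le_refl (u x y), hy⟩
  simp only [Set.mem_ofPred_eq] at hab hb
  have hle : ∀ c d, 1 ≤ d → u c d ≤ u a b := by
    intro c d hd
    rcases le_total (u x y) (u c d) with h | h
    · exact hmax (c, d) ⟨h, hd⟩
    · exact h.trans hab
  have hstep : ∀ c d, 1 ≤ d → u c d = u a b → u (c + 1) (d + 1) = u a b := by
    intro c d hd hcd
    refine le_antisymm (hle _ _ (by omega)) ?_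
    rcases (by omega : 2 ≤ d ∨ d = 1) with h2 | rfl
    · have := hharm c d h2
      linarith [hle (c - 1) (d - 1) (by omega), hle (c + 1) (d - 1) (by omega),
        hle (c - 1) (d + 1) (by omega)]
    · rcases Int.even_or_odd c with hc | hc
      · linarith [hparity c hc]
      · rw [Int.odd_iff] at hc
        rcases (by omega : 3 ≤ c ∨ c = 1 ∨ c = -1 ∨ c ≤ -3) with h | rfl | rfl | h
        · have := hrow c h (Int.odd_iff.2 hc)
          norm_num
          linarith [hle (c + 2) 1 le_rfl, hle (c - 1) 2 (by norm_num)]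
        · linarith
        · linarith [heven 1 1]
        · have := hrow (-c) (by omega) (Int.odd_iff.2 (by omega))
          rw [show -c + 2 = -(c - 2) by ring, show -c - 1 = -(c + 1) by ring,
            show -c + 1 = -(c - 1) by ring] at this
          simp only [heven] at this
          norm_num
          linarith [hle (c - 2) 1 le_rfl, hle (c - 1) 2 (by norm_num)]
  have hray : ∀ k : ℕ, u (a + k) (b + k) = u a b := by
    intro k
    induction k with
    | zero => simp
    | succ k ih =>
      have := hstep _ _ (by omega) ih
      push_cast
      rwa [← add_assoc, ← add_assoc]
  refine Set.infinite_of_injective_forall_mem (f := fun k : ℕ => (a + (k : ℤ), b + (k : ℤ)))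
    (fun k l h => ?_) (fun k => ?_) hfin
  · simpa using h
  · simpa [hray k] using hab

theorem eq_zero_of_oblique {u : ℤ → ℤ → ℝ} (heven : ∀ x y, u (-x) y = u x y)
    (hdecay : Tendsto (fun p : ℤ × ℤ => u p.1 p.2) cofinite (𝓝 0))
    (hharm : ∀ x y, 2 ≤ y → 4 * u x y =
      u (x - 1) (y - 1) + u (x + 1) (y - 1) + u (x - 1) (y + 1) + u (x + 1) (y + 1))
    (hparity : ∀ x, Even x → u x 1 = 0)
    (hrow : ∀ x, 3 ≤ x → Odd x → 4 * u x 1 = u x 1 + u (x + 2) 1 + u (x - 1) 2 + u (x + 1) 2)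
    (hone : u 1 1 = 0) (x y : ℤ) (hy : 1 ≤ y) : u x y = 0 := by
  refine le_antisymm (nonpos_of_oblique heven hdecay hharm hparity hrow hone.le x y hy) ?_
  have := nonpos_of_oblique (u := fun x y => -u x y) (fun x y => by rw [heven])
    (by simpa using hdecay.neg) (fun x y h => by linarith [hharm x y h])
    (fun x h => by rw [hparity x h, neg_zero]) (fun x h h' => by linarith [hrow x h h'])
    (by rw [hone, neg_zero]) x y hy
  linarith

namespace IsReflectedGreen

variable {G : ℤ → ℤ → ℝ}

theorem tendsto_comp (hG : IsReflectedGreen G) {α : Type*} {f : α → ℤ × ℤ}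
    (hf : Function.Injective f) : Tendsto (fun a => G (f a).1 (f a).2) cofinite (𝓝 0) :=
  hG.decay.comp hf.tendsto_cofinite

/-- The defect in the discrete Cauchy–Riemann equations between `G` and its mirror image. -/
def conjDefect (G : ℤ → ℤ → ℝ) (x y : ℤ) : ℝ :=
  G x y + G (-x) y - G (x - 1) (y - 1) - G (-x - 1) (y - 1)

theorem conjDefect_neg (x y : ℤ) : conjDefect G (-x) y = conjDefect G x y := by
  simp only [conjDefect, neg_neg]
  ring

theorem conjDefect_one_one (hG : IsReflectedGreen G) : conjDefect G 1 1 = G 0 0 - 1 := by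
  have := hG.slit (-2) (by norm_num)
  have := hG.source
  norm_num [conjDefect]
  linarith

theorem tendsto_conjDefect (hG : IsReflectedGreen G) :
    Tendsto (fun p : ℤ × ℤ => conjDefect G p.1 p.2) cofinite (𝓝 0) := by
  have h1 := hG.tendsto_comp (f := fun p : ℤ × ℤ => (-p.1, p.2))
    (fun p q h => by simpa [Prod.ext_iff] using h)
  have h2 := hG.tendsto_comp (f := fun p : ℤ × ℤ => (p.1 - 1, p.2 - 1))
    (fun p q h => by simpa [Prod.ext_iff] using h)
  have h3 := hG.tendsto_comp (f := fun p : ℤ × ℤ => (-p.1 - 1, p.2 - 1))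
    (fun p q h => by simpa [Prod.ext_iff] using h)
  simpa [conjDefect] using ((hG.decay.add h1).sub h2).sub h3

theorem conjDefect_harm (hG : IsReflectedGreen G) (x y : ℤ) (hy : 2 ≤ y) :
    4 * conjDefect G x y = conjDefect G (x - 1) (y - 1) + conjDefect G (x + 1) (y - 1)
      + conjDefect G (x - 1) (y + 1) + conjDefect G (x + 1) (y + 1) := by
  have h1 := hG.harm x y (by omega)
  have h2 := hG.harm (-x) y (by omega)
  have h3 := hG.harm (x - 1) (y - 1) (by omega)
  have h4 := hG.harm (-x - 1) (y - 1) (by omega)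
  simp only [conjDefect]
  ring_nf at *
  linarith

theorem conjDefect_parity (hG : IsReflectedGreen G) (x : ℤ) (hx : Even x) :
    conjDefect G x 1 = 0 := by
  rw [Int.even_iff] at hx
  rw [conjDefect, hG.parity, hG.parity, hG.parity, hG.parity]
  · norm_num
  all_goals rw [Int.odd_iff]; omega

theorem conjDefect_row (hG : IsReflectedGreen G) (x : ℤ) (hx : 3 ≤ x) :
    4 * conjDefect G x 1 = conjDefect G x 1 + conjDefect G (x + 2) 1
      + conjDefect G (x - 1) 2 + conjDefect G (x + 1) 2 := by
  have h1 := hG.harm x 1 (by omega)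
  have h2 := hG.harm (-x) 1 (by omega)
  have h3 := hG.harm (x - 1) 0 (by omega)
  have h4 := hG.harm (x + 1) 0 (by omega)
  have h5 := hG.slit (-x - 1) (by omega)
  have h6 := hG.slit (-x + 1) (by omega)
  have h7 := hG.slit (-x - 3) (by omega)
  have h8 := fun x => hG.symm x 1
  simp only [conjDefect]
  norm_num at h1 h2 h3 h4 h8 ⊢
  simp only [h8] at *
  ring_nf at *
  linarith

/-- The tent function of half-width `N`. -/
def tent (N : ℕ) (x : ℤ) : ℝ := max 0 (N - |(x : ℝ)|)

theorem tent_nonneg (N : ℕ) (x : ℤ) : 0 ≤ tent N x := le_max_left _ _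

theorem tent_le (N : ℕ) (x : ℤ) : tent N x ≤ N :=
  max_le (Nat.cast_nonneg N) (by linarith [abs_nonneg (x : ℝ)])

theorem tent_eq_zero {N : ℕ} {x : ℤ} (h : (N : ℤ) ≤ |x|) : tent N x = 0 := by
  have : (N : ℝ) ≤ |(x : ℝ)| := by exact_mod_cast h
  exact max_eq_left (by linarith)

theorem tent_neg (N : ℕ) (x : ℤ) : tent N (-x) = tent N x := by simp [tent]

theorem sub_one_le_tent_one (N : ℕ) : (N : ℝ) - 1 ≤ tent N 1 := by simp [tent]

theorem tent_succ_le (N : ℕ) {x : ℤ} (hx : 0 ≤ x) : tent N (x + 1) ≤ tent N x := by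
  have hx' : (0 : ℝ) ≤ x := by exact_mod_cast hx
  simp only [tent]
  push_cast
  rw [abs_of_nonneg hx', abs_of_nonneg (by linarith)]
  exact max_le_max le_rfl (by linarith)

theorem tent_second_difference (N : ℕ) (x : ℤ) :
    2 * tent N x - (if x = 0 then 2 else 0) ≤ tent N (x + 1) + tent N (x - 1) := by
  have key : |(x : ℝ) + 1| + |(x : ℝ) - 1| ≤ 2 * |(x : ℝ)| + if x = 0 then 2 else 0 := by
    rcases lt_trichotomy x 0 with h | rfl | h
    · have h' : (x : ℝ) ≤ -1 := by exact_mod_cast (by omega : x ≤ -1)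
      rw [abs_of_nonpos (by linarith), abs_of_nonpos (by linarith), abs_of_nonpos (by linarith),
        if_neg h.ne]
      linarith
    · norm_num
    · have h' : (1 : ℝ) ≤ x := by exact_mod_cast h
      rw [abs_of_nonneg (by linarith), abs_of_nonneg (by linarith), abs_of_nonneg (by linarith),
        if_neg h.ne']
      linarith
  have h1 : (N : ℝ) - |(x : ℝ) + 1| ≤ tent N (x + 1) := by simp [tent]
  have h2 : (N : ℝ) - |(x : ℝ) - 1| ≤ tent N (x - 1) := by simp [tent]
  have h3 := tent_nonneg N (x + 1)
  have h4 := tent_nonneg N (x - 1)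
  have h5 : (0 : ℝ) ≤ if x = 0 then 2 else 0 := by split_ifs <;> norm_num
  rcases max_choice (0 : ℝ) (N - |(x : ℝ)|) with h | h <;> rw [tent, h] <;> linarith

theorem summable_tent_mul (N : ℕ) (a : ℤ) (φ : ℤ → ℝ) :
    Summable fun x => tent N (x + a) * φ x := by
  refine summable_of_hasFiniteSupport ((Set.finite_Icc (-N - a) (N - a)).subset fun x hx => ?_)
  by_contra h
  refine hx ?_
  simp only
  rw [tent_eq_zero, zero_mul]
  rw [Set.mem_Icc] at h
  rw [le_abs]
  omega

theorem tsum_tent_mul_shift (N : ℕ) (a : ℤ) (φ : ℤ → ℝ) :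
    ∑' x, tent N x * φ (x + a) = ∑' x, tent N (x - a) * φ x := by
  rw [← (Equiv.addRight a).tsum_eq fun x => tent N (x - a) * φ x]
  simp

/-- The tent-weighted sum of `G` over the row at height `y`. -/
noncomputable def rowSum (G : ℤ → ℤ → ℝ) (N : ℕ) (y : ℤ) : ℝ := ∑' x, tent N x * G x y

theorem summable_row (N : ℕ) (φ : ℤ → ℝ) : Summable fun x => tent N x * φ x := by
  simpa using summable_tent_mul N 0 φ

theorem rowSum_nonneg (hG : IsReflectedGreen G) (N : ℕ) (y : ℤ) : 0 ≤ rowSum G N y :=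
  tsum_nonneg fun _ => mul_nonneg (tent_nonneg _ _) (hG.nonneg _ _)

theorem tsum_tent_neighbours (hG : IsReflectedGreen G) (N : ℕ) (y : ℤ) :
    2 * rowSum G N y - 2 * G 0 y ≤ ∑' x, tent N x * (G (x - 1) y + G (x + 1) y) := by
  have hsplit : ∑' x, tent N x * (G (x - 1) y + G (x + 1) y)
      = ∑' x, (tent N (x + 1) + tent N (x - 1)) * G x y := by
    simp only [mul_add, add_mul]
    rw [(summable_row N fun x => G (x - 1) y).tsum_add (summable_row N fun x => G (x + 1) y),
      (summable_tent_mul N 1 fun x => G x y).tsum_add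
        (by simpa only [← sub_eq_add_neg] using summable_tent_mul N (-1) fun x => G x y)]
    congr 1
    · simpa [← sub_eq_add_neg] using tsum_tent_mul_shift N (-1) fun x => G x y
    · exact tsum_tent_mul_shift N 1 fun x => G x y
  have hzero : Summable fun x : ℤ => (if x = 0 then 2 else 0) * G x y :=
    summable_of_hasFiniteSupport ((Set.finite_singleton 0).subset fun x hx => by
      by_contra h
      exact hx (by simp_all))
  have hval : ∑' x : ℤ, (if x = 0 then 2 else 0) * G x y = 2 * G 0 y := by
    rw [tsum_eq_single 0 (fun x hx => by simp [hx])]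
    simp
  rw [hsplit, rowSum, ← tsum_mul_left, ← hval, ← ((summable_row N _).mul_left 2).tsum_sub hzero]
  refine Summable.tsum_le_tsum (fun x => ?_) (((summable_row N _).mul_left 2).sub hzero) ?_
  · rw [← mul_assoc, ← sub_mul]
    exact mul_le_mul_of_nonneg_right (tent_second_difference N x) (hG.nonneg _ _)
  · simp only [add_mul]
    exact (summable_tent_mul N 1 _).add (summable_tent_mul N (-1) _)

theorem rowSum_concave (hG : IsReflectedGreen G) (N : ℕ) (y : ℤ) (hy : 1 ≤ y) :
    rowSum G N (y + 1) - rowSum G N y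
      ≤ rowSum G N y - rowSum G N (y - 1) + G 0 (y - 1) + G 0 (y + 1) := by
  have h : 4 * rowSum G N y = ∑' x, tent N x * (G (x - 1) (y - 1) + G (x + 1) (y - 1))
      + ∑' x, tent N x * (G (x - 1) (y + 1) + G (x + 1) (y + 1)) := by
    rw [rowSum, ← tsum_mul_left, ← (summable_row N _).tsum_add (summable_row N _)]
    refine tsum_congr fun x => ?_
    linear_combination tent N x * hG.harm x y (by omega)
  linarith [hG.tsum_tent_neighbours N (y - 1), hG.tsum_tent_neighbours N (y + 1)]

theorem rowSum_increment_le (hG : IsReflectedGreen G) (N n : ℕ) :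
    rowSum G N (n + 1) - rowSum G N n
      ≤ rowSum G N 1 - rowSum G N 0 + 2 * ∑ k ∈ Finset.range (n + 2), G 0 k := by
  have key : rowSum G N (n + 1) - rowSum G N n ≤ rowSum G N 1 - rowSum G N 0
      + ∑ k ∈ Finset.range n, G 0 k + ∑ k ∈ Finset.range (n + 2), G 0 k := by
    induction n with
    | zero =>
      simp only [Finset.sum_range_succ, Finset.sum_range_zero]
      push_cast
      norm_num
      linarith [hG.nonneg 0 0, hG.nonneg 0 1]
    | succ n ih =>
      have := hG.rowSum_concave N (n + 1) (by omega)
      rw [Finset.sum_range_succ, Finset.sum_range_succ _ (n + 2)]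
      push_cast
      rw [add_sub_cancel_right] at this
      rw [show (n : ℤ) + 2 = n + 1 + 1 by ring]
      linarith
  have hmono : ∑ k ∈ Finset.range n, G 0 k ≤ ∑ k ∈ Finset.range (n + 2), G 0 k :=
    Finset.sum_le_sum_of_subset_of_nonneg (Finset.range_mono (by omega))
      fun _ _ _ => hG.nonneg _ _
  linarith

theorem rowSum_zero_le (hG : IsReflectedGreen G) (N : ℕ) :
    rowSum G N 0 ≤ N * ∑ k ∈ Finset.range N, G k 0 := by
  have h : rowSum G N 0 = ∑ k ∈ Finset.range N, tent N k * G k 0 := by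
    rw [rowSum, tsum_eq_sum (s := (Finset.range N).map Nat.castEmbedding)]
    · simp
    · intro x hx
      simp only [Finset.mem_map, Finset.mem_range, Nat.castEmbedding_apply, not_exists,
        not_and] at hx
      rcases lt_or_ge x 0 with h | h
      · rw [hG.slit x h, mul_zero]
      · rw [tent_eq_zero, zero_mul]
        by_contra! hlt
        rw [abs_of_nonneg h] at hlt
        exact hx x.toNat (by omega) (by omega)
  rw [h, Finset.mul_sum]
  exact Finset.sum_le_sum fun k _ => mul_le_mul_of_nonneg_right (tent_le _ _) (hG.nonneg _ _)

theorem le_rowSum_increment (hG : IsReflectedGreen G) (N : ℕ) (hN : 0 < N) :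
    -(∑ k ∈ Finset.range N, G k 0 + 2 * ∑ k ∈ Finset.range (N + 1), G 0 k)
      ≤ rowSum G N 1 - rowSum G N 0 := by
  set d := rowSum G N 1 - rowSum G N 0
  set Y := ∑ k ∈ Finset.range (N + 1), G 0 k
  have htel : rowSum G N N - rowSum G N 0 ≤ N * (d + 2 * Y) := by
    have := Finset.sum_range_sub (fun n : ℕ => rowSum G N n) N
    rw [Nat.cast_zero] at this
    rw [← this, ← nsmul_eq_mul]
    conv_rhs => rw [← Finset.card_range N]
    refine Finset.sum_le_card_nsmul _ _ _ fun n hn => ?_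
    rw [Finset.mem_range] at hn
    have hmono : ∑ k ∈ Finset.range (n + 2), G 0 k ≤ Y :=
      Finset.sum_le_sum_of_subset_of_nonneg (Finset.range_mono (by omega))
        fun _ _ _ => hG.nonneg _ _
    push_cast
    linarith [hG.rowSum_increment_le N n]
  have hN' : (0 : ℝ) < N := by exact_mod_cast hN
  have : 0 ≤ (N : ℝ) * (∑ k ∈ Finset.range N, G k 0 + (d + 2 * Y)) := by
    rw [mul_add]
    linarith [hG.rowSum_zero_le N, hG.rowSum_nonneg N N]
  linarith [nonneg_of_mul_nonneg_right this hN']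

theorem conjDefect_nonpos (hG : IsReflectedGreen G) (x y : ℤ) (hy : 1 ≤ y) :
    conjDefect G x y ≤ 0 :=
  nonpos_of_oblique conjDefect_neg hG.tendsto_conjDefect hG.conjDefect_harm hG.conjDefect_parity
    (fun x hx _ => hG.conjDefect_row x hx)
    (by rw [hG.conjDefect_one_one]; linarith [hG.le_one 0 0]) x y hy

theorem rowSum_increment_le_defect (hG : IsReflectedGreen G) (N : ℕ) :
    2 * (rowSum G N 1 - rowSum G N 0) ≤ (N - 1) * (G 0 0 - 1) := by
  have hneg : ∀ φ : ℤ → ℝ, ∑' x, tent N x * φ (-x) = ∑' x, tent N x * φ x := by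
    intro φ
    rw [← (Equiv.neg ℤ).tsum_eq fun x => tent N x * φ x]
    simp [tent_neg]
  have hshift : ∑' x, tent N x * G (x - 1) 0 ≤ rowSum G N 0 := by
    have := tsum_tent_mul_shift N (-1) fun x => G x 0
    simp only [sub_neg_eq_add, ← sub_eq_add_neg] at this
    rw [this, rowSum]
    refine Summable.tsum_le_tsum (fun x => ?_) (summable_tent_mul N 1 _) (summable_row N _)
    rcases lt_or_ge x 0 with h | h
    · simp [hG.slit x h]
    · exact mul_le_mul_of_nonneg_right (tent_succ_le N h) (hG.nonneg _ _)
  have hsum : ∑' x, tent N x * conjDefect G x 1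
      = 2 * rowSum G N 1 - 2 * ∑' x, tent N x * G (x - 1) 0 := by
    have e : ∀ x, tent N x * conjDefect G x 1 = tent N x * G x 1 + tent N x * G (-x) 1
        - tent N x * G (x - 1) 0 - tent N x * G (-x - 1) 0 := by
      intro x
      simp only [conjDefect, sub_self]
      ring
    simp only [e]
    have s1 := summable_row N fun x => G x 1
    have s2 := summable_row N fun x => G (-x) 1
    have s3 := summable_row N fun x => G (x - 1) 0
    have s4 := summable_row N fun x => G (-x - 1) 0
    rw [((s1.add s2).sub s3).tsum_sub s4, (s1.add s2).tsum_sub s3, s1.tsum_add s2,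
      hneg fun x => G x 1, hneg fun x => G (x - 1) 0, rowSum]
    ring
  have hle : ∑' x, tent N x * conjDefect G x 1 ≤ tent N 1 * conjDefect G 1 1 := by
    have := (summable_row N fun x => -conjDefect G x 1).le_tsum 1 fun x _ =>
      mul_nonneg (tent_nonneg N x) (neg_nonneg.2 (hG.conjDefect_nonpos x 1 le_rfl))
    simp only [mul_neg, tsum_neg] at this
    linarith
  rw [hG.conjDefect_one_one] at hle
  have := mul_le_mul_of_nonneg_right (sub_one_le_tent_one N)
    (by linarith [hG.le_one 0 0] : (0 : ℝ) ≤ 1 - G 0 0)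
  linarith

/-- The effective resistance of the slit half-plane seen from the tip of the slit is one. -/
theorem origin_eq_one (hG : IsReflectedGreen G) : G 0 0 = 1 := by
  refine le_antisymm (hG.le_one 0 0) ?_
  by_contra! hlt
  have hnat : Tendsto (Nat.cast : ℕ → ℤ) atTop cofinite := by
    rw [← Nat.cofinite_eq_atTop]
    exact Nat.cast_injective.tendsto_cofinite
  have h1 := (hG.tendsto_comp (f := fun x : ℤ => (x, 0))
    (fun a b h => by simpa using h)).comp hnat
  have h2 := (hG.tendsto_comp (f := fun x : ℤ => (0, x))
    (fun a b h => by simpa using h)).comp hnat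
  have hces := (h1.add h2).cesaro
  simp only [Function.comp_apply, add_zero] at hces
  obtain ⟨M, hM, hM4⟩ := ((hces.eventually (gt_mem_nhds
    (by linarith : (0 : ℝ) < (1 - G 0 0) / 8))).and (eventually_ge_atTop 4)).exists
  obtain ⟨N, rfl⟩ : ∃ N, M = N + 1 := ⟨M - 1, by omega⟩
  have hN : (3 : ℝ) ≤ N := by exact_mod_cast (by omega : 3 ≤ N)
  have hlow := hG.le_rowSum_increment N (by omega)
  have hup := hG.rowSum_increment_le_defect N
  have hX : ∑ k ∈ Finset.range N, G k 0 ≤ ∑ k ∈ Finset.range (N + 1), G k 0 :=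
    Finset.sum_le_sum_of_subset_of_nonneg (Finset.range_mono (by omega))
      fun _ _ _ => hG.nonneg _ _
  have hX0 : 0 ≤ ∑ k ∈ Finset.range (N + 1), G k 0 := Finset.sum_nonneg fun _ _ => hG.nonneg _ _
  rw [inv_mul_lt_iff₀ (by positivity), Finset.sum_add_distrib] at hM
  push_cast at hM
  nlinarith

theorem conjDefect_eq_zero (hG : IsReflectedGreen G) (x y : ℤ) (hy : 1 ≤ y) :
    conjDefect G x y = 0 :=
  eq_zero_of_oblique conjDefect_neg hG.tendsto_conjDefect hG.conjDefect_harm hG.conjDefect_parity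
    (fun x hx _ => hG.conjDefect_row x hx)
    (by rw [hG.conjDefect_one_one, hG.origin_eq_one, sub_self]) x y hy

/-- The defect between the even part of `G` and a multiple of its image under a quarter turn. -/
def turnDefect (G : ℤ → ℤ → ℝ) (c : ℝ) (x y : ℤ) : ℝ :=
  G x y + G (-x) y - c * (G (y - 1) (x - 1) + G (y - 1) (x + 1))

theorem turnDefect_neg (hG : IsReflectedGreen G) (c : ℝ) (x y : ℤ) :
    turnDefect G c (-x) y = turnDefect G c x y := by
  simp only [turnDefect, neg_neg]
  rw [show -x - 1 = -(x + 1) by ring, show -x + 1 = -(x - 1) by ring, hG.symm, hG.symm]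
  ring

theorem tendsto_turnDefect (hG : IsReflectedGreen G) (c : ℝ) :
    Tendsto (fun p : ℤ × ℤ => turnDefect G c p.1 p.2) cofinite (𝓝 0) := by
  have h1 := hG.tendsto_comp (f := fun p : ℤ × ℤ => (-p.1, p.2))
    (fun p q h => by simpa [Prod.ext_iff] using h)
  have h2 := hG.tendsto_comp (f := fun p : ℤ × ℤ => (p.2 - 1, p.1 - 1))
    (fun p q h => by simpa [Prod.ext_iff, and_comm] using h)
  have h3 := hG.tendsto_comp (f := fun p : ℤ × ℤ => (p.2 - 1, p.1 + 1))
    (fun p q h => by simpa [Prod.ext_iff, and_comm] using h)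
  simpa [turnDefect] using (hG.decay.add h1).sub ((h2.add h3).const_mul c)

theorem turnDefect_harm (hG : IsReflectedGreen G) (c : ℝ) (x y : ℤ) (hy : 2 ≤ y) :
    4 * turnDefect G c x y = turnDefect G c (x - 1) (y - 1) + turnDefect G c (x + 1) (y - 1)
      + turnDefect G c (x - 1) (y + 1) + turnDefect G c (x + 1) (y + 1) := by
  have h1 := hG.harm x y (by omega)
  have h2 := hG.harm (-x) y (by omega)
  have h3 := hG.harm (y - 1) (x - 1) (by omega)
  have h4 := hG.harm (y - 1) (x + 1) (by omega)
  simp only [turnDefect]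
  rw [show -(x - 1) = -x + 1 by ring, show -(x + 1) = -x - 1 by ring,
    show y + 1 - 1 = y - 1 + 1 by ring]
  linear_combination h1 + h2 - c * (h3 + h4)

theorem turnDefect_parity (hG : IsReflectedGreen G) (c : ℝ) (x : ℤ) (hx : Even x) :
    turnDefect G c x 1 = 0 := by
  rw [Int.even_iff] at hx
  rw [turnDefect, hG.parity, hG.parity, hG.parity, hG.parity]
  · norm_num
  all_goals rw [Int.odd_iff]; omega

theorem axis_eq (hG : IsReflectedGreen G) (m : ℤ) (hm : 1 ≤ m) : G (-1) (m - 1) = G 0 m := by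
  have := hG.conjDefect_eq_zero 0 m hm
  norm_num [conjDefect] at this
  linarith

theorem even_part_row_one (hG : IsReflectedGreen G) (x : ℤ) (hx : 1 ≤ x) :
    G x 1 + G (-x) 1 = G (x - 1) 0 := by
  have := hG.conjDefect_eq_zero x 1 le_rfl
  have := hG.slit (-x - 1) (by omega)
  simp only [conjDefect, sub_self] at *
  linarith

theorem turnDefect_row (hG : IsReflectedGreen G) (c : ℝ) (x : ℤ) (hx : 3 ≤ x) :
    4 * turnDefect G c x 1 = turnDefect G c x 1 + turnDefect G c (x + 2) 1
      + turnDefect G c (x - 1) 2 + turnDefect G c (x + 1) 2 := by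
  have h1 := hG.harm x 1 (by omega)
  have h2 := hG.harm (-x) 1 (by omega)
  have h3 := hG.harm 0 (x - 1) (by omega)
  have h4 := hG.harm 0 (x + 1) (by omega)
  have a1 := hG.axis_eq (x - 1) (by omega)
  have a2 := hG.axis_eq (x + 1) (by omega)
  have a3 := hG.axis_eq (x + 3) (by omega)
  have b1 := hG.even_part_row_one x (by omega)
  have b2 := hG.even_part_row_one (x + 2) (by omega)
  have s1 := hG.slit (-x - 1) (by omega)
  have s2 := hG.slit (-x + 1) (by omega)
  simp only [turnDefect]
  norm_num at h1 h2 h3 h4 ⊢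
  ring_nf at *
  linear_combination h1 + h2 - c * (h3 + h4) - b1 - b2 - c * (a1 + 2 * a2 + a3) + s1 + s2

/-- The even part of `G` is proportional to a quarter turn of `G`; the factor is fixed by the
value at the tip of the slit. -/
theorem turnDefect_eq_zero (hG : IsReflectedGreen G) {c : ℝ} (hc : c * (1 + G 0 2) = 1)
    (x y : ℤ) (hy : 1 ≤ y) : turnDefect G c x y = 0 := by
  refine eq_zero_of_oblique (hG.turnDefect_neg c) (hG.tendsto_turnDefect c) (hG.turnDefect_harm c)
    (hG.turnDefect_parity c) (fun x hx _ => hG.turnDefect_row c x hx) ?_ x y hy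
  have h := hG.even_part_row_one 1 le_rfl
  have h0 := hG.origin_eq_one
  norm_num [turnDefect] at h ⊢
  linear_combination h + h0 - hc - c * h0

theorem factor_eq (hG : IsReflectedGreen G) : 1 + G 0 2 = √2 := by
  have hpos : 0 < 1 + G 0 2 := by linarith [hG.nonneg 0 2]
  have h := hG.turnDefect_eq_zero (inv_mul_cancel₀ hpos.ne') 0 2 (by norm_num)
  have ha := hG.axis_eq 2 (by norm_num)
  have hb := hG.even_part_row_one 1 le_rfl
  have h0 := hG.origin_eq_one
  have hs := hG.symm 1 1
  norm_num [turnDefect] at h ha hb hs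
  rw [hs] at h
  field_simp at h
  refine ((Real.sqrt_eq_iff_mul_self_eq_of_pos hpos).2 ?_).symm
  nlinarith

theorem vertical_recurrence (hG : IsReflectedGreen G) (m : ℤ) (hm : 0 ≤ m) :
    G 0 m + G 0 (m + 2) = √2 * G m 0 := by
  have hpos : 0 < 1 + G 0 2 := by linarith [hG.nonneg 0 2]
  have h := hG.turnDefect_eq_zero (inv_mul_cancel₀ hpos.ne') (m + 1) 1 le_rfl
  have hb := hG.even_part_row_one (m + 1) (by omega)
  rw [turnDefect, hb, hG.factor_eq] at h
  norm_num at h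
  rw [show m + 1 + 1 = m + 2 by ring] at h
  field_simp at h
  linarith

end IsReflectedGreen

/-- The recurrence relating the values of the slit-plane Green's function on the
vertical axis to those on the horizontal axis:
`g(0,2k) + g(0,2k+2) = √2 · g(2k,0)`. -/
theorem slitGreen_vertical_recurrence (g : ℤ × ℤ → ℝ) (hg : IsSlitGreen g) :
    ∀ k : ℕ, g (0, 2 * (k : ℤ)) + g (0, 2 * (k : ℤ) + 2) =
      Real.sqrt 2 * g (2 * (k : ℤ), 0) := by
  intro k
  have h := hg.isReflectedGreen.vertical_recurrence (2 * (k : ℤ)) (by positivity)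
  simpa only [abs_zero, abs_of_nonneg (by positivity : (0 : ℤ) ≤ 2 * (k : ℤ)),
    abs_of_nonneg (by positivity : (0 : ℤ) ≤ 2 * (k : ℤ) + 2)] using h
end
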